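/- arXiv:2404.05194 — 5 statements merged into one kernel-verified Lean document; each statement's English description precedes it below -/
import Mathlib

section
/- The group presented by generators a, b subject to the relations a^2 = b^11 = (b*a)^3 = (b^2*a*b^6*a)^3 = 1 is isomorphic to PSL(2, 11). -/
abbrev PSL2_11 :=
  Matrix.SpecialLinearGroup (Fin 2) (ZMod 11) ⧸
    Subgroup.center (Matrix.SpecialLinearGroup (Fin 2) (ZMod 11))

namespace Stmt1

local notation "a" => FreeGroup.of (0 : Fin 2)
local notation "b" => FreeGroup.of (1 : Fin 2)

def rels : Set (FreeGroup (Fin 2)) :=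
  {a ^ 2, b ^ 11, (b * a) ^ 3, (b ^ 2 * a * b ^ 6 * a) ^ 3}

section Words

variable {G : Type*} [Group G] {x y : G}

/-- The torus element. -/
def tor (x y : G) : G := y ^ 2 * x * y ^ 6 * x * y ^ 2 * x

/-- Mennicke's relation. -/
theorem mennicke (hx : x * x = 1) (hy : y ^ 11 = 1) (hxy : (y * x) ^ 3 = 1)
    (h : (y ^ 2 * x * y ^ 6 * x) ^ 3 = 1) :
    (y ^ 2 * x * y ^ 6 * x * y ^ 2) * (y ^ 2 * x * y ^ 6 * x * y ^ 2) = 1 := by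
  obtain ⟨d, hd⟩ : ∃ d, d = x * y ^ 6 * x := ⟨_, rfl⟩
  have hxi : x⁻¹ = x := inv_eq_of_mul_eq_one_left hx
  have hdd : d * d = x * y * x := by
    have : d * d = x * y ^ 6 * (x * x) * y ^ 6 * x := by rw [hd]; group
    rw [this, hx]
    have : x * y ^ 6 * 1 * y ^ 6 * x = x * (y ^ 11 * y) * x := by group
    rw [this, hy, one_mul]
  have h3 : y * x * y = x * y⁻¹ * x := by
    have : y * x * y * (x * y * x) = 1 := by rw [← hxy]; simp only [pow_succ, pow_zero]; group
    rw [eq_inv_of_mul_eq_one_left this]; simp [mul_assoc, hxi]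
  have h4 : y ^ 2 * d * y ^ 2 * d * y ^ 2 * d = 1 := by
    rw [← h, hd]; simp only [pow_succ, pow_zero]; group
  -- y² d² y² = d⁻²
  have h5 : y ^ 2 * (d * d) * y ^ 2 = (d * d)⁻¹ := by
    rw [hdd]
    have : y ^ 2 * (x * y * x) * y ^ 2 = y * (y * x * y) * x * y * y := by
      simp only [pow_two, mul_assoc]
    rw [this, h3]
    have : y * (x * y⁻¹ * x) * x * y * y = y * x * y⁻¹ * (x * x) * y * y := by group
    rw [this, hx]
    have : y * x * y⁻¹ * 1 * y * y = y * x * y := by group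
    rw [this, h3]; simp [mul_assoc, hxi]
  have e1 : y ^ 2 * d = d⁻¹ * (y ^ 2)⁻¹ * d⁻¹ * (y ^ 2)⁻¹ := by
    have : y ^ 2 * d * (y ^ 2 * d * y ^ 2 * d) = 1 := by rw [← h4]; group
    rw [eq_inv_of_mul_eq_one_left this]; group
  have e2 : d * y ^ 2 = (y ^ 2)⁻¹ * d⁻¹ * (y ^ 2)⁻¹ * d⁻¹ := by
    have : y ^ 2 * d * y ^ 2 * d * (y ^ 2 * d) = 1 := by rw [← h4]; group
    have h' := eq_inv_of_mul_eq_one_left this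
    have : d * y ^ 2 = (y ^ 2)⁻¹ * (y ^ 2 * d * y ^ 2 * d) * d⁻¹ := by group
    rw [this, h']; group
  have h6 : (d * d)⁻¹ = d⁻¹ * (y ^ 2)⁻¹ * d⁻¹ * (y ^ 2)⁻¹ * ((y ^ 2)⁻¹ * d⁻¹ * (y ^ 2)⁻¹ * d⁻¹) := by
    rw [← e1, ← e2, ← h5]; group
  have h7 : (y ^ 2)⁻¹ * d⁻¹ * (y ^ 2)⁻¹ * (y ^ 2)⁻¹ * d⁻¹ * (y ^ 2)⁻¹ = 1 := by
    have : (y ^ 2)⁻¹ * d⁻¹ * (y ^ 2)⁻¹ * (y ^ 2)⁻¹ * d⁻¹ * (y ^ 2)⁻¹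
      = d * (d⁻¹ * (y ^ 2)⁻¹ * d⁻¹ * (y ^ 2)⁻¹ * ((y ^ 2)⁻¹ * d⁻¹ * (y ^ 2)⁻¹ * d⁻¹)) * d := by
      group
    rw [this, ← h6]; group
  have h8 : (y ^ 2 * d * y ^ 2) * (y ^ 2 * d * y ^ 2) = 1 := by
    have := congrArg (·⁻¹) h7
    simp only [inv_one] at this
    rw [← this]; group
  rw [← h8, hd]; group

theorem tor_conj (hx : x * x = 1) (hy : y ^ 11 = 1) (hxy : (y * x) ^ 3 = 1)
    (h : (y ^ 2 * x * y ^ 6 * x) ^ 3 = 1) : tor x y * y = y ^ 4 * tor x y := by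
  have hw := mennicke hx hy hxy h
  obtain ⟨d, hd⟩ : ∃ d, d = x * y ^ 6 * x := ⟨_, rfl⟩
  obtain ⟨w, hwd⟩ : ∃ w, w = y ^ 2 * d * y ^ 2 := ⟨_, rfl⟩
  have ht : tor x y = w * x := by rw [hwd, hd, tor]; group
  have hw : w * w = 1 := by rw [← hw, hwd, hd]; group
  have h4 : w * (d * y ^ 2 * d) = 1 := by
    rw [← h, hwd, hd]; simp only [pow_succ, pow_zero]; group
  have h5 : w = d * y ^ 2 * d := mul_left_cancel (hw.trans h4.symm)
  have h6 : w * d = y ^ 2 * w := by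
    calc w * d = y ^ 2 * (d * y ^ 2 * d) := by rw [hwd]; group
      _ = _ := by rw [← h5]
  have h7 : tor x y * y ^ 6 = y ^ 2 * tor x y := by
    rw [ht]
    calc w * x * y ^ 6 = w * x * y ^ 6 * (x * x) := by rw [hx, mul_one]
      _ = w * d * x := by rw [hd]; group
      _ = _ := by rw [h6]; group
  have h8 : tor x y * (y ^ 6) ^ 2 = (y ^ 2) ^ 2 * tor x y :=
    ((show SemiconjBy (tor x y) (y ^ 6) (y ^ 2) from h7).pow_right 2)
  have : y = (y ^ 6) ^ 2 := by
    rw [← pow_mul, show 6 * 2 = 11 + 1 by norm_num, pow_succ, hy, one_mul]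
  calc tor x y * y = tor x y * (y ^ 6) ^ 2 := by rw [← this]
    _ = _ := by rw [h8, ← pow_mul]

theorem tor_inv (hx : x * x = 1) (hy : y ^ 11 = 1) (hxy : (y * x) ^ 3 = 1)
    (h : (y ^ 2 * x * y ^ 6 * x) ^ 3 = 1) : x * tor x y = (tor x y)⁻¹ * x := by
  have hw := mennicke hx hy hxy h
  have hxi : x⁻¹ = x := inv_eq_of_mul_eq_one_left hx
  obtain ⟨w, hwd⟩ : ∃ w, w = y ^ 2 * x * y ^ 6 * x * y ^ 2 := ⟨_, rfl⟩
  rw [← hwd] at hw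
  have ht : tor x y = w * x := by rw [hwd, tor]
  have hwi : w⁻¹ = w := inv_eq_of_mul_eq_one_left hw
  rw [ht, mul_inv_rev, hxi, hwi, mul_assoc]

theorem ypow (hy : y ^ 11 = 1) (m n : ℕ) (hmn : m % 11 = n % 11) : y ^ m = y ^ n := by
  rw [← Nat.div_add_mod m 11, ← Nat.div_add_mod n 11, pow_add, pow_add, pow_mul, pow_mul, hy, hmn]
  simp

theorem tor_pow (hx : x * x = 1) (hy : y ^ 11 = 1) (hxy : (y * x) ^ 3 = 1)
    (h : (y ^ 2 * x * y ^ 6 * x) ^ 3 = 1) (j i : ℕ) : tor x y ^ j * y ^ i = y ^ (4 ^ j * i) * tor x y ^ j := by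
  have h1 : ∀ i, tor x y * y ^ i = y ^ (4 * i) * tor x y := by
    intro i
    have := (show SemiconjBy (tor x y) y (y ^ 4) from tor_conj hx hy hxy h).pow_right i
    rw [← pow_mul] at this
    exact this
  induction j generalizing i with
  | zero => simp
  | succ j ih =>
    rw [pow_succ, mul_assoc, h1, ← mul_assoc, ih, mul_assoc]
    congr 2
    ring

theorem tor_pow' (hx : x * x = 1) (hy : y ^ 11 = 1) (hxy : (y * x) ^ 3 = 1)
    (h : (y ^ 2 * x * y ^ 6 * x) ^ 3 = 1) (j i : ℕ) : y ^ i * tor x y ^ j = tor x y ^ j * y ^ (3 ^ j * i) := by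
  rw [tor_pow hx hy hxy h]
  congr 1
  apply ypow hy
  rw [← mul_assoc, ← mul_pow, Nat.mul_mod, Nat.pow_mod]
  norm_num

theorem x_tor (hx : x * x = 1) (hy : y ^ 11 = 1) (hxy : (y * x) ^ 3 = 1)
    (h : (y ^ 2 * x * y ^ 6 * x) ^ 3 = 1) (j : ℕ) : x * tor x y ^ j = (tor x y ^ j)⁻¹ * x := by
  rw [← inv_pow]
  exact (show SemiconjBy x (tor x y) (tor x y)⁻¹ from tor_inv hx hy hxy h).pow_right j

theorem key (hx : x * x = 1) (hy : y ^ 11 = 1) (hxy : (y * x) ^ 3 = 1)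
    (h : (y ^ 2 * x * y ^ 6 * x) ^ 3 = 1) (k : ℕ) : x * y ^ (3 ^ k) * x =
    y ^ (10 * 4 ^ k) * tor x y ^ (2 * k) * x * y ^ (10 * 4 ^ k) := by
  have hxi : x⁻¹ = x := inv_eq_of_mul_eq_one_left hx
  have h10 : y ^ 10 = y⁻¹ := eq_inv_of_mul_eq_one_left (by rw [← pow_succ, hy])
  have h3 : x * y * x = y ^ 10 * x * y ^ 10 := by
    have : x * y * x * (y * x * y) = 1 := by
      have h2 : (x * y) ^ 3 = 1 := by
        have : (x * y) ^ 3 = x * (y * x) ^ 3 * x⁻¹ := by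
          simp only [pow_succ, pow_zero]; group
        rw [this, hxy]; group
      rw [← h2]; simp only [pow_succ, pow_zero]; group
    rw [eq_inv_of_mul_eq_one_left this, h10]; simp [hxi, mul_assoc]
  have e := tor_pow' hx hy hxy h k 1
  rw [pow_one, mul_one] at e
  have f := x_tor hx hy hxy h k
  have g := tor_pow hx hy hxy h k 10
  have g' := tor_pow hx hy hxy h k 10
  obtain ⟨t, ht⟩ : ∃ t, t = tor x y ^ k := ⟨_, rfl⟩
  rw [show tor x y ^ (2 * k) = t * t by rw [ht, two_mul, pow_add]]
  rw [← ht] at e f g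
  have e' : y ^ 3 ^ k = t⁻¹ * y * t := by rw [mul_assoc, e]; group
  have f' : x * t⁻¹ = t * x := by
    have := congrArg (fun z => t * z * t⁻¹) f
    simpa [mul_assoc] using this.symm
  have fx : t * x = x * t⁻¹ := f'.symm
  rw [mul_comm (4 ^ k) 10] at g
  calc x * y ^ 3 ^ k * x = (x * t⁻¹) * y * (t * x) := by rw [e']; group
    _ = (t * x) * y * (x * t⁻¹) := by rw [fx]
    _ = t * (x * y * x) * t⁻¹ := by group
    _ = (t * y ^ 10) * x * (y ^ 10 * t⁻¹) := by rw [h3]; group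
    _ = y ^ (10 * 4 ^ k) * t * x * (t⁻¹ * (t * y ^ 10) * t⁻¹) := by
      nth_rewrite 1 [g]; group
    _ = y ^ (10 * 4 ^ k) * t * (x * t⁻¹) * y ^ (10 * 4 ^ k) := by rw [g]; group
    _ = _ := by rw [f']; group

theorem key' (hx : x * x = 1) (hy : y ^ 11 = 1) (hxy : (y * x) ^ 3 = 1)
    (h : (y ^ 2 * x * y ^ 6 * x) ^ 3 = 1) (k : ℕ) : x * y ^ (10 * 3 ^ k) * x =
    y ^ (4 ^ k) * tor x y ^ (2 * k) * x * y ^ (4 ^ k) := by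
  have hxi : x⁻¹ = x := inv_eq_of_mul_eq_one_left hx
  have h10 : ∀ i, y ^ (10 * i) = (y ^ i)⁻¹ := fun i =>
    eq_inv_of_mul_eq_one_left (by rw [← pow_add, ← Nat.succ_mul, pow_mul, hy, one_pow])
  have e := congrArg (·⁻¹) (key hx hy hxy h k)
  have f := x_tor hx hy hxy h (2 * k)
  simp only [mul_inv_rev, hxi, h10, inv_inv] at e
  rw [h10, mul_assoc, e]
  have f' : x * (tor x y ^ (2 * k))⁻¹ = tor x y ^ (2 * k) * x := by
    have := congrArg (fun z => tor x y ^ (2 * k) * z * (tor x y ^ (2 * k))⁻¹) f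
    simpa [mul_assoc] using this.symm
  simp only [← mul_assoc]
  rw [mul_assoc (y ^ 4 ^ k), f']
  group

theorem tor_five (hx : x * x = 1) (hy : y ^ 11 = 1) (hxy : (y * x) ^ 3 = 1)
    (h : (y ^ 2 * x * y ^ 6 * x) ^ 3 = 1) : tor x y ^ 5 = 1 := by
  have hxi : x⁻¹ = x := inv_eq_of_mul_eq_one_left hx
  -- 10 * 3 ^ 3 = 6 mod 11
  have e := key' hx hy hxy h 3
  rw [ypow hy (10 * 3 ^ 3) 6 (by norm_num), ypow hy (4 ^ 3) 9 (by norm_num)] at e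
  have e2 : x * y ^ 6 * x = y ^ 9 * tor x y * x * y ^ 9 := by
    have : y ^ 9 * tor x y * x * y ^ 9 = y ^ 11 * x * y ^ 6 * x * y ^ 2 * (x * x) * y ^ 9 := by
      rw [tor]; group
    rw [this, hx, hy]
    have : 1 * x * y ^ 6 * x * y ^ 2 * 1 * y ^ 9 = x * y ^ 6 * x * y ^ 11 := by group
    rw [this, hy, mul_one]
  rw [e2] at e
  generalize tor x y = t at e ⊢
  have e := mul_left_cancel (mul_right_cancel (mul_right_cancel e))
  rw [show 2 * 3 = 5 + 1 by norm_num, pow_succ] at e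
  exact (mul_eq_right.mp e.symm)

theorem x_tor' (hx : x * x = 1) (hy : y ^ 11 = 1) (hxy : (y * x) ^ 3 = 1)
    (h : (y ^ 2 * x * y ^ 6 * x) ^ 3 = 1) (j : ℕ) : x * tor x y ^ j = tor x y ^ (4 * j) * x := by
  rw [x_tor hx hy hxy h]
  congr 1
  symm
  apply eq_inv_of_mul_eq_one_left
  rw [← pow_add, ← Nat.succ_mul, pow_mul, tor_five hx hy hxy h, one_pow]

theorem xyx (hx : x * x = 1) (hy : y ^ 11 = 1) (hxy : (y * x) ^ 3 = 1)
    (h : (y ^ 2 * x * y ^ 6 * x) ^ 3 = 1) (i : ℕ) : x * y ^ i * x = 1 ∧ y ^ i = 1 ∨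
    ∃ m n k, x * y ^ i * x = y ^ m * tor x y ^ n * x * y ^ k := by
  have : i % 11 = 0 ∨ ∃ k, i % 11 = 3 ^ k % 11 ∨ i % 11 = (10 * 3 ^ k) % 11 := by
    have hlt : i % 11 < 11 := Nat.mod_lt _ (by norm_num)
    generalize i % 11 = r at hlt
    have : ∀ r < 11, r = 0 ∨ ∃ k < 5, r = 3 ^ k % 11 ∨ r = (10 * 3 ^ k) % 11 := by decide
    rcases this r hlt with h | ⟨k, -, h⟩
    · exact Or.inl h
    · exact Or.inr ⟨k, h⟩
  rcases this with h0 | ⟨k, h0 | h0⟩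
  · left
    have : y ^ i = 1 := by rw [ypow hy i 0 (by simpa using h0), pow_zero]
    rw [this, mul_one, hx]; simp
  · right
    rw [ypow hy _ _ h0]
    exact ⟨_, _, _, key hx hy hxy h k⟩
  · right
    rw [ypow hy _ _ h0]
    exact ⟨_, _, _, key' hx hy hxy h k⟩

/-- Bruhat normal form. -/
def NF (x y g : G) : Prop :=
  (∃ i j, g = y ^ i * tor x y ^ j) ∨ ∃ i j k, g = y ^ i * tor x y ^ j * x * y ^ k

theorem NF_y (g : G) (hg : NF x y g) (m : ℕ) : NF x y (y ^ m * g) := by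
  rcases hg with ⟨i, j, rfl⟩ | ⟨i, j, k, rfl⟩
  · exact Or.inl ⟨m + i, j, by rw [pow_add, mul_assoc]⟩
  · exact Or.inr ⟨m + i, j, k, by simp only [pow_add, mul_assoc]⟩

theorem NF_x (hx : x * x = 1) (hy : y ^ 11 = 1) (hxy : (y * x) ^ 3 = 1)
    (h : (y ^ 2 * x * y ^ 6 * x) ^ 3 = 1) (g : G) (hg : NF x y g) : NF x y (x * g) := by
  rcases hg with ⟨i, j, rfl⟩ | ⟨i, j, k, rfl⟩
  · refine Or.inr ⟨0, 4 * j, 3 ^ j * i, ?_⟩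
    rw [tor_pow' hx hy hxy h, ← mul_assoc, x_tor' hx hy hxy h]; simp
  · have e : tor x y ^ j * x = x * tor x y ^ (4 * j) := by
      rw [x_tor' hx hy hxy h]
      congr 1
      rw [← mul_assoc, show 4 * 4 * j = 5 * (3 * j) + j by ring, pow_add, pow_mul,
        tor_five hx hy hxy h, one_pow, one_mul]
    have e2 : x * (y ^ i * tor x y ^ j * x * y ^ k)
        = (x * y ^ i * x) * (tor x y ^ (4 * j) * y ^ k) := by
      rw [mul_assoc (y ^ i), e]; simp only [mul_assoc]
    rw [e2]
    rcases xyx hx hy hxy h i with ⟨h1, -⟩ | ⟨m, n, l, h1⟩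
    · rw [h1, one_mul, tor_pow hx hy hxy h]
      exact Or.inl ⟨_, _, rfl⟩
    · rw [h1]
      refine Or.inr ⟨m, n + 4 * (4 * j), 3 ^ (4 * j) * l + k, ?_⟩
      rw [pow_add, pow_add]
      calc _ = y ^ m * tor x y ^ n * x * (y ^ l * tor x y ^ (4 * j)) * y ^ k := by
            simp only [mul_assoc]
        _ = y ^ m * tor x y ^ n * (x * tor x y ^ (4 * j)) * y ^ (3 ^ (4 * j) * l) * y ^ k := by
            rw [tor_pow' hx hy hxy h (4 * j) l]; simp only [mul_assoc]
        _ = _ := by rw [x_tor' hx hy hxy h]; simp only [mul_assoc]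

theorem NF_closure (hx : x * x = 1) (hy : y ^ 11 = 1) (hxy : (y * x) ^ 3 = 1)
    (h : (y ^ 2 * x * y ^ 6 * x) ^ 3 = 1) (g : G) (hg : g ∈ Subgroup.closure {x, y}) : NF x y g := by
  have hxi : x⁻¹ = x := inv_eq_of_mul_eq_one_left hx
  have hyi : y⁻¹ = y ^ 10 := (eq_inv_of_mul_eq_one_left (by rw [← pow_succ, hy])).symm
  induction hg using Subgroup.closure_induction_left with
  | one => exact Or.inl ⟨0, 0, by simp⟩
  | mul_left u hu v _ ih =>
    rcases hu with rfl | rfl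
    · exact NF_x hx hy hxy h v ih
    · simpa using NF_y v ih 1
  | inv_mul_cancel u hu v _ ih =>
    rcases hu with rfl | rfl
    · rw [hxi]; exact NF_x hx hy hxy h v ih
    · rw [hyi]; exact NF_y v ih 10

end Words

abbrev SL := Matrix.SpecialLinearGroup (Fin 2) (ZMod 11)

instance : Fact (Nat.Prime 11) := ⟨by norm_num⟩

def mA : SL := ⟨!![0, -1; 1, 0], by decide⟩
def mB : SL := ⟨!![1, 1; 0, 1], by decide⟩
def mH : SL := ⟨!![2, 0; 0, 6], by decide⟩

theorem mB_pow (n : ℕ) : ((mB ^ n : SL) : Matrix (Fin 2) (Fin 2) (ZMod 11)) = !![1, (n : ZMod 11); 0, 1] := by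
  induction n with
  | zero => simp [Matrix.one_fin_two]
  | succ n ih =>
    rw [pow_succ, Matrix.SpecialLinearGroup.coe_mul, ih]
    simp [mB, add_comm]

theorem mH_pow (n : ℕ) :
    ((mH ^ n : SL) : Matrix (Fin 2) (Fin 2) (ZMod 11)) = !![2 ^ n, 0; 0, 6 ^ n] := by
  induction n with
  | zero => simp [Matrix.one_fin_two]
  | succ n ih =>
    rw [pow_succ, Matrix.SpecialLinearGroup.coe_mul, ih]
    simp [mH, pow_succ]

theorem neg_central (M : SL) : (QuotientGroup.mk (-M) : PSL2_11) = QuotientGroup.mk M := by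
  rw [QuotientGroup.eq, Subgroup.mem_center_iff]
  intro g
  have : (-M)⁻¹ * M = -1 := by
    rw [inv_mul_eq_iff_eq_mul]; simp
  rw [this]; simp

def pA : PSL2_11 := QuotientGroup.mk mA
def pB : PSL2_11 := QuotientGroup.mk mB

theorem mk_neg_one : (QuotientGroup.mk (-1 : SL) : PSL2_11) = 1 := neg_central 1

theorem pA2 : pA ^ 2 = 1 := by
  rw [← mk_neg_one, pA, ← QuotientGroup.mk_pow]; congr 1; decide
theorem pB11 : pB ^ 11 = 1 := by
  rw [pB, ← QuotientGroup.mk_pow, ← QuotientGroup.mk_one]; congr 1; decide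
theorem pBA : (pB * pA) ^ 3 = 1 := by
  have : (mB * mA) ^ 3 = -1 ∨ (mB * mA) ^ 3 = 1 := by decide
  rw [pB, pA, ← QuotientGroup.mk_mul, ← QuotientGroup.mk_pow]
  rcases this with h | h <;> rw [h]
  · exact mk_neg_one
  · rfl
theorem pR : (pB ^ 2 * pA * pB ^ 6 * pA) ^ 3 = 1 := by
  have : (mB ^ 2 * mA * mB ^ 6 * mA) ^ 3 = -1 ∨ (mB ^ 2 * mA * mB ^ 6 * mA) ^ 3 = 1 := by decide
  have e : (pB ^ 2 * pA * pB ^ 6 * pA) ^ 3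
    = QuotientGroup.mk ((mB ^ 2 * mA * mB ^ 6 * mA) ^ 3) := rfl
  rw [e]
  rcases this with h | h <;> rw [h]
  · exact mk_neg_one
  · rfl
theorem pH : tor pA pB = QuotientGroup.mk mH := by
  have e : tor pA pB = QuotientGroup.mk (tor mA mB) := rfl
  have : tor mA mB = -mH ∨ tor mA mB = mH := by unfold tor; decide
  rw [e]
  rcases this with h | h <;> rw [h]
  exact neg_central _

def gens : Fin 2 → PSL2_11 := ![pA, pB]

theorem gens_rels : ∀ r ∈ rels, FreeGroup.lift gens r = 1 := by
  intro r hr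
  rcases hr with rfl | rfl | rfl | rfl
  · simpa [gens] using pA2
  · simpa [gens] using pB11
  · simpa [gens] using pBA
  · simpa [gens] using pR

def phi : PresentedGroup rels →* PSL2_11 := PresentedGroup.toGroup gens_rels

def gA : PresentedGroup rels := PresentedGroup.of 0
def gB : PresentedGroup rels := PresentedGroup.of 1

theorem phiA : phi gA = pA := PresentedGroup.toGroup.of gens_rels
theorem phiB : phi gB = pB := PresentedGroup.toGroup.of gens_rels

theorem phiH : phi (tor gA gB) = QuotientGroup.mk mH := by
  rw [← pH]; simp [tor, phiA, phiB]

theorem gA2 : gA * gA = 1 := by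
  rw [← pow_two]
  exact PresentedGroup.one_of_mem (rels := rels) (x := a ^ 2) (by simp [rels])
theorem gB11 : gB ^ 11 = 1 :=
  PresentedGroup.one_of_mem (rels := rels) (x := b ^ 11) (by simp [rels])
theorem gBA : (gB * gA) ^ 3 = 1 :=
  PresentedGroup.one_of_mem (rels := rels) (x := (b * a) ^ 3) (by simp [rels])
theorem gR : (gB ^ 2 * gA * gB ^ 6 * gA) ^ 3 = 1 :=
  PresentedGroup.one_of_mem (rels := rels) (x := (b ^ 2 * a * b ^ 6 * a) ^ 3) (by simp [rels])

theorem nf (g : PresentedGroup rels) : NF gA gB g := by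
  apply NF_closure gA2 gB11 gBA gR
  have : Set.range (PresentedGroup.of : Fin 2 → PresentedGroup rels) = {gA, gB} := by
    ext z
    simp [gA, gB, eq_comm]
  rw [← this, PresentedGroup.closure_range_of]
  trivial

theorem phi_inj : Function.Injective phi := by
  rw [injective_iff_map_eq_one]
  intro g hg
  have six : ∀ n, (6 : ZMod 11) ^ n ≠ 0 := fun n => pow_ne_zero _ (by decide)
  rcases nf g with ⟨i, j, rfl⟩ | ⟨i, j, k, rfl⟩
  · rw [map_mul, map_pow, map_pow, phiB, phiH] at hg
    change (QuotientGroup.mk (mB ^ i * mH ^ j) : PSL2_11) = 1 at hg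
    rw [QuotientGroup.eq_one_iff, Matrix.SpecialLinearGroup.mem_center_iff] at hg
    obtain ⟨r, -, hr⟩ := hg
    rw [Matrix.SpecialLinearGroup.coe_mul, mB_pow, mH_pow] at hr
    have h01 := congrFun (congrFun hr 0) 1
    have h00 := congrFun (congrFun hr 0) 0
    have h11 := congrFun (congrFun hr 1) 1
    simp at h01 h00 h11
    have hi : (i : ZMod 11) = 0 := by
      rcases h01 with h | h
      · exact h
      · exact absurd h.1 (by decide)
    rw [ZMod.natCast_eq_zero_iff] at hi
    obtain ⟨i', rfl⟩ := hi
    have hj : (2 : ZMod 11) ^ (j % 5) * 2 ^ (j % 5) = 1 := by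
      have h2 : (2 : ZMod 11) ^ j * 2 ^ j = 1 := by
        have : (2 : ZMod 11) ^ j * 2 ^ j = 2 ^ j * 6 ^ j := by rw [← h11, ← h00]
        rw [this, ← mul_pow, show (2 : ZMod 11) * 6 = 1 by decide, one_pow]
      rw [← mul_pow] at h2 ⊢
      rw [← Nat.div_add_mod j 5, pow_add, pow_mul,
        show ((2 : ZMod 11) * 2) ^ 5 = 1 by decide, one_pow, one_mul] at h2
      exact h2
    have hj5 : j % 5 = 0 := by
      have hlt : j % 5 < 5 := Nat.mod_lt _ (by norm_num)
      generalize j % 5 = q at hj hlt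
      have : ∀ q < 5, (2 : ZMod 11) ^ q * 2 ^ q = 1 → q = 0 := by decide
      exact this q hlt hj
    rw [← Nat.div_add_mod j 5, hj5, add_zero, pow_mul, pow_mul, gB11,
      tor_five gA2 gB11 gBA gR]
    simp
  · exfalso
    rw [map_mul, map_mul, map_mul, map_pow, map_pow, map_pow, phiA, phiB, phiH] at hg
    change (QuotientGroup.mk (mB ^ i * mH ^ j * mA * mB ^ k) : PSL2_11) = 1 at hg
    rw [QuotientGroup.eq_one_iff, Matrix.SpecialLinearGroup.mem_center_iff] at hg
    obtain ⟨r, -, hr⟩ := hg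
    simp only [Matrix.SpecialLinearGroup.coe_mul, mB_pow, mH_pow] at hr
    have h10 := congrFun (congrFun hr 1) 0
    simp [mA] at h10
    exact absurd h10 (six j).symm

theorem big_cell (M : SL) (hM : M 1 0 ≠ 0) : ∃ g, phi g = QuotientGroup.mk M := by
  have hdet := M.det_coe
  rw [Matrix.det_fin_two] at hdet
  have hr : ∀ r : ZMod 11, r ≠ 0 → ∃ j < 5, r = 6 ^ j ∨ r = - 6 ^ j := by decide
  obtain ⟨j, -, hj⟩ := hr _ hM
  have h26 : (2 : ZMod 11) ^ j * 6 ^ j = 1 := by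
    rw [← mul_pow, show (2 : ZMod 11) * 6 = 1 by decide, one_pow]
  refine ⟨gB ^ (M 0 0 / M 1 0).val * tor gA gB ^ j * gA * gB ^ (M 1 1 / M 1 0).val, ?_⟩
  rw [map_mul, map_mul, map_mul, map_pow, map_pow, map_pow, phiA, phiB, phiH]
  change (QuotientGroup.mk (mB ^ (M 0 0 / M 1 0).val * mH ^ j * mA * mB ^ (M 1 1 / M 1 0).val)
    : PSL2_11) = _
  have key : ∀ e : ZMod 11, e * e = 1 → M 1 0 = e * 6 ^ j →
      ((mB ^ (M 0 0 / M 1 0).val * mH ^ j * mA * mB ^ (M 1 1 / M 1 0).val : SL) :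
        Matrix (Fin 2) (Fin 2) (ZMod 11)) = e • (M : Matrix (Fin 2) (Fin 2) (ZMod 11)) := by
    intro e he hc
    have h6 : (6 : ZMod 11) ^ j = e * M 1 0 := by rw [hc, ← mul_assoc, he, one_mul]
    have h2 : (2 : ZMod 11) ^ j = e / M 1 0 := by
      rw [eq_div_iff hM, hc]
      linear_combination e * h26
    simp only [Matrix.SpecialLinearGroup.coe_mul, mB_pow, mH_pow, ZMod.natCast_zmod_val]
    ext u v
    fin_cases u <;> fin_cases v <;> simp [mA, h2, h6] <;> field_simp
    linear_combination e * hdet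
  rcases hj with hj | hj
  · congr 1
    apply Subtype.ext
    rw [key 1 (by ring) (by rw [hj]; ring), one_smul]
  · rw [← neg_central M]
    congr 1
    apply Subtype.ext
    rw [key (-1) (by ring) (by rw [hj]; ring), Matrix.SpecialLinearGroup.coe_neg, neg_one_smul]

theorem phi_surj : Function.Surjective phi := by
  intro q
  induction q using QuotientGroup.induction_on with
  | H M =>
    by_cases hM : M 1 0 = 0
    · have h0 : (mA * M) 1 0 ≠ 0 := by
        have hdet := M.det_coe
        rw [Matrix.det_fin_two, hM] at hdet
        have : (mA * M) 1 0 = M 0 0 := by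
          rw [Matrix.SpecialLinearGroup.coe_mul]
          simp [mA, Matrix.mul_apply, Fin.sum_univ_two]
        rw [this]
        intro h
        rw [h] at hdet
        simp at hdet
      obtain ⟨g, hg⟩ := big_cell _ h0
      refine ⟨gA⁻¹ * g, ?_⟩
      rw [map_mul, hg, map_inv, phiA, QuotientGroup.mk_mul, pA]
      simp
    · exact big_cell M hM

theorem presentation_psl2_11 : Nonempty (PresentedGroup rels ≃* PSL2_11) :=
  ⟨MulEquiv.ofBijective phi ⟨phi_inj, phi_surj⟩⟩

end Stmt1
end

section
/- If G is a nontrivial group generated by two elements a and b satisfying a^2 = b^11 = (b*a)^3 = (b^2*a*b^6*a)^3 = 1, then G is isomorphic to PSL(2, 11). -/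
/-! ## A small verified coset enumeration

Letters: `0` is `a`, `1` is `b`, `2` is the inverse of `b`.  A coset is named by the number that
encodes a word leading to it from the base point, and a table is a list of arrows
`(source, letter, target)`. -/

namespace CosetEnum

/-- The inverse letter. -/
def inv : ℕ → ℕ
  | 0 => 0
  | 1 => 2
  | _ => 1

/-- The permutation belonging to a letter. -/
def act {X : Type*} (p q : Equiv.Perm X) : ℕ → Equiv.Perm X
  | 0 => p
  | 1 => q
  | _ => q⁻¹

/-- The points named by numbers. -/
def pt {X : Type*} (p q : Equiv.Perm X) (x : X) : ℕ → X
  | 0 => x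
  | n + 1 => act p q (n % 3) (pt p q x (n / 3))
termination_by n => n
decreasing_by omega

/-- Apply the letters of a word one after the other. -/
def run {X : Type*} (p q : Equiv.Perm X) : List ℕ → X → X
  | [], x => x
  | g :: w, x => run p q w (act p q g x)

/-- Tables of arrows. -/
abbrev Table := List (ℕ × ℕ × ℕ)

/-- Look up an arrow. -/
def look : Table → ℕ → ℕ → Option ℕ
  | [], _, _ => none
  | e :: t, i, g => bif Nat.beq e.1 i && Nat.beq e.2.1 g then some e.2.2 else look t i g

/-- Follow a word as far as possible. -/
def follow (T : Table) : ℕ → List ℕ → ℕ × List ℕ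
  | i, [] => (i, [])
  | i, g :: w =>
    match look T i g with
    | none => (i, g :: w)
    | some k => follow T k w

/-- Replace `y` by `x`. -/
def ren (x y n : ℕ) : ℕ := bif Nat.beq n y then x else n

/-- Identify two names, keeping the smaller one. -/
def merge (T : Table) (f k : ℕ) : Table :=
  bif Nat.ble f k then T.map (fun e => (ren f k e.1, e.2.1, ren f k e.2.2))
  else T.map (fun e => (ren k f e.1, e.2.1, ren k f e.2.2))

/-- Scan a relator at `i`. -/
def scan (T : Table) (i : ℕ) (r : List ℕ) : Table :=
  match follow T i r with
  | (f, w) =>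
    match follow T i (w.reverse.map inv) with
    | (k, []) => merge T f k
    | (k, [g]) => (k, g, f) :: (f, inv g, k) :: T
    | _ => T

/-- Resolve a conflict between two arrows with the same source and letter. -/
def conflict (T : Table) (i g : ℕ) : Table :=
  match look T i g, look T.reverse i g with
  | some x, some y => merge T x y
  | _, _ => T

/-- The relators. -/
def relB : List ℕ := List.replicate 11 1
def relC : List ℕ := [1, 0, 1, 0, 1, 0]
def relD : List ℕ :=
  let u := [1, 1, 0, 1, 1, 1, 1, 1, 1, 0]
  u ++ u ++ u

/-- One step: codes `0,1,2` define a coset, `3,4,5` scan a relator, `6,7,8` resolve a conflict. -/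
def step (T : Table) (s : ℕ × ℕ) : Table :=
  match s.2 with
  | 0 => (s.1, 0, 3 * s.1 + 1) :: (3 * s.1 + 1, 0, s.1) :: T
  | 1 => (s.1, 1, 3 * s.1 + 2) :: (3 * s.1 + 2, 2, s.1) :: T
  | 2 => (s.1, 2, 3 * s.1 + 3) :: (3 * s.1 + 3, 1, s.1) :: T
  | 3 => scan T s.1 relB
  | 4 => scan T s.1 relC
  | 5 => scan T s.1 relD
  | n + 6 => conflict T s.1 n

/-- The steps of the enumeration of the cosets of the subgroup generated by `b`. -/
def steps : List (ℕ × ℕ) := [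
  (0, 0), (1, 1), (5, 0), (0, 4), (5, 1), (17, 1), (16, 2), (51, 0), (17, 0), (5, 4), (53, 1),
  (161, 1), (51, 2), (485, 1), (1457, 1), (1, 3), (53, 0), (52, 2), (159, 0), (17, 4), (161, 0),
  (160, 2), (484, 1), (53, 4), (154, 1), (464, 0), (156, 0), (154, 4), (485, 0), (484, 2), (1455,
  0), (161, 4), (1457, 0), (1456, 2), (4372, 1), (485, 4), (4373, 0), (13120, 2), (469, 1), (4373,
  4), (13120, 1), (4372, 2), (1457, 4), (478, 1), (159, 2), (1436, 0), (480, 0), (478, 4), (480,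
  2), (1443, 2), (464, 1), (4332, 2), (12999, 2), (1394, 1), (154, 3), (12999, 0), (38998, 1), (1,
  5), (38998, 3), (38998, 4), (1454, 1), (4364, 1), (13094, 1), (17, 5), (39362, 1), (1455, 2),
  (484, 3), (1441, 1), (4325, 1), (12977, 1), (4371, 2), (485, 5), (4309, 2), (4366, 1), (1456,
  3), (13119, 5), (39284, 4), (39284, 5), (4325, 7), (4372, 7), (16, 5), (4366, 4), (39362, 4),
  (12930, 0), (160, 5), (1436, 1), (38791, 2), (53, 5), (116376, 2), (5, 5), (13116, 0), (13118,
  4), (13094, 0), (4364, 4), (349131, 0), (4310, 4)]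

/-- The final table. -/
def final : Table := steps.foldl step [(0, 1, 0), (0, 2, 0)]

/-- The names which survive. -/
def names (T : Table) : List ℕ :=
  T.foldr (fun e l => bif l.any (Nat.beq e.1) then l else e.1 :: l) []

/-- All arrows are defined. -/
def closed (T : Table) (l : List ℕ) : Bool :=
  l.any (Nat.beq 0) && l.all fun i => [0, 1, 2].all fun g =>
    match look T i g with
    | none => false
    | some k => l.any (Nat.beq k)

theorem final_closed : (closed final (names final) && Nat.ble (names final).length 60) = true := by
  decide +kernel

section Sound

variable {X : Type*} (p q : Equiv.Perm X) (x : X)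

/-- All arrows of the table are correct. -/
def Valid (T : Table) : Prop := ∀ e ∈ T, act p q e.2.1 (pt p q x e.1) = pt p q x e.2.2

variable {p q x}

theorem act_inv (hp : p * p = 1) (g : ℕ) (y : X) : act p q (inv g) (act p q g y) = y := by
  match g with
  | 0 => exact congrArg (fun f : Equiv.Perm X => f y) hp
  | 1 => simp [act, inv]
  | n + 2 => simp [act, inv]

theorem look_mem {T : Table} {i g k : ℕ} (h : look T i g = some k) : (i, g, k) ∈ T := by
  induction T with
  | nil => simp [look] at h
  | cons e t ih =>
    rw [look] at h
    cases hb : (Nat.beq e.1 i && Nat.beq e.2.1 g) with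
    | true =>
      rw [hb] at h
      simp only [Bool.and_eq_true, Nat.beq_eq] at hb
      simp only [cond_true, Option.some.injEq] at h
      obtain ⟨e1, e2, e3⟩ := e
      simp only at hb h
      rw [hb.1, hb.2, h]
      exact List.mem_cons_self
    | false =>
      rw [hb] at h
      exact List.mem_cons_of_mem _ (ih h)

theorem follow_sound {T : Table} (hT : Valid p q x T) (w : List ℕ) (i : ℕ) :
    run p q w (pt p q x i) = run p q (follow T i w).2 (pt p q x (follow T i w).1) := by
  induction w generalizing i with
  | nil => rfl
  | cons g w ih =>
    rw [follow]
    cases h : look T i g with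
    | none => rfl
    | some k =>
      have := hT _ (look_mem h)
      simp only at this
      rw [run, this]
      exact ih k

theorem run_append (u w : List ℕ) (y : X) : run p q (u ++ w) y = run p q w (run p q u y) := by
  induction u generalizing y with
  | nil => rfl
  | cons g u ih => exact ih _

theorem run_inv (hp : p * p = 1) (w : List ℕ) (y : X) :
    run p q (w.reverse.map inv) (run p q w y) = y := by
  induction w generalizing y with
  | nil => rfl
  | cons g w ih =>
    rw [List.reverse_cons, List.map_append, run_append, run, ih]
    exact act_inv hp g y

theorem pt_ren {f k : ℕ} (h : pt p q x f = pt p q x k) (n : ℕ) :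
    pt p q x (ren f k n) = pt p q x n := by
  unfold ren
  cases hb : Nat.beq n k with
  | true =>
    rw [Nat.beq_eq] at hb
    rw [hb]; exact h
  | false => rfl

theorem merge_sound {T : Table} (hT : Valid p q x T) {f k : ℕ} (h : pt p q x f = pt p q x k) :
    Valid p q x (merge T f k) := by
  unfold merge
  cases Nat.ble f k with
  | true =>
    intro e he
    obtain ⟨e_2, he_2, rfl⟩ := List.mem_map.1 he
    simpa only [pt_ren h] using hT _ he_2
  | false =>
    intro e he
    obtain ⟨e_2, he_2, rfl⟩ := List.mem_map.1 he
    simpa only [pt_ren h.symm] using hT _ he_2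

theorem cons_sound (hp : p * p = 1) {T : Table} (hT : Valid p q x T) {i g k : ℕ}
    (h : act p q g (pt p q x i) = pt p q x k) :
    Valid p q x ((i, g, k) :: (k, inv g, i) :: T) := by
  intro e he
  rcases List.mem_cons.1 he with rfl | he
  · exact h
  rcases List.mem_cons.1 he with rfl | he
  · simp only
    rw [← h, act_inv hp]
  exact hT e he

theorem scan_sound (hp : p * p = 1) {T : Table} (hT : Valid p q x T) (i : ℕ) {r : List ℕ}
    (hr : ∀ y, run p q r y = y) : Valid p q x (scan T i r) := by
  unfold scan
  have h1 := follow_sound hT r i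
  rw [hr] at h1
  have h2 := follow_sound hT ((follow T i r).2.reverse.map inv) i
  have h3 := run_inv (q := q) hp (follow T i r).2 (pt p q x (follow T i r).1)
  rw [← h1, h2] at h3
  generalize follow T i r = F at *
  obtain ⟨f, w⟩ := F
  simp only at h3 ⊢
  generalize follow T i (w.reverse.map inv) = K at *
  obtain ⟨k, v⟩ := K
  match v with
  | [] => exact merge_sound hT h3.symm
  | [g] => exact cons_sound hp hT h3
  | _ :: _ :: _ => exact hT

theorem conflict_sound {T : Table} (hT : Valid p q x T) (i g : ℕ) :
    Valid p q x (conflict T i g) := by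
  unfold conflict
  cases h1 : look T i g with
  | none => exact hT
  | some y =>
    cases h2 : look T.reverse i g with
    | none => exact hT
    | some z =>
      have h3 := hT _ (look_mem h1)
      have h4 := hT _ (List.mem_reverse.1 (look_mem h2))
      exact merge_sound hT (h3.symm.trans h4)

theorem pt_succ (i g : ℕ) (hg : g < 3) :
    act p q g (pt p q x i) = pt p q x (3 * i + g + 1) := by
  rw [pt]
  have h1 : (3 * i + g) % 3 = g := by omega
  have h2 : (3 * i + g) / 3 = i := by omega
  rw [h1, h2]

theorem step_sound (hp : p * p = 1) (hB : ∀ y, run p q relB y = y) (hC : ∀ y, run p q relC y = y)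
    (hD : ∀ y, run p q relD y = y) {T : Table} (hT : Valid p q x T) (s : ℕ × ℕ) :
    Valid p q x (step T s) := by
  obtain ⟨i, c⟩ := s
  match c with
  | 0 => exact cons_sound hp hT (pt_succ i 0 (by norm_num))
  | 1 => exact cons_sound hp hT (pt_succ i 1 (by norm_num))
  | 2 => exact cons_sound hp hT (pt_succ i 2 (by norm_num))
  | 3 => exact scan_sound hp hT i hB
  | 4 => exact scan_sound hp hT i hC
  | 5 => exact scan_sound hp hT i hD
  | n + 6 => exact conflict_sound hT i n

theorem final_sound (hp : p * p = 1) (hB : ∀ y, run p q relB y = y)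
    (hC : ∀ y, run p q relC y = y) (hD : ∀ y, run p q relD y = y) (hx : q x = x) :
    Valid p q x final := by
  have key : ∀ (l : List (ℕ × ℕ)) (T : Table), Valid p q x T →
      Valid p q x (l.foldl step T) := by
    intro l
    induction l with
    | nil => intro T hT; exact hT
    | cons s l ih => intro T hT; exact ih _ (step_sound hp hB hC hD hT s)
  apply key
  have h0 : pt p q x 0 = x := by rw [pt]
  intro e he
  simp only [List.mem_cons, List.not_mem_nil, or_false] at he
  rcases he with rfl | rfl
  · simp only [h0]
    exact hx
  · simp only [h0]
    exact Equiv.Perm.inv_eq_iff_eq.2 hx.symm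

/-- The enumeration yields a set of at most 60 points, closed under the generators. -/
theorem exists_closed (hp : p * p = 1) (hB : ∀ y, run p q relB y = y)
    (hC : ∀ y, run p q relC y = y) (hD : ∀ y, run p q relD y = y) (hx : q x = x) :
    ∃ l : List X, l.length ≤ 60 ∧ x ∈ l ∧ ∀ y ∈ l, p y ∈ l ∧ q y ∈ l ∧ q⁻¹ y ∈ l := by
  have hV := final_sound hp hB hC hD hx
  have h := final_closed
  generalize final = T at hV h
  generalize names T = l at h
  simp only [closed, Bool.and_eq_true, List.any_eq_true, List.all_eq_true, Nat.ble_eq] at h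
  obtain ⟨⟨⟨z, hz, hz0⟩, hall⟩, hlen⟩ := h
  have h0 : pt p q x 0 = x := by rw [pt]
  have hm : ∀ i ∈ l, ∀ g ∈ [0, 1, 2], act p q g (pt p q x i) ∈ l.map (pt p q x) := by
    intro i hi g hg
    have := hall i hi g hg
    cases hk : look T i g with
    | none => rw [hk] at this; simp at this
    | some k =>
      rw [hk] at this
      simp only [List.any_eq_true] at this
      obtain ⟨m, hm, hkm⟩ := this
      rw [Nat.beq_eq] at hkm
      have h5 := hV _ (look_mem hk)
      simp only at h5
      rw [h5, hkm]
      exact List.mem_map_of_mem hm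
  refine ⟨l.map (pt p q x), by simpa using hlen, ?_, ?_⟩
  · rw [Nat.beq_eq] at hz0
    subst hz0
    have := List.mem_map_of_mem (f := pt p q x) hz
    rwa [h0] at this
  · intro y hy
    obtain ⟨i, hi, rfl⟩ := List.mem_map.1 hy
    exact ⟨hm i hi 0 (by simp), hm i hi 1 (by simp), hm i hi 2 (by simp)⟩

end Sound

end CosetEnum

/-- A group with the given presentation has at most 660 elements. -/
theorem card_le_of_relations {Q : Type*} [Group Q] (a b : Q)
    (hgen : Subgroup.closure ({a, b} : Set Q) = ⊤)
    (h1 : a ^ 2 = 1) (h2 : b ^ 11 = 1) (h3 : (b * a) ^ 3 = 1)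
    (h4 : (b ^ 2 * a * b ^ 6 * a) ^ 3 = 1) : Finite Q ∧ Nat.card Q ≤ 660 := by
  classical
  let H := Subgroup.zpowers b
  let ρ : Q →* Equiv.Perm (Q ⧸ H) := MulAction.toPermHom Q (Q ⧸ H)
  have e3 : (a * b) ^ 3 = 1 := by
    have : (a * b) ^ 3 = b⁻¹ * (b * a) ^ 3 * b := by
      simp only [pow_succ, pow_zero]; group
    rw [this, h3]; group
  have e4 : (a * b ^ 6 * a * b ^ 2) ^ 3 = 1 := by
    have : (a * b ^ 6 * a * b ^ 2) ^ 3 = (b ^ 2)⁻¹ * (b ^ 2 * a * b ^ 6 * a) ^ 3 * b ^ 2 := by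
      simp only [pow_succ, pow_zero]; group
    rw [this, h4]; group
  have r : ∀ g : Q, g = 1 → ∀ y : Q ⧸ H, ρ g y = y := by
    rintro g rfl y; simp
  obtain ⟨l, hlen, hx, hl⟩ := CosetEnum.exists_closed (p := ρ a) (q := ρ b)
    (x := ((1 : Q) : Q ⧸ H))
    (by rw [← map_mul, ← pow_two, h1, map_one])
    (fun y => by
      have := r _ h2 y
      simp only [pow_succ, pow_zero, one_mul, map_mul, Equiv.Perm.mul_apply] at this
      exact this)
    (fun y => by
      have := r _ e3 y
      simp only [pow_succ, pow_zero, one_mul, map_mul, Equiv.Perm.mul_apply] at this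
      exact this)
    (fun y => by
      have := r _ e4 y
      simp only [pow_succ, pow_zero, one_mul, map_mul, Equiv.Perm.mul_apply] at this
      exact this)
    (by
      change ((b * 1 : Q) : Q ⧸ H) = _
      rw [QuotientGroup.eq]
      simp [H])
  have hall : ∀ g : Q, ∀ y ∈ l, ρ g y ∈ l := by
    intro g
    have hg : g ∈ Subgroup.closure ({a, b} : Set Q) := by rw [hgen]; trivial
    induction hg using Subgroup.closure_induction'' with
    | one => intro y hy; simpa using hy
    | mem z hz =>
      rcases hz with rfl | rfl
      · exact fun y hy => (hl y hy).1
      · exact fun y hy => (hl y hy).2.1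
    | inv_mem z hz =>
      rcases hz with rfl | rfl
      · rw [inv_eq_of_mul_eq_one_left (by rw [← pow_two, h1] : z * z = 1)]
        exact fun y hy => (hl y hy).1
      · rw [map_inv]
        exact fun y hy => (hl y hy).2.2
    | mul z w _ _ hz hw =>
      intro y hy
      rw [map_mul]
      exact hz _ (hw _ hy)
  have hcov : ∀ y : Q ⧸ H, y ∈ l := by
    intro y
    obtain ⟨g, rfl⟩ := QuotientGroup.mk_surjective y
    have := hall g _ hx
    change ((g * 1 : Q) : Q ⧸ H) ∈ l at this
    simpa using this
  have hfX : Finite (Q ⧸ H) :=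
    Set.finite_univ_iff.1 (l.toFinset.finite_toSet.subset fun y _ => by simp [hcov])
  have hcX : Nat.card (Q ⧸ H) ≤ 60 := by
    have : Fintype (Q ⧸ H) := Fintype.ofFinite _
    rw [Nat.card_eq_fintype_card, ← Finset.card_univ]
    calc _ ≤ l.toFinset.card := Finset.card_le_card fun y _ => by simp [hcov]
      _ ≤ l.length := l.toFinset_card_le
      _ ≤ 60 := hlen
  have hob : IsOfFinOrder b := isOfFinOrder_iff_pow_eq_one.2 ⟨11, by norm_num, h2⟩
  have hfH : Finite H := hob.finite_zpowers
  have hcH : Nat.card H ≤ 11 := by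
    rw [Nat.card_zpowers]
    exact orderOf_le_of_pow_eq_one (by norm_num) h2
  refine ⟨Finite.of_equiv _ (Subgroup.groupEquivQuotientProdSubgroup (s := H)).symm, ?_⟩
  rw [Subgroup.card_eq_card_quotient_mul_card_subgroup H]
  exact Nat.mul_le_mul hcX hcH


instance fact_prime_eleven : Fact (Nat.Prime 11) := ⟨by norm_num⟩

/-- Explicit elements of `SL(2, 11)`. -/
def slParam : (ZMod 11)ˣ × ZMod 11 × ZMod 11 ⊕ (ZMod 11)ˣ × ZMod 11 →
    Matrix.SpecialLinearGroup (Fin 2) (ZMod 11)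
  | Sum.inl (u, y, z) => ⟨!![(u : ZMod 11), y; z, (↑u⁻¹ : ZMod 11) * (1 + y * z)], by
      rw [Matrix.det_fin_two_of, ← mul_assoc, Units.mul_inv]; ring⟩
  | Sum.inr (u, y) => ⟨!![0, (u : ZMod 11); -(↑u⁻¹ : ZMod 11), y], by
      rw [Matrix.det_fin_two_of, mul_neg, Units.mul_inv]; ring⟩

theorem slParam_injective : Function.Injective slParam := by
  have key : ∀ M N : Matrix.SpecialLinearGroup (Fin 2) (ZMod 11), M = N →
      ∀ i j, M.1 i j = N.1 i j := by rintro M _ rfl i j; rfl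
  rintro (⟨u, y, z⟩ | ⟨u, y⟩) (⟨u_2, y_2, z_2⟩ | ⟨u_2, y_2⟩) h
  · have h00 : (u : ZMod 11) = u_2 := key _ _ h 0 0
    have h01 : y = y_2 := key _ _ h 0 1
    have h10 : z = z_2 := key _ _ h 1 0
    rw [Units.ext h00, h01, h10]
  · have h00 : (u : ZMod 11) = 0 := key _ _ h 0 0
    exact absurd h00 u.ne_zero
  · have h00 : 0 = (u_2 : ZMod 11) := key _ _ h 0 0
    exact absurd h00.symm u_2.ne_zero
  · have h01 : (u : ZMod 11) = u_2 := key _ _ h 0 1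
    have h11 : y = y_2 := key _ _ h 1 1
    rw [Units.ext h01, h11]

theorem card_psl_ge : 660 ≤ Nat.card PSL2_11 := by
  have h1 : 1320 ≤ Nat.card (Matrix.SpecialLinearGroup (Fin 2) (ZMod 11)) := by
    have := Nat.card_le_card_of_injective _ slParam_injective
    rw [Nat.card_sum, Nat.card_prod, Nat.card_prod, Nat.card_prod, Nat.card_zmod,
      Nat.card_eq_fintype_card, ZMod.card_units] at this
    omega
  have h2 : Nat.card (Subgroup.center (Matrix.SpecialLinearGroup (Fin 2) (ZMod 11))) ≤ 2 := by
    rw [Nat.card_congr (Matrix.SpecialLinearGroup.center_equiv_rootsOfUnity' 0).toEquiv]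
    exact card_rootsOfUnity _ _
  rw [Subgroup.card_eq_card_quotient_mul_card_subgroup
    (Subgroup.center (Matrix.SpecialLinearGroup (Fin 2) (ZMod 11)))] at h1
  change 1320 ≤ Nat.card PSL2_11 * _ at h1
  have := h1.trans (Nat.mul_le_mul_left _ h2)
  omega

/-- The two generators of `SL(2, 11)`. -/
def slA : Matrix.SpecialLinearGroup (Fin 2) (ZMod 11) := ⟨!![0, 1; -1, 0], by decide⟩
def slB : Matrix.SpecialLinearGroup (Fin 2) (ZMod 11) := ⟨!![1, 1; 0, 1], by decide⟩

theorem sl_closure : Subgroup.closure {slA, slB} = ⊤ := by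
  rw [eq_top_iff]
  have hA : slA ∈ Subgroup.closure {slA, slB} := Subgroup.subset_closure (by simp)
  have hB : slB ∈ Subgroup.closure {slA, slB} := Subgroup.subset_closure (by simp)
  rintro M -
  refine Matrix.SL2.transvection_induction (fun M => M ∈ Subgroup.closure {slA, slB}) ?_
    (fun _ _ => mul_mem) M
  intro i j hij c
  have e1 : ∀ c : ZMod 11, Matrix.SpecialLinearGroup.transvection
      (show (0 : Fin 2) ≠ 1 by decide) c = slB ^ c.val := by decide +kernel
  have e2 : ∀ c : ZMod 11, Matrix.SpecialLinearGroup.transvection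
      (show (1 : Fin 2) ≠ 0 by decide) c = slA * slB ^ (-c).val * slA⁻¹ := by decide +kernel
  fin_cases i <;> fin_cases j
  · exact absurd rfl hij
  · change Matrix.SpecialLinearGroup.transvection (show (0 : Fin 2) ≠ 1 by decide) c ∈ _
    rw [e1]
    exact pow_mem hB _
  · change Matrix.SpecialLinearGroup.transvection (show (1 : Fin 2) ≠ 0 by decide) c ∈ _
    rw [e2]
    exact mul_mem (mul_mem hA (pow_mem hB _)) (inv_mem hA)
  · exact absurd rfl hij

theorem neg_one_center (M : Matrix.SpecialLinearGroup (Fin 2) (ZMod 11)) (h : M = 1 ∨ M = -1) :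
    (M : PSL2_11) = 1 := by
  rw [QuotientGroup.eq_one_iff, Subgroup.mem_center_iff]
  rcases h with rfl | rfl <;> intro g <;> simp

theorem psl_gen : Subgroup.closure ({(slA : PSL2_11), (slB : PSL2_11)} : Set PSL2_11) = ⊤ := by
  have h := congrArg (Subgroup.map (QuotientGroup.mk' (Subgroup.center
    (Matrix.SpecialLinearGroup (Fin 2) (ZMod 11))))) sl_closure
  rw [MonoidHom.map_closure, Set.image_pair,
    Subgroup.map_top_of_surjective _ (QuotientGroup.mk'_surjective _)] at h
  exact h

theorem psl_one : (slA : PSL2_11) ^ 2 = 1 := neg_one_center (slA ^ 2) (by decide +kernel)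

theorem psl_two : (slB : PSL2_11) ^ 11 = 1 := neg_one_center (slB ^ 11) (by decide +kernel)

theorem psl_three : ((slB : PSL2_11) * slA) ^ 3 = 1 :=
  neg_one_center ((slB * slA) ^ 3) (by decide +kernel)

theorem psl_four : ((slB : PSL2_11) ^ 2 * slA * slB ^ 6 * slA) ^ 3 = 1 :=
  neg_one_center ((slB ^ 2 * slA * slB ^ 6 * slA) ^ 3) (by decide +kernel)


theorem quotient_of_presentation_is_psl2_11
    (G : Type*) [Group G] [Nontrivial G] (a b : G)
    (hgen : Subgroup.closure ({a, b} : Set G) = ⊤)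
    (h1 : a ^ 2 = 1) (h2 : b ^ 11 = 1) (h3 : (b * a) ^ 3 = 1)
    (h4 : (b ^ 2 * a * b ^ 6 * a) ^ 3 = 1) :
    Nonempty (G ≃* PSL2_11) := by
  let S : Set (G × PSL2_11) := {(a, (slA : PSL2_11)), (b, (slB : PSL2_11))}
  let Q : Subgroup (G × PSL2_11) := Subgroup.closure S
  let a_2 : Q := ⟨(a, (slA : PSL2_11)), Subgroup.subset_closure (by simp [S])⟩
  let b_2 : Q := ⟨(b, (slB : PSL2_11)), Subgroup.subset_closure (by simp [S])⟩
  have hgen_2 : Subgroup.closure ({a_2, b_2} : Set Q) = ⊤ := by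
    apply Subgroup.map_injective Q.subtype_injective
    rw [MonoidHom.map_closure, Set.image_pair, ← MonoidHom.range_eq_map, Subgroup.range_subtype]
    rfl
  obtain ⟨hfin, hcard⟩ := card_le_of_relations a_2 b_2 hgen_2
    (Subtype.ext (Prod.ext h1 psl_one)) (Subtype.ext (Prod.ext h2 psl_two))
    (Subtype.ext (Prod.ext h3 psl_three)) (Subtype.ext (Prod.ext h4 psl_four))
  let f : Q →* G := (MonoidHom.fst G PSL2_11).comp Q.subtype
  let g : Q →* PSL2_11 := (MonoidHom.snd G PSL2_11).comp Q.subtype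
  have hf : Function.Surjective f := by
    rw [← MonoidHom.range_eq_top, MonoidHom.range_eq_map, ← hgen_2, MonoidHom.map_closure,
      Set.image_pair]
    exact hgen
  have hg : Function.Surjective g := by
    rw [← MonoidHom.range_eq_top, MonoidHom.range_eq_map, ← hgen_2, MonoidHom.map_closure,
      Set.image_pair]
    exact psl_gen
  have hgb : Function.Bijective g :=
    (Nat.bijective_iff_surjective_and_card g).2
      ⟨hg, le_antisymm (hcard.trans card_psl_ge) (Nat.card_le_card_of_surjective g hg)⟩
  let e : Q ≃* PSL2_11 := MulEquiv.ofBijective g hgb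
  have : IsSimpleGroup PSL2_11 :=
    Matrix.ProjectiveSpecialLinearGroup.rank_two_simple (F := ZMod 11) (by simp)
  let φ : PSL2_11 →* G := f.comp e.symm.toMonoidHom
  have hφ : Function.Surjective φ := hf.comp e.symm.surjective
  have hk : φ.ker = ⊥ := by
    rcases IsSimpleGroup.eq_bot_or_eq_top_of_normal φ.ker inferInstance with h | h
    · exact h
    · exfalso
      obtain ⟨x, hx⟩ := exists_ne (1 : G)
      obtain ⟨y, rfl⟩ := hφ x
      exact hx (MonoidHom.mem_ker.1 (h ▸ Subgroup.mem_top y))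
  exact ⟨(MulEquiv.ofBijective φ ⟨(MonoidHom.ker_eq_bot_iff φ).1 hk, hφ⟩).symm⟩
end

section
/- The group presented by generators a, b subject to the relations (a*b)^3 = a^2 and (a*b^4*a*b^4)^2 * b^7 * a^4 = 1 is isomorphic to SL(2, 7). -/
abbrev SL2_7 := Matrix.SpecialLinearGroup (Fin 2) (ZMod 7)

namespace Stmt11

local notation "a" => FreeGroup.of (0 : Fin 2)
local notation "b" => FreeGroup.of (1 : Fin 2)

def rels : Set (FreeGroup (Fin 2)) :=
  {(a * b) ^ 3 * a ^ (-2 : ℤ), (a * b ^ 4 * a * b ^ 4) ^ 2 * b ^ 7 * a ^ 4}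

end Stmt11

namespace Aux

section Helpers

set_option linter.unusedSimpArgs false
set_option linter.unusedVariables false

variable {G : Type*} [Group G]

/-- `a ^ 2` is central. -/
lemma comm_sq {a b : G} (h1 : (a * b) ^ 3 * a ^ (-2 : ℤ) = 1) : Commute (a ^ 2) b := by
  have e : (a * b) ^ 3 = a ^ 2 := by
    have := mul_eq_one_iff_eq_inv.1 h1
    simpa using this
  have h : Commute (a ^ 2) (a * b) := by
    rw [← e]; exact (Commute.refl (a * b)).pow_left 3
  have h' : Commute (a ^ 2) (a⁻¹ * (a * b)) :=
    Commute.mul_right ((Commute.refl a).pow_left 2).inv_right h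
  simpa using h'

lemma rel_aba {a b : G} (h1 : (a * b) ^ 3 * a ^ (-2 : ℤ) = 1) :
    a * b * a = b⁻¹ * a * b⁻¹ := by
  have e : (a * b) ^ 3 = a ^ 2 := by
    have := mul_eq_one_iff_eq_inv.1 h1
    simpa using this
  have c := comm_sq h1
  have e2 : b * (a * b * a) * b = a := by
    have : a * (b * (a * b * a) * b) = a * a := by
      rw [← pow_two a, ← e]; simp only [pow_succ, pow_zero]; group
    exact mul_left_cancel this
  calc a * b * a = b⁻¹ * (b * (a * b * a) * b) * b⁻¹ := by group
    _ = _ := by rw [e2]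

/-- `b ^ 7` is central. -/
lemma comm_b7 {a b : G} (h1 : (a * b) ^ 3 * a ^ (-2 : ℤ) = 1)
    (h2 : (a * b ^ 4 * a * b ^ 4) ^ 2 * b ^ 7 * a ^ 4 = 1) : Commute (b ^ 7) a := by
  have cz := comm_sq h1
  have r := rel_aba h1
  -- `C` is the centralizer of `b ^ 7`
  set C := Subgroup.centralizer {b ^ 7} with hC
  have mem : ∀ g : G, g ∈ C ↔ Commute (b ^ 7) g := by
    intro g; rw [hC, Subgroup.mem_centralizer_singleton_iff]
    exact ⟨fun h => h.symm, fun h => h.symm⟩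
  have hb : b ∈ C := (mem b).2 ((Commute.refl b).pow_left 7)
  have hz : a ^ 2 ∈ C := (mem _).2 (cz.symm.pow_left 7)
  have hw : a * b ^ 4 * a * b ^ 4 ∈ C := by
    rw [mem]
    have e : b ^ 7 = ((a * b ^ 4 * a * b ^ 4) ^ 2)⁻¹ * (a ^ 4)⁻¹ := by
      rw [mul_eq_one_iff_eq_inv] at h2
      rw [← h2]; group
    rw [e]
    refine Commute.mul_left ((Commute.refl _).pow_left 2).inv_left (Commute.inv_left ?_)
    have e4 : a ^ 4 = (a ^ 2) ^ 2 := by group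
    rw [e4]
    have ca : Commute (a ^ 2) a := (Commute.refl a).pow_left 2
    exact (((ca.mul_right (cz.pow_right 4)).mul_right ca).mul_right (cz.pow_right 4)).pow_left 2
  have hx4 : a * b ^ 4 * a⁻¹ ∈ C := by
    have : a * b ^ 4 * a⁻¹ = (a * b ^ 4 * a * b ^ 4) * (b ^ 4)⁻¹ * (a ^ 2)⁻¹ := by group
    rw [this]
    exact C.mul_mem (C.mul_mem hw (C.inv_mem (C.pow_mem hb 4))) (C.inv_mem hz)
  have hx11 : a * b ^ 11 * a⁻¹ ∈ C := by
    have e : a * b ^ 11 * a⁻¹ =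
        (a ^ 2 * b ^ 4 * (a * b ^ 4 * a⁻¹) * a ^ 2 * b ^ 4)⁻¹ * (a ^ 4)⁻¹ := by
      have e4 : Commute (a ^ 4) a := (Commute.refl a).pow_left 4
      have : (a ^ 2 * b ^ 4 * (a * b ^ 4 * a⁻¹) * a ^ 2 * b ^ 4) * (a * b ^ 11 * a⁻¹) * a ^ 4
          = 1 := by
        calc _ = a * ((a * b ^ 4 * a * b ^ 4) ^ 2 * b ^ 7 * a ^ 4) * a⁻¹ := by
              simp only [pow_two]; group
          _ = 1 := by rw [h2]; group
      rw [mul_eq_one_iff_eq_inv] at this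
      rw [← this]; group
    rw [e]
    have hz4 : a ^ 4 ∈ C := by
      have : a ^ 4 = (a ^ 2) ^ 2 := by group
      rw [this]; exact C.pow_mem hz 2
    have hb4 := C.pow_mem hb 4
    exact C.mul_mem (C.inv_mem (C.mul_mem (C.mul_mem (C.mul_mem (C.mul_mem hz hb4) hx4) hz) hb4))
      (C.inv_mem hz4)
  have hx1 : a * b * a⁻¹ ∈ C := by
    have : a * b * a⁻¹ = (a * b ^ 4 * a⁻¹) ^ 3 * (a * b ^ 11 * a⁻¹)⁻¹ := by
      simp only [conj_pow]; group
    rw [this]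
    exact C.mul_mem (C.pow_mem hx4 3) (C.inv_mem hx11)
  have ha : a ∈ C := by
    have : a = b * (a * b * a⁻¹) * a ^ 2 * b := by
      calc a = b * (b⁻¹ * a * b⁻¹) * b := by group
        _ = b * (a * b * a) * b := by rw [r]
        _ = _ := by group
    rw [this]
    exact C.mul_mem (C.mul_mem (C.mul_mem hb hx1) hz) hb
  exact (mem a).1 ha

/-- The rewriting rules used below, for `B n = b ^ n`, `C n = b ^ (7 n)`, `Z n = a ^ (2 n)`. -/
structure Rules (a b : G) : Prop where
  aZ : ∀ (n : ℤ) (x : G), a * ((a ^ 2) ^ n * x) = (a ^ 2) ^ n * (a * x)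
  BZ : ∀ (m n : ℤ) (x : G), b ^ m * ((a ^ 2) ^ n * x) = (a ^ 2) ^ n * (b ^ m * x)
  CZ : ∀ (m n : ℤ) (x : G), (b ^ 7) ^ m * ((a ^ 2) ^ n * x) = (a ^ 2) ^ n * ((b ^ 7) ^ m * x)
  aC : ∀ (n : ℤ) (x : G), a * ((b ^ 7) ^ n * x) = (b ^ 7) ^ n * (a * x)
  BC : ∀ (m n : ℤ) (x : G), b ^ m * ((b ^ 7) ^ n * x) = (b ^ 7) ^ n * (b ^ m * x)
  BB : ∀ (m n : ℤ) (x : G), b ^ m * (b ^ n * x) = b ^ (m + n) * x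
  CC : ∀ (m n : ℤ) (x : G), (b ^ 7) ^ m * ((b ^ 7) ^ n * x) = (b ^ 7) ^ (m + n) * x
  ZZ : ∀ (m n : ℤ) (x : G), (a ^ 2) ^ m * ((a ^ 2) ^ n * x) = (a ^ 2) ^ (m + n) * x
  r0 : ∀ x : G, a * (a * x) = (a ^ 2) ^ (1 : ℤ) * x
  r1 : ∀ x : G, a * (b ^ (1 : ℤ) * (a * x)) = b ^ (-1 : ℤ) * (a * (b ^ (-1 : ℤ) * x))
  r2 : ∀ x : G, a * (b ^ (2 : ℤ) * (a * x)) = (a ^ 2) ^ (-1 : ℤ) *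
    (b ^ (-1 : ℤ) * (a * (b ^ (-2 : ℤ) * (a * (b ^ (-1 : ℤ) * x)))))
  r4 : ∀ x : G, a * (b ^ (4 : ℤ) * (a * x)) = (b ^ 7) ^ (-1 : ℤ) * ((a ^ 2) ^ (-4 : ℤ) *
    (b ^ (-4 : ℤ) * (a * (b ^ (-4 : ℤ) * (a * (b ^ (-4 : ℤ) * x))))))
  r3 : ∀ x : G, a * (b ^ (-4 : ℤ) * (a * x)) = (b ^ 7) ^ (1 : ℤ) * ((a ^ 2) ^ (4 : ℤ) *
    (b ^ (4 : ℤ) * (a * (b ^ (4 : ℤ) * (a * (b ^ (4 : ℤ) * x))))))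

lemma rules {a b : G} (h1 : (a * b) ^ 3 * a ^ (-2 : ℤ) = 1)
    (h2 : (a * b ^ 4 * a * b ^ 4) ^ 2 * b ^ 7 * a ^ 4 = 1) : Rules a b := by
  have zb := comm_sq h1
  have za : Commute (a ^ 2) a := (Commute.refl a).pow_left 2
  have ca := comm_b7 h1 h2
  have cb : Commute (b ^ 7) b := (Commute.refl b).pow_left 7
  have aba := rel_aba h1
  have push : ∀ {g h : G}, Commute g h → ∀ (m n : ℤ) (x : G),
      h ^ m * (g ^ n * x) = g ^ n * (h ^ m * x) := by
    intro g h hc m n x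
    rw [← mul_assoc, ← mul_assoc, (hc.zpow_zpow n m).eq]
  have merge : ∀ (g : G) (m n : ℤ) (x : G), g ^ m * (g ^ n * x) = g ^ (m + n) * x := by
    intro g m n x; rw [← mul_assoc, zpow_add]
  have R1 : ∀ x : G, a * (b * (a * x)) = b⁻¹ * (a * (b⁻¹ * x)) := by
    intro x; simpa only [mul_assoc] using congrArg (· * x) aba
  have aZ : ∀ (n : ℤ) (x : G), a * ((a ^ 2) ^ n * x) = (a ^ 2) ^ n * (a * x) := by
    intro n x; simpa using push za 1 n x
  have BZ := push zb
  have r4 : ∀ x : G, a * (b ^ (4 : ℤ) * (a * x)) = (b ^ 7) ^ (-1 : ℤ) * ((a ^ 2) ^ (-4 : ℤ) *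
    (b ^ (-4 : ℤ) * (a * (b ^ (-4 : ℤ) * (a * (b ^ (-4 : ℤ) * x)))))) := by
    intro x
    have e : a * b ^ 4 * a * b ^ 4 * (a * b ^ 4 * a * b ^ 4) = (a ^ 4)⁻¹ * (b ^ 7)⁻¹ := by
      rw [← pow_two]
      have := mul_eq_one_iff_eq_inv.1 h2
      rw [← this]
      group
    have e2 : a * b ^ 4 * a = (a ^ 4)⁻¹ * (b ^ 7)⁻¹ * ((b ^ 4)⁻¹ * a⁻¹ * (b ^ 4)⁻¹ * a⁻¹ * (b ^ 4)⁻¹) := by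
      rw [← e]; group
    have ai : a⁻¹ = (a ^ 2) ^ (-1 : ℤ) * a := by group
    have a4 : (a ^ 4)⁻¹ = (a ^ 2) ^ (-2 : ℤ) := by group
    have b4 : (b ^ 4)⁻¹ = b ^ (-4 : ℤ) := by group
    have b7 : (b ^ 7)⁻¹ = (b ^ 7) ^ (-1 : ℤ) := by group
    have b44 : b ^ 4 = b ^ (4 : ℤ) := by group
    rw [ai, a4, b4, b7, b44] at e2
    have := congrArg (· * x) e2
    simp only [mul_assoc] at this
    rw [this]
    simp only [aZ, BZ, push (zb.pow_right 7), merge]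
    norm_num
  refine ⟨aZ, BZ, push (zb.pow_right 7), fun n x => by simpa using push ca 1 n x,
    push cb, merge b, merge _, merge _, fun x => by simp [pow_two, mul_assoc], fun x => by simpa using R1 x, ?_, r4, ?_⟩
  · intro x
    have e : a * (b ^ (2 : ℤ) * (a * x)) = (a ^ 2) ^ (-1 : ℤ) * (a * (b * (a * (a * (b * (a * x)))))) := by
      have : a * (b * (a * (a * (b * (a * x))))) = a * (b ^ (1 : ℤ) * ((a ^ 2) ^ (1 : ℤ) * (b * (a * x)))) := by
        simp [pow_two, mul_assoc]
      rw [this, BZ, aZ, merge]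
      have : b ^ (2 : ℤ) = b * b := zpow_two b
      rw [this]; simp [mul_assoc]
    rw [e, R1, R1]
    group
  · intro x
    have aa : ∀ y : G, a * (a * y) = (a ^ 2) ^ (1 : ℤ) * y := fun y => by
      simp [pow_two, mul_assoc]
    have e := r4 (b ^ (4 : ℤ) * (a * (b ^ (4 : ℤ) * x)))
    simp only [merge, Int.reduceAdd, zpow_zero, one_mul, aa, BZ, aZ, push (zb.pow_right 7)] at e
    have e2 : a * x = (b ^ 7) ^ (1 : ℤ) * ((a ^ 2) ^ (3 : ℤ) *
        (b ^ (4 : ℤ) * (a * (b ^ (4 : ℤ) * (a * (b ^ (4 : ℤ) * (a * (b ^ (4 : ℤ) * x)))))))) := by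
      rw [e]
      simp only [merge, Int.reduceAdd, zpow_zero, one_mul, BZ, aZ, push cb,
        push (zb.pow_right 7)]
    rw [e2]
    have aC : ∀ (n : ℤ) (x : G), a * ((b ^ 7) ^ n * x) = (b ^ 7) ^ n * (a * x) :=
      fun n x => by simpa using push ca 1 n x
    simp only [push cb, aC, aZ, BZ, merge, Int.reduceAdd, zpow_zero, one_mul, aa,
      push (zb.pow_right 7)]

/-- First relation in the central subgroup. -/
lemma central1 {a b : G} (R : Rules a b) : (b ^ 7) ^ (9 : ℤ) * (a ^ 2) ^ (11 : ℤ) = 1 := by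
  obtain ⟨aZ, BZ, CZ, aC, BC, BB, CC, ZZ, r0, r1, r2, r4, r3⟩ := R
  have w1 : a * (b ^ (1 : ℤ) * (a * (b ^ (4 : ℤ) * (a * 1)))) =
      (a ^ 2) ^ (4 : ℤ) * ((b ^ 7) ^ (2 : ℤ) *
        (b ^ (3 : ℤ) * (a * (b ^ (4 : ℤ) * (a * (b ^ (4 : ℤ) * 1)))))) := by
    have e3 : ∀ x : G, b ^ (3 : ℤ) * x = (b ^ 7) ^ (1 : ℤ) * (b ^ (-4 : ℤ) * x) := by
      intro x; group
    rw [r1, BB]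
    simp only [Int.reduceAdd]
    rw [e3 (a * 1), aC, r3]
    simp only [BB, CC, ZZ, aZ, BZ, CZ, aC, BC, Int.reduceAdd]
  have w2 : a * (b ^ (1 : ℤ) * (a * (b ^ (4 : ℤ) * (a * 1)))) =
      (a ^ 2) ^ (-8 : ℤ) * ((b ^ 7) ^ (-7 : ℤ) *
        (b ^ (3 : ℤ) * (a * (b ^ (3 : ℤ) * (a * (b ^ (-1 : ℤ) * (a * (b ^ (3 : ℤ) * 1)))))))) := by
    have e3 : ∀ x : G, b ^ (-3 : ℤ) * x = (b ^ 7) ^ (-1 : ℤ) * (b ^ (4 : ℤ) * x) := by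
      intro x; group
    have e4 : ∀ x : G, b ^ (-4 : ℤ) * x = (b ^ 7) ^ (-1 : ℤ) * (b ^ (3 : ℤ) * x) := by
      intro x; group
    have e8 : ∀ x : G, b ^ (-8 : ℤ) * x = (b ^ 7) ^ (-1 : ℤ) * (b ^ (-1 : ℤ) * x) := by
      intro x; group
    rw [r4]
    simp only [BB, CC, ZZ, aZ, BZ, CZ, aC, BC, Int.reduceAdd, e3]
    rw [r4]
    simp only [BB, CC, ZZ, aZ, BZ, CZ, aC, BC, Int.reduceAdd, e8]
    simp only [CC, ZZ, aZ, BZ, CZ, aC, BC, Int.reduceAdd, e4]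
  have e : b ^ (4 : ℤ) * (a * (b ^ (4 : ℤ) * 1)) =
      (a ^ 2) ^ (-1 : ℤ) * (b ^ (3 : ℤ) * (a * (b ^ (-1 : ℤ) * (a * (b ^ (3 : ℤ) * 1))))) := by
    have h : ∀ x : G, b ^ (1 : ℤ) * (a * (b ^ (1 : ℤ) * (a * (b ^ (1 : ℤ) * x)))) = a * x := by
      intro x; rw [r1]; simp only [BB, Int.reduceAdd, zpow_zero, one_mul]
    have h6 : ∀ x : G, a * (b ^ (-1 : ℤ) * (a * x)) =
        (a ^ 2) ^ (1 : ℤ) * (b ^ (1 : ℤ) * (a * (b ^ (1 : ℤ) * x))) := by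
      intro x
      rw [← h x]
      simp only [BB, Int.reduceAdd, zpow_zero, one_mul, r0]
    rw [h6]
    simp only [BB, BZ, ZZ, Int.reduceAdd, zpow_zero, one_mul]
  rw [w2, e] at w1
  simp only [aZ, BZ, CZ, ZZ, aC, BC, Int.reduceAdd] at w1
  have := congrArg (fun y => (b ^ 7) ^ (7 : ℤ) * ((a ^ 2) ^ (8 : ℤ) * y)) w1
  simp only [aZ, BZ, CZ, CC, ZZ, aC, BC, Int.reduceAdd, zpow_zero, one_mul] at this
  rw [← mul_assoc ((a ^ 2) ^ (11 : ℤ))] at this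
  replace this := right_eq_mul.1 this
  have hc := CZ 9 11 1
  rw [mul_one, mul_one] at hc
  rw [hc, this]

/-- The word for (a lift of) the diagonal element. -/
def hh (a b : G) : G := b ^ 2 * a * b ^ 4 * a * b ^ 2 * a

lemma uu_rules {a b : G} (R : Rules a b) :
    (∀ x, b ^ 2 * a * b ^ 4 * a * b ^ 2 * (a * (b * (a * (b ^ 2 * a * b ^ 4 * a * b ^ 2 * x)))) =
      (a ^ 2) ^ (2 : ℤ) * ((b ^ 7) ^ (1 : ℤ) * (b ^ 4 * x))) ∧
    (∀ x, b ^ 2 * a * b ^ 4 * a * b ^ 2 * (b ^ 2 * a * b ^ 4 * a * b ^ 2 * x) =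
      (a ^ 2) ^ (-2 : ℤ) * ((b ^ 7) ^ (-1 : ℤ) * x)) := by
  obtain ⟨aZ, BZ, CZ, aC, BC, BB, CC, ZZ, r0, r1, r2, r4, r3⟩ := R
  have b2 : b ^ 2 = b ^ (2 : ℤ) := by group
  have b4 : b ^ 4 = b ^ (4 : ℤ) := by group
  have b7 : ∀ x : G, b ^ (7 : ℤ) * x = (b ^ 7) ^ (1 : ℤ) * x := by intro x; group
  constructor
  · intro x
    have b1 : ∀ x : G, b * x = b ^ (1 : ℤ) * x := by intro x; group
    rw [b1, b2, b4]
    simp only [mul_assoc]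
    rw [r2]
    simp only [BB, BZ, ZZ, aZ, r0, Int.reduceAdd, zpow_zero, one_mul, b7, aC, BC, CZ]
  · intro x
    rw [b2, b4]
    simp only [mul_assoc]
    rw [r4]
    simp only [BB, BZ, ZZ, aZ, r0, Int.reduceAdd, zpow_zero, one_mul, aC, BC, CZ, CC]

lemma hb_rule {a b : G} (R : Rules a b) :
    hh a b * b = (a ^ 2) ^ (3 : ℤ) * ((b ^ 7) ^ (2 : ℤ) * (b ^ 4 * hh a b)) := by
  obtain ⟨U1, U2⟩ := uu_rules R
  obtain ⟨aZ, BZ, CZ, aC, BC, BB, CC, ZZ, r0, r1, r2, r4, r3⟩ := R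
  have hu : hh a b = b ^ 2 * a * b ^ 4 * a * b ^ 2 * a := rfl
  have uZ : ∀ (n : ℤ) (x : G), b ^ 2 * a * b ^ 4 * a * b ^ 2 * ((a ^ 2) ^ n * x) =
      (a ^ 2) ^ n * (b ^ 2 * a * b ^ 4 * a * b ^ 2 * x) := by
    intro n x
    have b2 : b ^ 2 = b ^ (2 : ℤ) := by group
    have b4 : b ^ 4 = b ^ (4 : ℤ) := by group
    rw [b2, b4]; simp only [mul_assoc, BZ, aZ]
  have uC : ∀ (n : ℤ) (x : G), b ^ 2 * a * b ^ 4 * a * b ^ 2 * ((b ^ 7) ^ n * x) =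
      (b ^ 7) ^ n * (b ^ 2 * a * b ^ 4 * a * b ^ 2 * x) := by
    intro n x
    have b2 : b ^ 2 = b ^ (2 : ℤ) := by group
    have b4 : b ^ 4 = b ^ (4 : ℤ) := by group
    rw [b2, b4]; simp only [mul_assoc, BC, aC]
  set u := b ^ 2 * a * b ^ 4 * a * b ^ 2 with hu'
  rw [hu]
  have e := U1 (u * a)
  have b1 : ∀ x : G, b * x = b ^ (1 : ℤ) * x := by intro x; group
  rw [U2, b1] at e
  have aa : a * a = (a ^ 2) ^ (1 : ℤ) * 1 := by simp [pow_two]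
  simp only [aZ, aC, BZ, BC, CZ, uZ, uC, aa, ZZ, Int.reduceAdd] at e
  have := congrArg (fun y => (b ^ 7) ^ (1 : ℤ) * ((a ^ 2) ^ (1 : ℤ) * y)) e
  simp only [aZ, BZ, CZ, CC, ZZ, aC, BC, Int.reduceAdd, zpow_zero, one_mul, mul_one] at this
  rw [← this]
  simp [mul_assoc]

lemma central2 {a b : G} (R : Rules a b) : (b ^ 7) ^ (17 : ℤ) * (a ^ 2) ^ (21 : ℤ) = 1 := by
  have H := hb_rule R
  obtain ⟨aZ, BZ, CZ, aC, BC, BB, CC, ZZ, r0, r1, r2, r4, r3⟩ := R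
  have cz : Commute (b ^ 7) (a ^ 2) := by simpa [Commute, SemiconjBy] using CZ 1 1 1
  have zb : Commute (a ^ 2) b := by simpa [Commute, SemiconjBy] using (BZ 1 1 1).symm
  have ca : Commute (b ^ 7) a := by simpa [Commute, SemiconjBy] using (aC 1 1).symm
  have cb : Commute (b ^ 7) b := (Commute.refl b).pow_left 7
  set h := hh a b with hh'
  have ch : Commute (b ^ 7) h := by
    rw [hh', hh]
    exact ((((((cb.pow_right 2).mul_right ca).mul_right (cb.pow_right 4)).mul_right ca).mul_right
      (cb.pow_right 2)).mul_right ca)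
  have e : h * b * h⁻¹ = (a ^ 2) ^ (3 : ℤ) * ((b ^ 7) ^ (2 : ℤ) * b ^ 4) := by
    rw [H]; group
  have e7 : h * b ^ 7 * h⁻¹ = ((a ^ 2) ^ (3 : ℤ) * ((b ^ 7) ^ (2 : ℤ) * b ^ 4)) ^ 7 := by
    rw [← e, conj_pow]
  rw [← ch.eq, mul_inv_cancel_right] at e7
  have c1 : Commute ((a ^ 2) ^ (3 : ℤ)) ((b ^ 7) ^ (2 : ℤ) * b ^ 4) :=
    ((cz.symm.zpow_right 2).mul_right (zb.pow_right 4)).zpow_left 3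
  have c2 : Commute ((b ^ 7) ^ (2 : ℤ)) (b ^ 4) := (cb.pow_right 4).zpow_left 2
  rw [c1.mul_pow, c2.mul_pow] at e7
  have e8 : (b ^ 7) ^ (17 : ℤ) = (b ^ 7)⁻¹ * (((b ^ 7) ^ (2 : ℤ)) ^ 7 * (b ^ 4) ^ 7) := by group
  have e9 : (a ^ 2) ^ (21 : ℤ) = ((a ^ 2) ^ (3 : ℤ)) ^ 7 := by group
  rw [(cz.zpow_zpow 17 21).eq, e8, e9]
  have c3 : Commute (((a ^ 2) ^ (3 : ℤ)) ^ 7) (b ^ 7)⁻¹ :=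
    ((cz.symm.zpow_left 3).pow_left 7).inv_right
  rw [← mul_assoc, c3.eq, mul_assoc, ← e7, inv_mul_cancel]

/-- The centre has order at most two. -/
lemma central {a b : G} (R : Rules a b) : b ^ 7 = a ^ 2 ∧ (a ^ 2) * (a ^ 2) = 1 := by
  have h1 := central1 R
  have h2 := central2 R
  have cz : Commute (b ^ 7) (a ^ 2) := by simpa [Commute, SemiconjBy] using R.CZ 1 1 1
  generalize b ^ 7 = c at *
  generalize a ^ 2 = z at *
  have e : ∀ m n k l : ℤ, c ^ m * z ^ n = 1 → c ^ k * z ^ l = 1 → ∀ p q : ℤ,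
      c ^ (m * p + k * q) * z ^ (n * p + l * q) = 1 := by
    intro m n k l h h' p q
    have g1 : (c ^ m * z ^ n) ^ p * (c ^ k * z ^ l) ^ q = 1 := by rw [h, h']; simp
    rw [(cz.zpow_zpow m n).mul_zpow, (cz.zpow_zpow k l).mul_zpow, ← zpow_mul, ← zpow_mul,
      ← zpow_mul, ← zpow_mul, mul_assoc, ← mul_assoc (z ^ (n * p)),
      (cz.symm.zpow_zpow (n * p) (k * q)).eq] at g1
    rw [zpow_add, zpow_add, ← g1]; group
  have f1 := e _ _ _ _ h1 h2 2 (-1)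
  have f2 := e _ _ _ _ h1 h2 (-17) 9
  norm_num at f1 f2
  have f2' : z * z = 1 := by rw [← f2]; simp [zpow_two, pow_two]
  refine ⟨?_, f2'⟩
  rw [mul_eq_one_iff_eq_inv.1 f1]
  exact (mul_eq_one_iff_eq_inv.1 f2').symm

end Helpers
section Helpers2

set_option linter.unusedSimpArgs false

variable {G : Type*} [Group G]

/-- Relations of `SL(2,7)` in Bruhat form. -/
structure Bruhat (a z t h : G) : Prop where
  zz : z * z = 1
  za : Commute z a
  zt : Commute z t
  zh : Commute z h
  aa : a * a = z
  t7 : t ^ 7 = 1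
  h3 : h ^ 3 = 1
  ht : h * t = t ^ 4 * h
  ah : a * h = h⁻¹ * a
  ata : a * t * a = z * (t⁻¹ * a * t⁻¹)

lemma bruhat {a b : G} (h1 : (a * b) ^ 3 * a ^ (-2 : ℤ) = 1)
    (h2 : (a * b ^ 4 * a * b ^ 4) ^ 2 * b ^ 7 * a ^ 4 = 1) :
    Bruhat a (a ^ 2) (a ^ 2 * b) (hh a b) := by
  have R := rules h1 h2
  obtain ⟨hc, zz⟩ := central R
  have HB := hb_rule R
  have U2 := (uu_rules R).2
  have aba := rel_aba h1
  have zb := comm_sq h1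
  have za : Commute (a ^ 2) a := (Commute.refl a).pow_left 2
  have zu : Commute (a ^ 2) (b ^ 2 * a * b ^ 4 * a * b ^ 2) :=
    (((((zb.pow_right 2).mul_right za).mul_right (zb.pow_right 4)).mul_right za).mul_right
      (zb.pow_right 2))
  have zh : Commute (a ^ 2) (hh a b) := zu.mul_right za
  have hu : hh a b = b ^ 2 * a * b ^ 4 * a * b ^ 2 * a := rfl
  have hu0 : a * b ^ 4 * a = (b ^ 2)⁻¹ * (b ^ 2 * a * b ^ 4 * a * b ^ 2) * (b ^ 2)⁻¹ := by group
  have aa : a * a = a ^ 2 := (pow_two a).symm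
  rw [hc] at HB U2
  clear R h1 h2
  generalize b ^ 2 * a * b ^ 4 * a * b ^ 2 = u at *
  generalize hh a b = h at *
  generalize a ^ 2 = z at *
  have zi : z⁻¹ = z := inv_eq_of_mul_eq_one_left zz
  have z2 : z ^ 2 = 1 := by rw [pow_two, zz]
  have uu : u * u = z := by
    have := U2 1
    simp only [mul_one] at this
    rw [this, ← zpow_add]
    have : z ^ (-2 + -1 : ℤ) = (z ^ 2)⁻¹ * z⁻¹ := by group
    rw [this, z2, zi]; simp
  have hinv : h⁻¹ = a * u := by
    rw [inv_eq_iff_mul_eq_one, hu]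
    calc u * a * (a * u) = u * (a * a) * u := by group
      _ = z * (u * u) := by rw [aa, ← zu.eq]; group
      _ = 1 := by rw [uu, zz]
  have ah : a * h = h⁻¹ * a := by rw [hinv, hu]; group
  have tb : ∀ n : ℕ, (z * b) ^ n = z ^ n * b ^ n := fun n => zb.mul_pow n
  have z4 : z ^ 4 = 1 := by rw [show 4 = 2 * 2 from rfl, pow_mul, z2, one_pow]
  have ht : h * (z * b) = (z * b) ^ 4 * h := by
    rw [tb, z4, one_mul, ← mul_assoc, ← zh.eq, mul_assoc, HB, ← mul_assoc, ← mul_assoc,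
      ← zpow_one_add, ← zpow_add]
    have : z ^ (1 + 3 + 2 : ℤ) = z ^ 4 * z ^ 2 := by group
    rw [this, z4, z2]; simp
  have ata : a * (z * b) * a = z * ((z * b)⁻¹ * a * (z * b)⁻¹) := by
    calc a * (z * b) * a = z * (a * b * a) := by rw [← mul_assoc, ← za.eq]; group
      _ = z * (b⁻¹ * a * b⁻¹) := by rw [aba]
      _ = z * (z * z) * (b⁻¹ * a * b⁻¹) := by rw [zz, mul_one]
      _ = _ := by
        rw [mul_inv_rev, zi]
        have e1 : Commute z (b⁻¹ * z * a * b⁻¹) :=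
          ((zb.inv_right.mul_right (Commute.refl z)).mul_right za).mul_right zb.inv_right
        have e2 : Commute z b⁻¹ := zb.inv_right
        calc _ = z * (z * ((z * b⁻¹) * a * b⁻¹)) := by group
          _ = z * (z * (b⁻¹ * z * a * b⁻¹)) := by rw [e2.eq]
          _ = z * ((b⁻¹ * z * a * b⁻¹) * z) := by rw [e1.eq]
          _ = _ := by group
  have zt : Commute z (z * b) := (Commute.refl z).mul_right zb
  have t4 : (z * b) ^ 4 = b ^ 4 := by rw [tb, z4, one_mul]
  have t2 : (z * b) ^ 2 = b ^ 2 := by rw [tb, z2, one_mul]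
  have t7 : (z * b) ^ 7 = 1 := by
    rw [tb, hc, ← pow_succ, show 7 + 1 = 4 * 2 from rfl, pow_mul, z4, one_pow]
  refine ⟨zz, za, zt, zh, aa, t7, ?_, ht, ah, ata⟩
  rw [← t4, ← t2] at hu0
  generalize z * b = t at *
  have ht2 : h * t ^ 2 = t * h := by
    calc h * t ^ 2 = (h * t) * t := by rw [pow_two, mul_assoc]
      _ = t ^ 4 * (h * t) := by rw [ht, mul_assoc, ht]
      _ = t ^ 7 * t * h := by rw [ht]; group
      _ = _ := by rw [t7, one_mul]
  have c1 : t⁻¹ * h = h * (t ^ 2)⁻¹ := by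
    rw [eq_mul_inv_iff_mul_eq, mul_assoc, ht2]; group
  have c2 : h⁻¹ * t⁻¹ = (t ^ 2)⁻¹ * h⁻¹ := by
    rw [← mul_inv_rev, ← mul_inv_rev, ht2]
  have c3 : t ^ 4 = h * t * h⁻¹ := by rw [ht]; group
  have key : u = z * (h⁻¹ * h⁻¹ * a) := by
    calc u = t ^ 2 * ((t ^ 2)⁻¹ * u * (t ^ 2)⁻¹) * t ^ 2 := by group
      _ = t ^ 2 * (a * t ^ 4 * a) * t ^ 2 := by rw [← hu0]
      _ = t ^ 2 * ((a * h) * t * (h⁻¹ * a)) * t ^ 2 := by rw [c3]; group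
      _ = t ^ 2 * h⁻¹ * (a * t * a) * h * t ^ 2 := by
        rw [← ah, show t ^ 2 * (a * h * t * (a * h)) * t ^ 2 =
          t ^ 2 * (a * h) * (t * a) * h * t ^ 2 by group, ah]; group
      _ = t ^ 2 * h⁻¹ * z * t⁻¹ * a * (t⁻¹ * h) * t ^ 2 := by rw [ata]; group
      _ = t ^ 2 * (h⁻¹ * z) * t⁻¹ * (a * h) := by rw [c1]; group
      _ = (t ^ 2 * z) * (h⁻¹ * t⁻¹) * (a * h) := by rw [← zh.inv_right.eq]; group
      _ = z * (h⁻¹ * (a * h)) := by rw [c2, ← (zt.pow_right 2).eq]; group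
      _ = _ := by rw [ah]; group
  have : h = h⁻¹ * h⁻¹ := by
    calc h = u * a := hu
      _ = z * (h⁻¹ * h⁻¹ * (a * a)) := by rw [key]; group
      _ = (z * (h⁻¹ * h⁻¹)) * z := by rw [aa]; group
      _ = h⁻¹ * h⁻¹ * (z * z) := by
        rw [(zh.inv_right.mul_right zh.inv_right).eq]; group
      _ = _ := by rw [zz, mul_one]
  calc h ^ 3 = h * (h * h) := by rw [pow_succ, pow_two, mul_assoc]
    _ = (h⁻¹ * h⁻¹) * (h * h) := by rw [← this]
    _ = 1 := by group

section table
variable {a z t h : G}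

lemma Bruhat.th (B : Bruhat a z t h) (n : ℤ) : t ^ n * h = h * t ^ (2 * n) := by
  have ht2 : h * t ^ 2 = t * h := by
    calc h * t ^ 2 = (h * t) * t := by rw [pow_two, mul_assoc]
      _ = t ^ 4 * (h * t) := by rw [B.ht, mul_assoc, B.ht]
      _ = t ^ 7 * t * h := by rw [B.ht]; group
      _ = _ := by rw [B.t7, one_mul]
  have : SemiconjBy h (t ^ 2) t := ht2
  have := this.zpow_right n
  rw [← this.eq, ← zpow_natCast, ← zpow_mul]; norm_num

lemma Bruhat.th2 (B : Bruhat a z t h) (n : ℤ) : t ^ n * h ^ 2 = h ^ 2 * t ^ (4 * n) := by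
  rw [pow_two, ← mul_assoc, B.th, mul_assoc, B.th, mul_assoc]; ring_nf

lemma Bruhat.red (B : Bruhat a z t h) (j : ℤ) : t ^ j = t ^ (j % 7) := by
  conv_lhs => rw [← Int.emod_add_mul_ediv j 7, zpow_add, zpow_mul]
  have : t ^ (7 : ℤ) = 1 := by exact_mod_cast B.t7
  rw [this]; simp

lemma Bruhat.hinv (B : Bruhat a z t h) : h⁻¹ = h ^ 2 := by
  rw [inv_eq_iff_mul_eq_one, ← pow_succ', B.h3]

lemma Bruhat.ah2 (B : Bruhat a z t h) : a * h ^ 2 = h * a := by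
  rw [← B.hinv, mul_inv_eq_iff_eq_mul, mul_assoc, B.ah, mul_inv_cancel_left]

lemma Bruhat.t4 (B : Bruhat a z t h) (n : ℤ) : t ^ (4 * n) = h * t ^ n * h ^ 2 := by
  rw [mul_assoc, B.th2, ← mul_assoc, ← pow_succ', B.h3, one_mul]

lemma Bruhat.t2 (B : Bruhat a z t h) (n : ℤ) : t ^ (2 * n) = h ^ 2 * t ^ n * h := by
  rw [mul_assoc, B.th, ← mul_assoc, ← pow_succ, B.h3, one_mul]

lemma Bruhat.tab4 (B : Bruhat a z t h) (n m k : ℤ)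
    (e : a * t ^ n * a = z ^ k * (t ^ m * a * t ^ m)) :
    a * t ^ (4 * n) * a = z ^ k * (h ^ 1 * t ^ (4 * m) * a * t ^ (2 * m)) := by
  have zh := (B.zh.zpow_left k).pow_right 2
  calc a * t ^ (4 * n) * a = (a * h) * t ^ n * (h ^ 2 * a) := by rw [B.t4]; group
    _ = h ^ 2 * a * t ^ n * (a * h) := by rw [B.ah, B.hinv]
    _ = h ^ 2 * (a * t ^ n * a) * h := by group
    _ = (h ^ 2 * z ^ k) * t ^ m * a * (t ^ m * h) := by rw [e]; group
    _ = z ^ k * h ^ 2 * t ^ m * (a * h) * t ^ (2 * m) := by rw [← zh.eq, B.th]; group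
    _ = z ^ k * h ^ 2 * (t ^ m * h ^ 2) * a * t ^ (2 * m) := by rw [B.ah, B.hinv]; group
    _ = z ^ k * h ^ 3 * h * t ^ (4 * m) * a * t ^ (2 * m) := by
      rw [B.th2]; group
    _ = _ := by rw [B.h3]; group

lemma Bruhat.tab2 (B : Bruhat a z t h) (n m k : ℤ)
    (e : a * t ^ n * a = z ^ k * (t ^ m * a * t ^ m)) :
    a * t ^ (2 * n) * a = z ^ k * (h ^ 2 * t ^ (2 * m) * a * t ^ (4 * m)) := by
  have zh := (B.zh.zpow_left k)
  calc a * t ^ (2 * n) * a = (a * h ^ 2) * t ^ n * (h * a) := by rw [B.t2]; group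
    _ = h * a * t ^ n * (a * h ^ 2) := by rw [B.ah2]
    _ = h * (a * t ^ n * a) * h ^ 2 := by group
    _ = (h * z ^ k) * t ^ m * a * (t ^ m * h ^ 2) := by rw [e]; group
    _ = z ^ k * h * t ^ m * (a * h ^ 2) * t ^ (4 * m) := by rw [← zh.eq, B.th2]; group
    _ = z ^ k * h * (t ^ m * h) * a * t ^ (4 * m) := by rw [B.ah2]; group
    _ = z ^ k * (h * h) * t ^ (2 * m) * a * t ^ (4 * m) := by rw [B.th]; group
    _ = _ := by rw [← pow_two]; group

lemma Bruhat.tab (B : Bruhat a z t h) (j : ℤ) : a * t ^ j * a = z ∨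
    ∃ (k : ℤ) (l : ℕ) (i i' : ℤ), l < 3 ∧ a * t ^ j * a = z ^ k * (h ^ l * t ^ i * a * t ^ i') := by
  have e1 : a * t ^ (1 : ℤ) * a = z ^ (1 : ℤ) * (t ^ (-1 : ℤ) * a * t ^ (-1 : ℤ)) := by
    simpa using B.ata
  have e6 : a * t ^ (-1 : ℤ) * a = z ^ (0 : ℤ) * (t ^ (1 : ℤ) * a * t ^ (1 : ℤ)) := by
    have zi : z⁻¹ = z := inv_eq_of_mul_eq_one_left B.zz
    have ai : a⁻¹ = z * a := by
      rw [inv_eq_iff_mul_eq_one, ← mul_assoc, ← B.za.eq, mul_assoc, B.aa, B.zz]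
    have e := congrArg (fun y => y⁻¹) B.ata
    simp only [mul_inv_rev, inv_inv, ai, zi] at e
    have zt := B.zt.inv_right
    have l : z * a * (t⁻¹ * (z * a)) = a * t⁻¹ * a := by
      calc z * a * (t⁻¹ * (z * a)) = z * ((a * t⁻¹) * z) * a := by group
        _ = (z * z) * (a * t⁻¹) * a := by rw [← (B.za.mul_right zt).eq]; group
        _ = _ := by rw [B.zz, one_mul]
    have r : t * (z * a * t) * z = t * a * t := by
      calc t * (z * a * t) * z = (t * z) * ((a * t) * z) := by group
        _ = (z * t) * (z * (a * t)) := by rw [← B.zt.eq, ← (B.za.mul_right B.zt).eq]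
        _ = z * (t * z) * (a * t) := by group
        _ = z * z * t * (a * t) := by rw [← B.zt.eq]; group
        _ = _ := by rw [B.zz, one_mul, mul_assoc]
    rw [l, r] at e
    simpa using e
  have f4 := B.tab4 _ _ _ e1
  have f3 := B.tab4 _ _ _ e6
  have f2 := B.tab2 _ _ _ e1
  have f5 := B.tab2 _ _ _ e6
  have d6 : t ^ (6 : ℤ) = t ^ (-1 : ℤ) := by rw [B.red 6, B.red (-1)]; norm_num
  have d5 : t ^ (5 : ℤ) = t ^ (2 * -1 : ℤ) := by rw [B.red 5, B.red (2 * -1)]; norm_num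
  have d3 : t ^ (3 : ℤ) = t ^ (4 * -1 : ℤ) := by rw [B.red 3, B.red (4 * -1)]; norm_num
  rw [B.red j]
  have hlo : 0 ≤ j % 7 := Int.emod_nonneg _ (by norm_num)
  have hhi : j % 7 < 7 := Int.emod_lt_of_pos _ (by norm_num)
  generalize j % 7 = r at *
  interval_cases r
  · left; simpa using B.aa
  · right; exact ⟨1, 0, -1, -1, by norm_num, by rw [e1]; simp⟩
  · right; exact ⟨1, 2, 2 * -1, 4 * -1, by norm_num, f2⟩
  · right; refine ⟨0, 1, 4 * 1, 2 * 1, by norm_num, ?_⟩; rw [d3]; exact f3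
  · right; exact ⟨1, 1, 4 * -1, 2 * -1, by norm_num, f4⟩
  · right; refine ⟨0, 2, 2 * 1, 4 * 1, by norm_num, ?_⟩; rw [d5]; exact f5
  · right; exact ⟨0, 0, 1, 1, by norm_num, by rw [d6, e6]; simp⟩

/-- Being in Bruhat normal form. -/
def NF (a z t h g : G) : Prop :=
  (∃ (k : ℤ) (l : ℕ) (i : ℤ), g = z ^ k * h ^ l * t ^ i) ∨
  (∃ (k : ℤ) (l : ℕ) (i j : ℤ), g = z ^ k * h ^ l * t ^ i * a * t ^ j)

lemma Bruhat.nf_t (_B : Bruhat a z t h) {g : G} (hg : NF a z t h g) (n : ℤ) :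
    NF a z t h (g * t ^ n) := by
  rcases hg with ⟨k, l, i, rfl⟩ | ⟨k, l, i, j, rfl⟩
  · exact Or.inl ⟨k, l, i + n, by rw [zpow_add]; group⟩
  · exact Or.inr ⟨k, l, i, j + n, by rw [zpow_add]; group⟩

lemma Bruhat.nf_z (B : Bruhat a z t h) {g : G} (hg : NF a z t h g) (n : ℤ) :
    NF a z t h (g * z ^ n) := by
  have zc : ∀ (m : ℕ) (i : ℤ), Commute (z ^ n) (h ^ m * t ^ i) := fun m i =>
    ((B.zh.pow_right m).mul_right (B.zt.zpow_right i)).zpow_left n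
  rcases hg with ⟨k, l, i, rfl⟩ | ⟨k, l, i, j, rfl⟩
  · refine Or.inl ⟨k + n, l, i, ?_⟩
    rw [mul_assoc (z ^ k), mul_assoc, ← (zc l i).eq, zpow_add]; group
  · refine Or.inr ⟨k + n, l, i, j, ?_⟩
    have : Commute (z ^ n) (h ^ l * t ^ i * a * t ^ j) :=
      ((zc l i).mul_right (B.za.zpow_left n)).mul_right ((B.zt.zpow_right j).zpow_left n)
    calc z ^ k * h ^ l * t ^ i * a * t ^ j * z ^ n
        = z ^ k * ((h ^ l * t ^ i * a * t ^ j) * z ^ n) := by group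
      _ = z ^ k * z ^ n * (h ^ l * t ^ i * a * t ^ j) := by rw [← this.eq, mul_assoc (z ^ k)]
      _ = _ := by rw [zpow_add]; group

lemma Bruhat.nf_a (B : Bruhat a z t h) {g : G} (hg : NF a z t h g) : NF a z t h (g * a) := by
  rcases hg with ⟨k, l, i, rfl⟩ | ⟨k, l, i, j, rfl⟩
  · exact Or.inr ⟨k, l, i, 0, by simp⟩
  · have e : z ^ k * h ^ l * t ^ i * a * t ^ j * a = z ^ k * h ^ l * t ^ i * (a * t ^ j * a) := by
      group
    rw [e]
    rcases B.tab j with h0 | ⟨k', l', i', j', hl, h0⟩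
    · rw [h0]
      have := B.nf_z (g := z ^ k * h ^ l * t ^ i) (Or.inl ⟨k, l, i, rfl⟩) 1
      simpa using this
    · rw [h0, ← mul_assoc]
      have hz : z ^ k * h ^ l * t ^ i * z ^ k' = z ^ (k + k') * h ^ l * t ^ i := by
        have : Commute (z ^ k') (h ^ l * t ^ i) :=
          ((B.zh.pow_right l).mul_right (B.zt.zpow_right i)).zpow_left k'
        rw [mul_assoc (z ^ k), mul_assoc, ← this.eq, zpow_add]; group
      rw [hz]
      interval_cases l'
      · exact Or.inr ⟨k + k', l, i + i', j', by simp [zpow_add, mul_assoc]⟩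
      · refine Or.inr ⟨k + k', l + 1, 2 * i + i', j', ?_⟩
        calc _ = z ^ (k + k') * h ^ l * (t ^ i * h) * t ^ i' * a * t ^ j' := by group
          _ = _ := by rw [B.th, pow_succ, zpow_add t]; simp only [mul_assoc]
      · refine Or.inr ⟨k + k', l + 2, 4 * i + i', j', ?_⟩
        calc _ = z ^ (k + k') * h ^ l * (t ^ i * h ^ 2) * t ^ i' * a * t ^ j' := by group
          _ = _ := by rw [B.th2, pow_add, zpow_add t]; simp only [mul_assoc]

lemma Bruhat.nf_all (B : Bruhat a z t h) {b : G} (hb : t = z * b)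
    (g : G) (hg : g ∈ Subgroup.closure {a, b}) : NF a z t h g := by
  have zi : z⁻¹ = z := inv_eq_of_mul_eq_one_left B.zz
  have hb' : b = z ^ (-1 : ℤ) * t ^ (1 : ℤ) := by rw [hb]; group
  have hbi : b⁻¹ = t ^ (-1 : ℤ) * z ^ (1 : ℤ) := by rw [hb]; group
  have ai : a⁻¹ = a * z ^ (1 : ℤ) := by
    rw [inv_eq_iff_mul_eq_one, zpow_one, ← mul_assoc, B.aa, B.zz]
  induction hg using Subgroup.closure_induction_right with
  | one => exact Or.inl ⟨0, 0, 0, by simp⟩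
  | mul_right x hx y hy ih =>
    rcases hy with rfl | rfl
    · exact B.nf_a ih
    · rw [hb', ← mul_assoc]; exact B.nf_t (B.nf_z ih _) _
  | mul_inv_cancel x hx y hy ih =>
    rcases hy with rfl | rfl
    · rw [ai, ← mul_assoc]; exact B.nf_z (B.nf_a ih) _
    · rw [hbi, ← mul_assoc]; exact B.nf_z (B.nf_t ih _) _

lemma Bruhat.nf_fin (B : Bruhat a z t h) {g : G} (hg : NF a z t h g) :
    (∃ (k : Fin 2) (l : Fin 3) (i : Fin 7), g = z ^ k.1 * h ^ l.1 * t ^ i.1) ∨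
    (∃ (k : Fin 2) (l : Fin 3) (i j : Fin 7),
      g = z ^ k.1 * h ^ l.1 * t ^ i.1 * a * t ^ j.1) := by
  have hz : ∀ k : ℤ, ∃ k' : Fin 2, z ^ k = z ^ k'.1 := by
    intro k
    refine ⟨⟨(k % 2).toNat, by omega⟩, ?_⟩
    rw [← zpow_natCast, Int.toNat_of_nonneg (by omega)]
    conv_lhs => rw [← Int.emod_add_mul_ediv k 2, zpow_add, zpow_mul, zpow_two, B.zz]
    simp
  have ht : ∀ k : ℤ, ∃ k' : Fin 7, t ^ k = t ^ k'.1 := by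
    intro k
    refine ⟨⟨(k % 7).toNat, by omega⟩, ?_⟩
    rw [← zpow_natCast, Int.toNat_of_nonneg (by omega), B.red k]
  have hl : ∀ k : ℕ, ∃ k' : Fin 3, h ^ k = h ^ k'.1 := by
    intro k
    exact ⟨⟨k % 3, by omega⟩, pow_eq_pow_mod k B.h3⟩
  rcases hg with ⟨k, l, i, rfl⟩ | ⟨k, l, i, j, rfl⟩
  · obtain ⟨k', hk⟩ := hz k
    obtain ⟨l', hl⟩ := hl l
    obtain ⟨i', hi⟩ := ht i
    exact Or.inl ⟨k', l', i', by rw [hk, hl, hi]⟩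
  · obtain ⟨k', hk⟩ := hz k
    obtain ⟨l', hl⟩ := hl l
    obtain ⟨i', hi⟩ := ht i
    obtain ⟨j', hj⟩ := ht j
    exact Or.inr ⟨k', l', i', j', by rw [hk, hl, hi, hj]⟩

end table

end Helpers2

/-- Images of the generators. -/
def mA : SL2_7 := ⟨!![0, -1; 1, 0], by decide⟩
def mB : SL2_7 := ⟨!![-1, 1; 0, -1], by decide⟩
def mZ : SL2_7 := ⟨!![-1, 0; 0, -1], by decide⟩
def mT : SL2_7 := ⟨!![1, -1; 0, 1], by decide⟩
def mH : SL2_7 := ⟨!![2, 0; 0, 4], by decide⟩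

lemma mH_eq : hh mA mB = mH := by decide
lemma mZ_eq : mA ^ 2 = mZ := by decide
lemma mT_eq : mA ^ 2 * mB = mT := by decide
lemma m_rel1 : (mA * mB) ^ 3 * mA ^ (-2 : ℤ) = 1 := by decide
lemma m_rel2 : (mA * mB ^ 4 * mA * mB ^ 4) ^ 2 * mB ^ 7 * mA ^ 4 = 1 := by decide

lemma m_diag : ∀ r : ZMod 7, r ≠ 0 → ∃ (k : Fin 2) (l : Fin 3),
    (mZ ^ k.1 * mH ^ l.1).1 = !![r⁻¹, 0; 0, r] := by decide +kernel

lemma m_unip : ∀ c : ZMod 7, ∃ i : Fin 7, (mT ^ i.1).1 = !![1, c; 0, 1] := by decide +kernel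

lemma m_diag' : ∀ (k : Fin 2) (l : Fin 3), ∃ p s : ZMod 7, s ≠ 0 ∧
    (mZ ^ k.1 * mH ^ l.1).1 = !![p, 0; 0, s] ∧ (p = 1 → k = 0 ∧ l = 0) := by decide +kernel

lemma m_unip' : ∀ i : Fin 7, ∃ c : ZMod 7, (mT ^ i.1).1 = !![1, c; 0, 1] ∧ (c = 0 → i = 0) := by
  decide +kernel

lemma m_inj1 (k : Fin 2) (l : Fin 3) (i : Fin 7)
    (e : mZ ^ k.1 * mH ^ l.1 * mT ^ i.1 = 1) : k = 0 ∧ l = 0 ∧ i = 0 := by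
  obtain ⟨p, s, hs, e1, hp⟩ := m_diag' k l
  obtain ⟨c, e2, hc⟩ := m_unip' i
  have e' := congrArg Subtype.val e
  have e3 : (mZ ^ k.1 * mH ^ l.1 * mT ^ i.1).1 =
      (mZ ^ k.1 * mH ^ l.1).1 * (mT ^ i.1).1 := rfl
  rw [e3, e1, e2] at e'
  have h0 := congrFun (congrFun e' 0) 0
  have h1 := congrFun (congrFun e' 0) 1
  simp at h0 h1
  subst h0
  exact ⟨(hp rfl).1, (hp rfl).2, hc (by simpa using h1)⟩

lemma m_inj2 (k : Fin 2) (l : Fin 3) (i j : Fin 7) :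
    mZ ^ k.1 * mH ^ l.1 * mT ^ i.1 * mA * mT ^ j.1 ≠ 1 := by
  intro e
  obtain ⟨p, s, hs, e1, hp⟩ := m_diag' k l
  obtain ⟨c, e2, hc⟩ := m_unip' i
  obtain ⟨d, e4, hd⟩ := m_unip' j
  have e' := congrArg Subtype.val e
  have e3 : (mZ ^ k.1 * mH ^ l.1 * mT ^ i.1 * mA * mT ^ j.1).1 =
      (mZ ^ k.1 * mH ^ l.1).1 * (mT ^ i.1).1 * mA.1 * (mT ^ j.1).1 := rfl
  rw [e3, e1, e2, e4] at e'
  have h0 := congrFun (congrFun e' 1) 0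
  simp [mA] at h0
  exact hs h0

lemma m_surj0 (p q s : ZMod 7) (h : p * s = 1) : ∃ (k : Fin 2) (l : Fin 3) (i : Fin 7),
      (mZ ^ k.1 * mH ^ l.1 * mT ^ i.1).1 = !![p, q; 0, s] := by
  have : Fact (Nat.Prime 7) := ⟨by norm_num⟩
  have hs : s ≠ 0 := by rintro rfl; simp at h
  obtain ⟨k, l, e1⟩ := m_diag s hs
  obtain ⟨i, e2⟩ := m_unip (q * s)
  refine ⟨k, l, i, ?_⟩
  have e3 : (mZ ^ k.1 * mH ^ l.1 * mT ^ i.1).1 =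
      (mZ ^ k.1 * mH ^ l.1).1 * (mT ^ i.1).1 := rfl
  have hp : s⁻¹ = p := (eq_inv_of_mul_eq_one_left h).symm
  have hq : p * (q * s) = q := by linear_combination q * h
  rw [e3, e1, e2, hp]
  simp [hq]

lemma m_surj1 (p r s : ZMod 7) (hr : r ≠ 0) : ∃ (k : Fin 2) (l : Fin 3) (i j : Fin 7),
      (mZ ^ k.1 * mH ^ l.1 * mT ^ i.1 * mA * mT ^ j.1).1 = !![p, (p * s - 1) * r⁻¹; r, s] := by
  have : Fact (Nat.Prime 7) := ⟨by norm_num⟩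
  obtain ⟨k, l, e1⟩ := m_diag r hr
  obtain ⟨i, e2⟩ := m_unip (p * r)
  obtain ⟨j, e4⟩ := m_unip (s * r⁻¹)
  refine ⟨k, l, i, j, ?_⟩
  have e3 : (mZ ^ k.1 * mH ^ l.1 * mT ^ i.1 * mA * mT ^ j.1).1 =
      (mZ ^ k.1 * mH ^ l.1).1 * (mT ^ i.1).1 * mA.1 * (mT ^ j.1).1 := rfl
  rw [e3, e1, e2, e4]
  have ea : mA.1 = !![0, -1; 1, 0] := rfl
  rw [ea]
  ext u v
  fin_cases u <;> fin_cases v <;> simp <;> field_simp <;> ring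

end Aux

namespace Stmt11

theorem presentation_sl2_7 : Nonempty (PresentedGroup rels ≃* SL2_7) := by
  have hrel : ∀ r ∈ rels, FreeGroup.lift ![Aux.mA, Aux.mB] r = 1 := by
    intro r hr
    rcases hr with rfl | rfl
    · simpa using Aux.m_rel1
    · simpa using Aux.m_rel2
  let φ : PresentedGroup rels →* SL2_7 := PresentedGroup.toGroup hrel
  let x : PresentedGroup rels := PresentedGroup.of 0
  let y : PresentedGroup rels := PresentedGroup.of 1
  have φx : φ x = Aux.mA := by simp [φ, x]
  have φy : φ y = Aux.mB := by simp [φ, y]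
  have h1 : (x * y) ^ 3 * x ^ (-2 : ℤ) = 1 :=
    PresentedGroup.one_of_mem (rels := rels) (Or.inl rfl)
  have h2 : (x * y ^ 4 * x * y ^ 4) ^ 2 * y ^ 7 * x ^ 4 = 1 :=
    PresentedGroup.one_of_mem (rels := rels) (Or.inr rfl)
  have B := Aux.bruhat h1 h2
  have φz : φ (x ^ 2) = Aux.mZ := by rw [map_pow, φx, Aux.mZ_eq]
  have φt : φ (x ^ 2 * y) = Aux.mT := by rw [map_mul, map_pow, φx, φy, Aux.mT_eq]
  have φh : φ (Aux.hh x y) = Aux.mH := by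
    rw [← Aux.mH_eq]; simp only [Aux.hh, map_mul, map_pow, φx, φy]
  have gen : ∀ g : PresentedGroup rels, g ∈ Subgroup.closure {x, y} := by
    intro g
    have : Set.range (PresentedGroup.of (rels := rels)) ⊆ {x, y} := by
      rintro _ ⟨i, rfl⟩
      fin_cases i
      · exact Or.inl rfl
      · exact Or.inr rfl
    apply Subgroup.closure_mono this
    rw [PresentedGroup.closure_range_of]; trivial
  refine ⟨MulEquiv.ofBijective φ ⟨?_, ?_⟩⟩
  · rw [injective_iff_map_eq_one]
    intro g hg
    rcases B.nf_fin (B.nf_all rfl g (gen g)) with ⟨k, l, i, rfl⟩ | ⟨k, l, i, j, rfl⟩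
    · rw [map_mul, map_mul, map_pow φ _ k.1, map_pow φ _ l.1, map_pow φ _ i.1, φz, φt, φh] at hg
      obtain ⟨rfl, rfl, rfl⟩ := Aux.m_inj1 k l i hg
      simp
    · exfalso
      rw [map_mul, map_mul, map_mul, map_mul, map_pow φ _ k.1, map_pow φ _ l.1, map_pow φ _ i.1,
        map_pow φ _ j.1, φz, φt, φh, φx] at hg
      exact Aux.m_inj2 k l i j hg
  · intro M
    have hM := M.2
    rw [Matrix.det_fin_two] at hM
    by_cases hr : M.1 1 0 = 0
    · obtain ⟨k, l, i, e⟩ := Aux.m_surj0 (M.1 0 0) (M.1 0 1) (M.1 1 1) (by simpa [hr] using hM)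
      refine ⟨(x ^ 2) ^ k.1 * Aux.hh x y ^ l.1 * (x ^ 2 * y) ^ i.1, ?_⟩
      rw [map_mul, map_mul, map_pow φ _ k.1, map_pow φ _ l.1, map_pow φ _ i.1, φz, φt, φh]
      apply Subtype.ext
      rw [e, ← hr]
      exact (Matrix.eta_fin_two M.1).symm
    · obtain ⟨k, l, i, j, e⟩ := Aux.m_surj1 (M.1 0 0) (M.1 1 0) (M.1 1 1) hr
      refine ⟨(x ^ 2) ^ k.1 * Aux.hh x y ^ l.1 * (x ^ 2 * y) ^ i.1 * x * (x ^ 2 * y) ^ j.1, ?_⟩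
      rw [map_mul, map_mul, map_mul, map_mul, map_pow φ _ k.1, map_pow φ _ l.1, map_pow φ _ i.1,
        map_pow φ _ j.1, φz, φt, φh, φx]
      apply Subtype.ext
      have : Fact (Nat.Prime 7) := ⟨by norm_num⟩
      have hq : (M.1 0 0 * M.1 1 1 - 1) * (M.1 1 0)⁻¹ = M.1 0 1 := by
        rw [mul_inv_eq_iff_eq_mul₀ hr]; linear_combination hM
      rw [e, hq]
      exact (Matrix.eta_fin_two M.1).symm

end Stmt11
end

section
/- If G is a group generated by elements a and b satisfying (a*b)^3 = a^2 and (a*b^4*a*b^4)^2 * b^7 * a^4 = 1, and G contains an element of order 14, then G is isomorphic to SL(2, 7). -/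
/-- `a ^ 2` is central. -/
lemma sq_central {G : Type*} [Group G] (a b : G)
    (hgen : Subgroup.closure ({a, b} : Set G) = ⊤)
    (h1 : (a * b) ^ 3 = a ^ 2) : ∀ x, Commute (a ^ 2) x := by
  have ha : Commute (a ^ 2) a := (Commute.refl a).pow_left 2
  have hab : Commute (a ^ 2) (a * b) := h1 ▸ (Commute.refl (a * b)).pow_left 3
  have hb : Commute (a ^ 2) b := by
    have := ha.inv_right.mul_right hab
    simpa using this
  intro x
  have hx : x ∈ Subgroup.closure ({a, b} : Set G) := hgen ▸ Subgroup.mem_top x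
  induction hx using Subgroup.closure_induction with
  | mem x hx =>
    rcases hx with rfl | rfl
    · exact ha
    · exact hb
  | one => exact Commute.one_right _
  | mul x y _ _ hx hy => exact hx.mul_right hy
  | inv x _ hx => exact hx.inv_right

lemma quot_trivial {Q : Type*} [Group Q] (A B : Q) (e4 : B ^ 4 = 1) (e1 : (A * B) ^ 3 = A ^ 2)
    (e2 : (A * B ^ 4 * A * B ^ 4) ^ 2 * B ^ 7 * A ^ 4 = 1) : A = 1 ∧ B = 1 := by
  have f1 : B = A ^ 8 := by
    have h7 : B ^ 7 = B⁻¹ := by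
      rw [eq_inv_iff_mul_eq_one, ← pow_succ]
      rw [show B ^ (7 + 1) = (B ^ 4) ^ 2 by rw [← pow_mul], e4, one_pow]
    rw [e4, h7, mul_one, mul_one] at e2
    have e5 : (A * A) ^ 2 * B⁻¹ = (A ^ 4)⁻¹ := eq_inv_of_mul_eq_one_left e2
    have e6 : B = A ^ 4 * (A * A) ^ 2 := by
      have : B = ((A * A) ^ 2 * B⁻¹)⁻¹ * (A * A) ^ 2 := by group
      rw [this, e5, inv_inv]
    rw [e6, ← pow_two, ← pow_mul, ← pow_add]
  subst f1
  have g1 : A ^ 25 = 1 := by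
    have : A ^ 25 = (A * A ^ 8) ^ 3 * (A ^ 2)⁻¹ := by group
    rw [this, e1]; group
  have g2 : A ^ 32 = 1 := by rw [← e4]; group
  have g3 : A = 1 := by
    have : A = (A ^ 25) ^ 9 * (A ^ 32)⁻¹ ^ 7 := by group
    rw [this, g1, g2]; simp
  simp [g3]

/-- If `b ^ 4` centralizes a normal subgroup, so does everything. -/
lemma normal_eq_top {G : Type*} [Group G] (a b : G)
    (hgen : Subgroup.closure ({a, b} : Set G) = ⊤)
    (h1 : (a * b) ^ 3 = a ^ 2)
    (h2 : (a * b ^ 4 * a * b ^ 4) ^ 2 * b ^ 7 * a ^ 4 = 1)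
    (N : Subgroup G) [N.Normal] (hN : b ^ 4 ∈ N) : N = ⊤ := by
  have e4 : (b : G ⧸ N) ^ 4 = 1 := by
    rw [← QuotientGroup.mk_pow]; exact (QuotientGroup.eq_one_iff _).2 hN
  have e1 : ((a : G ⧸ N) * b) ^ 3 = (a : G ⧸ N) ^ 2 := by exact_mod_cast congrArg (QuotientGroup.mk (s := N)) h1
  have e2 : ((a : G ⧸ N) * b ^ 4 * a * b ^ 4) ^ 2 * (b : G ⧸ N) ^ 7 * (a : G ⧸ N) ^ 4 = 1 := by
    exact_mod_cast congrArg (QuotientGroup.mk (s := N)) h2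
  obtain ⟨hA, hB⟩ := quot_trivial _ _ e4 e1 e2
  rw [← top_le_iff, ← hgen, Subgroup.closure_le]
  rintro x (rfl | rfl)
  · exact (QuotientGroup.eq_one_iff _).1 hA
  · exact (QuotientGroup.eq_one_iff _).1 hB

lemma gen_induction {G : Type*} [Group G] (a b : G)
    (hgen : Subgroup.closure ({a, b} : Set G) = ⊤) (P : G → Prop) (one : P 1)
    (ha : ∀ g, P g → P (a * g)) (hb : ∀ g, P g → P (b * g))
    (ha' : ∀ g, P g → P (a⁻¹ * g)) (hb' : ∀ g, P g → P (b⁻¹ * g)) (g : G) : P g := by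
  have hx : g ∈ Subgroup.closure ({a, b} : Set G) := hgen ▸ Subgroup.mem_top g
  induction hx using Subgroup.closure_induction_left with
  | one => exact one
  | mul_left x hx y _ ih =>
    rcases hx with rfl | rfl
    · exact ha _ ih
    · exact hb _ ih
  | inv_mul_cancel x hx y _ ih =>
    rcases hx with rfl | rfl
    · exact ha' _ ih
    · exact hb' _ ih

lemma pow7_central {G : Type*} [Group G] (a b : G)
    (hgen : Subgroup.closure ({a, b} : Set G) = ⊤)
    (h1 : (a * b) ^ 3 = a ^ 2)
    (h2 : (a * b ^ 4 * a * b ^ 4) ^ 2 * b ^ 7 * a ^ 4 = 1) : ∀ x, Commute (b ^ 7) x := by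
  have hc := sq_central a b hgen h1
  have hc4 : ∀ x, Commute (a ^ 4) x := fun x => by
    have := (hc x).pow_left 2
    rwa [← pow_mul] at this
  set H : Subgroup G := Subgroup.centralizer {b ^ 7} with hH
  have memH : ∀ x, x ∈ H ↔ Commute (b ^ 7) x := fun x => by
    rw [hH, Subgroup.mem_centralizer_singleton_iff]
    exact ⟨fun h => h.symm, fun h => h.symm⟩
  have Hb : b ∈ H := (memH _).2 ((Commute.refl b).pow_left 7)
  have Hc : a ^ 2 ∈ H := (memH _).2 (hc _).symm
  have Hw : a * b ^ 4 * a ∈ H := by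
    have e : b ^ 7 = ((a * b ^ 4 * a * b ^ 4) ^ 2)⁻¹ * (a ^ 4)⁻¹ := by
      rw [eq_mul_inv_iff_mul_eq, eq_inv_iff_mul_eq_one, (Commute.eq ?_ : b ^ 7 * a ^ 4 * _ = _),
        ← mul_assoc]
      · exact h2
      · have := eq_inv_of_mul_eq_one_right ((mul_assoc _ _ _).symm.trans h2)
        rw [this]
        exact (Commute.refl _).inv_left
    have : Commute (b ^ 7) (a * b ^ 4 * a * b ^ 4) := by
      rw [e]
      exact (((Commute.refl _).pow_left 2).inv_left).mul_left ((hc4 _).inv_left)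
    have := H.mul_mem ((memH _).2 this) (H.inv_mem (H.pow_mem Hb 4))
    simpa using this
  have aba : a * b * a = b⁻¹ * a * b⁻¹ := by
    have : a * b * a = b⁻¹ * a⁻¹ * ((a * b) ^ 3) * b⁻¹ := by
      simp [pow_succ, mul_assoc]
    rw [this, h1]; group
  have bab : b * a * b = a * b⁻¹ * a⁻¹ := by
    have : b * a * b = a⁻¹ * ((a * b) ^ 3) * b⁻¹ * a⁻¹ := by
      simp [pow_succ, mul_assoc]
    rw [this, h1]; group
  have Hv : a⁻¹ * b ^ 4 * a ∈ H := by
    have : a⁻¹ * b ^ 4 * a = (a ^ 2)⁻¹ * (a * b ^ 4 * a) := by group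
    rw [this]
    exact H.mul_mem (H.inv_mem Hc) Hw
  have ubu : (a * b ^ 2 * a) * b * (a * b ^ 2 * a) = a ^ 2 * b⁻¹ := by
    have : (a * b ^ 2 * a) * b * (a * b ^ 2 * a) = a * b * (b * a * b) * a * b * b * a := by
      simp [pow_succ, mul_assoc]
    rw [this, bab]
    have : a * b * (a * b⁻¹ * a⁻¹) * a * b * b * a = a * (b * a * b) * a := by group
    rw [this, bab]; simp [pow_succ, mul_assoc]
  have uu : (a * b ^ 2 * a) * (a * b ^ 2 * a) = a ^ 2 * (a * b ^ 4 * a) := by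
    have : (a * b ^ 2 * a) * (a * b ^ 2 * a) = (a * b ^ 2) * a ^ 2 * (b ^ 2 * a) := by
      simp [pow_succ, mul_assoc]
    rw [this, ← (hc _).eq]; group
  have Hu : (a * b ^ 2 * a)⁻¹ * b * (a * b ^ 2 * a) ∈ H := by
    have : (a * b ^ 2 * a)⁻¹ * b * (a * b ^ 2 * a) = ((a * b ^ 2 * a) * (a * b ^ 2 * a))⁻¹ *
      ((a * b ^ 2 * a) * b * (a * b ^ 2 * a)) := by group
    rw [this, ubu, uu]
    exact H.mul_mem (H.inv_mem (H.mul_mem Hc Hw)) (H.mul_mem Hc (H.inv_mem Hb))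
  -- left multiples by `a ^ 2` are harmless
  have cH : ∀ x y : G, x⁻¹ * (a ^ 2 * y) = a ^ 2 * (x⁻¹ * y) := fun x y => by
    rw [← mul_assoc, ← (hc _).eq, mul_assoc]
  have shift : ∀ (i k : ℤ) (g : G), (b ^ i * a)⁻¹ * g ∈ H → (b ^ (i + 4 * k) * a)⁻¹ * g ∈ H := by
    intro i k g hg
    have : (b ^ (i + 4 * k) * a)⁻¹ * g = (a⁻¹ * b ^ 4 * a) ^ (-k) * ((b ^ i * a)⁻¹ * g) := by
      have e : a⁻¹ * b ^ 4 * a = a⁻¹ * b ^ 4 * (a⁻¹)⁻¹ := by group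
      rw [e, conj_zpow]
      have e : (b ^ 4) ^ (-k) = b ^ (-(4 * k)) := by
        rw [← zpow_natCast, ← zpow_mul]; congr 1; push_cast; ring
      rw [e, zpow_add]; group
    rw [this]
    exact H.mul_mem (H.zpow_mem Hv _) hg
  have mula : ∀ g : G, (g ∈ H ∨ (∃ i : ℤ, (b ^ i * a)⁻¹ * g ∈ H) ∨ (a * b ^ 2 * a)⁻¹ * g ∈ H) →
      (a * g ∈ H ∨ (∃ i : ℤ, (b ^ i * a)⁻¹ * (a * g) ∈ H) ∨
        (a * b ^ 2 * a)⁻¹ * (a * g) ∈ H) := by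
    rintro g (hg | ⟨i, hg⟩ | hg)
    · exact Or.inr (Or.inl ⟨0, by simpa using hg⟩)
    · have hg2 := shift i (-(i / 4)) g hg
      have hi : i + 4 * (-(i / 4)) = 0 ∨ i + 4 * (-(i / 4)) = 1 ∨ i + 4 * (-(i / 4)) = 2 ∨
        i + 4 * (-(i / 4)) = 3 := by omega
      rcases hi with e | e | e | e <;> rw [e] at hg2
      · left
        have : a * g = a ^ 2 * ((b ^ (0 : ℤ) * a)⁻¹ * g) := by group
        rw [this]; exact H.mul_mem Hc hg2
      · right; left
        refine ⟨-1, ?_⟩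
        have : (b ^ (-1 : ℤ) * a)⁻¹ * (a * g) =
            a⁻¹ * b * (a * b * a) * ((b ^ (1 : ℤ) * a)⁻¹ * g) := by group
        rw [this, aba]
        have : a⁻¹ * b * (b⁻¹ * a * b⁻¹) = b⁻¹ := by group
        rw [this]; exact H.mul_mem (H.inv_mem Hb) hg2
      · right; right
        have : (a * b ^ 2 * a)⁻¹ * (a * g) = (b ^ (2 : ℤ) * a)⁻¹ * g := by group
        rw [this]; exact hg2
      · right; left
        refine ⟨1, ?_⟩
        have hg3 := shift 3 (-1) g hg2
        have : (b ^ (1 : ℤ) * a)⁻¹ * (a * g) =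
            a⁻¹ * b⁻¹ * (a * b⁻¹ * a⁻¹) * a ^ 2 * ((b ^ (3 + 4 * (-1) : ℤ) * a)⁻¹ * g) := by group
        rw [this, ← bab]
        have : a⁻¹ * b⁻¹ * (b * a * b) = b := by group
        rw [this]; exact H.mul_mem (H.mul_mem Hb Hc) hg3
    · right; left
      refine ⟨2, ?_⟩
      have : (b ^ (2 : ℤ) * a)⁻¹ * (a * g) =
        (b ^ (2 : ℤ) * a)⁻¹ * (a ^ 2 * (b ^ 2 * a * ((a * b ^ 2 * a)⁻¹ * g))) := by group
      rw [this, cH]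
      refine H.mul_mem Hc ?_
      have : (b ^ (2 : ℤ) * a)⁻¹ * (b ^ 2 * a * ((a * b ^ 2 * a)⁻¹ * g)) =
        (a * b ^ 2 * a)⁻¹ * g := by group
      rw [this]; exact hg
  have mulb : ∀ (n : ℤ) (g : G),
      (g ∈ H ∨ (∃ i : ℤ, (b ^ i * a)⁻¹ * g ∈ H) ∨ (a * b ^ 2 * a)⁻¹ * g ∈ H) →
      (b ^ n * g ∈ H ∨ (∃ i : ℤ, (b ^ i * a)⁻¹ * (b ^ n * g) ∈ H) ∨
        (a * b ^ 2 * a)⁻¹ * (b ^ n * g) ∈ H) := by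
    rintro n g (hg | ⟨i, hg⟩ | hg)
    · exact Or.inl (H.mul_mem (H.zpow_mem Hb n) hg)
    · refine Or.inr (Or.inl ⟨n + i, ?_⟩)
      have : (b ^ (n + i) * a)⁻¹ * (b ^ n * g) = (b ^ i * a)⁻¹ * g := by
        rw [zpow_add]; group
      rw [this]; exact hg
    · refine Or.inr (Or.inr ?_)
      have : (a * b ^ 2 * a)⁻¹ * (b ^ n * g) =
          ((a * b ^ 2 * a)⁻¹ * b * ((a * b ^ 2 * a)⁻¹)⁻¹) ^ n * ((a * b ^ 2 * a)⁻¹ * g) := by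
        rw [conj_zpow]; group
      rw [this]
      rw [inv_inv]
      exact H.mul_mem (H.zpow_mem Hu n) hg
  have cov : ∀ g : G, (g ∈ H ∨ (∃ i : ℤ, (b ^ i * a)⁻¹ * g ∈ H) ∨ (a * b ^ 2 * a)⁻¹ * g ∈ H) := by
    refine gen_induction a b hgen _ (Or.inl H.one_mem) mula ?_ ?_ ?_
    · intro g hg; simpa only [zpow_one] using mulb 1 g hg
    · intro g hg
      have := mula _ hg
      have e : a * g = a ^ 2 * (a⁻¹ * g) := by group
      rw [e] at this
      simpa only [cH, H.mul_mem_cancel_left Hc] using this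
    · intro g hg; simpa only [zpow_neg_one] using mulb (-1) g hg
  have all : ∀ g : G, g⁻¹ * b ^ 4 * g ∈ H := by
    intro g
    have conjH : ∀ r : G, r⁻¹ * b ^ 4 * r ∈ H → r⁻¹ * g ∈ H → g⁻¹ * b ^ 4 * g ∈ H := by
      intro r hr ht
      have : g⁻¹ * b ^ 4 * g = (r⁻¹ * g)⁻¹ * (r⁻¹ * b ^ 4 * r) * (r⁻¹ * g) := by group
      rw [this]
      exact H.mul_mem (H.mul_mem (H.inv_mem ht) hr) ht
    rcases cov g with h | ⟨i, h⟩ | h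
    · exact conjH 1 (by simpa using H.pow_mem Hb 4) (by simpa using h)
    · refine conjH _ ?_ h
      have : (b ^ i * a)⁻¹ * b ^ 4 * (b ^ i * a) = a⁻¹ * b ^ 4 * a := by group
      rw [this]; exact Hv
    · refine conjH _ ?_ h
      have : (a * b ^ 2 * a)⁻¹ * b ^ 4 * (a * b ^ 2 * a) =
        ((a * b ^ 2 * a)⁻¹ * b * (a * b ^ 2 * a)) ^ 4 := by simp [pow_succ, mul_assoc]
      rw [this]; exact H.pow_mem Hu 4
  have hN : b ^ 4 ∈ Subgroup.centralizer (Subgroup.normalClosure {b ^ 7} : Set G) := by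
    rw [Subgroup.normalClosure, Subgroup.centralizer_closure, Subgroup.mem_centralizer_iff]
    intro x hx
    rw [Group.mem_conjugatesOfSet_iff] at hx
    obtain ⟨y, rfl, hy⟩ := hx
    obtain ⟨g, rfl⟩ := isConj_iff.1 hy
    have := ((memH _).1 (all g)).eq
    calc g * b ^ 7 * g⁻¹ * b ^ 4 = g * (b ^ 7 * (g⁻¹ * b ^ 4 * g)) * g⁻¹ := by group
      _ = _ := by rw [this]; group
  have htop := normal_eq_top a b hgen h1 h2 _ hN
  intro x
  have hx : x ∈ Subgroup.centralizer (Subgroup.normalClosure {b ^ 7} : Set G) :=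
    htop ▸ Subgroup.mem_top x
  exact (Subgroup.mem_centralizer_iff.1 hx _ (Subgroup.subset_normalClosure rfl))

set_option linter.unusedSimpArgs false in
lemma core {G : Type*} [Group G] (a b c z : G) (hc : ∀ x, Commute c x) (hz : ∀ x, Commute z x)
    (ha : a * a = c) (hb : b ^ 7 = z) (h1 : (a * b) ^ 3 = c)
    (h2 : (a * b ^ 4 * a * b ^ 4) ^ 2 * z * c ^ 2 = 1) :
    c ^ 2 = 1 ∧ z = c ∧ ∃ h : G, h ^ 3 = c ∧ a * h = h⁻¹ * a ∧ b * h = c * (h * b ^ 2) ∧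
      a * (b ^ (4 : ℤ) * a) = b ^ (-2 : ℤ) * (h * (a * b ^ (-2 : ℤ))) ∧
      a * (b ^ (-2 : ℤ) * a) = c * (b ^ (4 : ℤ) * (a * (b ^ (2 : ℤ) * h))) := by
  have aba : a * b * a = b⁻¹ * a * b⁻¹ := by
    have : a * b * a = b⁻¹ * a⁻¹ * ((a * b) ^ 3) * b⁻¹ := by simp [pow_succ, mul_assoc]
    rw [this, h1, ← ha]; group
  -- pushing central powers to the left
  have pc : ∀ (x : G) (n : ℤ) (y : G), x * (c ^ n * y) = c ^ n * (x * y) := fun x n y => by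
    rw [← mul_assoc, ← ((hc x).zpow_left n).eq, mul_assoc]
  have pz : ∀ (x : G) (n : ℤ) (y : G), x * (z ^ n * y) = z ^ n * (x * y) := fun x n y => by
    rw [← mul_assoc, ← ((hz x).zpow_left n).eq, mul_assoc]
  have ac := pc a
  have az := pz a
  have bc : ∀ (m n : ℤ) (y : G), b ^ m * (c ^ n * y) = c ^ n * (b ^ m * y) := fun m => pc _
  have bz : ∀ (m n : ℤ) (y : G), b ^ m * (z ^ n * y) = z ^ n * (b ^ m * y) := fun m => pz _
  have zc : ∀ (m n : ℤ) (y : G), z ^ m * (c ^ n * y) = c ^ n * (z ^ m * y) := fun m => pc _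
  have mrg : ∀ (x : G) (m n : ℤ) (y : G), x ^ m * (x ^ n * y) = x ^ (m + n) * y := fun x m n y => by
    rw [← mul_assoc, zpow_add]
  have cc := mrg c
  have zz := mrg z
  have bb := mrg b
  have aa : ∀ y, a * (a * y) = c ^ (1 : ℤ) * y := fun y => by rw [← mul_assoc, ha, zpow_one]
  -- reduction of powers of `b`
  have b7 : ∀ (m n : ℤ) (y : G), b ^ (m + 7 * n) * y = z ^ n * (b ^ m * y) := fun m n y => by
    rw [← bz, zpow_add, zpow_mul, ← hb]; norm_cast; rw [mul_assoc]
  have A1 : ∀ y, a * (b ^ (1 : ℤ) * (a * y)) = b ^ (-1 : ℤ) * (a * (b ^ (-1 : ℤ) * y)) := fun y => by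
    have := congrArg (· * y) aba
    simpa [mul_assoc] using this
  have A1m : ∀ y, a * (b ^ (-1 : ℤ) * (a * y)) = c ^ (1 : ℤ) * (b ^ (1 : ℤ) * (a * (b ^ (1 : ℤ) * y))) := by
    intro y
    have e : b * a * b = a * b⁻¹ * a⁻¹ := by
      have : b * a * b = a⁻¹ * ((a * b) ^ 3) * b⁻¹ * a⁻¹ := by simp [pow_succ, mul_assoc]
      rw [this, h1, ← ha]; group
    have e2 : a * (b ^ (-1 : ℤ) * (a * y)) = (a * b⁻¹ * a⁻¹) * (a * (a * y)) := by
      simp [mul_assoc]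
    rw [e2, ← e, aa, pc]
    simp [mul_assoc]
  have K : ∀ y, b ^ (4 : ℤ) * (a * (b ^ (4 : ℤ) * (a * (b ^ (4 : ℤ) * y)))) =
      c ^ (-4 : ℤ) * (z ^ (-1 : ℤ) * (a * (b ^ (-4 : ℤ) * (a * y)))) := by
    intro y
    have e : ∀ y, a * (b ^ (4 : ℤ) * (a * (b ^ (4 : ℤ) * (a * (b ^ (4 : ℤ) * (a * (b ^ (4 : ℤ) * (c ^ (2 : ℤ) * (z ^ (1 : ℤ) * y)))))))))
      = y := by
      intro y
      calc _ = (a * b ^ 4 * a * b ^ 4) ^ 2 * z * c ^ 2 * y := by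
            rw [mul_assoc _ z, (hz _).eq, sq (a * b ^ 4 * a * b ^ 4)]
            simp only [mul_assoc, zpow_one]
            norm_cast
        _ = y := by rw [h2, one_mul]
    have := congrArg (a * ·) (e (c ^ (-4 : ℤ) * (z ^ (-1 : ℤ) * (b ^ (-4 : ℤ) * (a * y)))))
    simpa only [aa, ac, az, bc, bz, zc, cc, zz, bb, zpow_zero, one_mul, Int.reduceAdd, Int.reduceNeg] using this
  -- the element of the torus
  obtain ⟨h, hdef⟩ : ∃ h, h = b ^ 2 * a * b ^ 4 * a * b ^ 2 * a⁻¹ := ⟨_, rfl⟩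
  have hh := mrg h
  have hhc : ∀ (m n : ℤ) (y : G), h ^ m * (c ^ n * y) = c ^ n * (h ^ m * y) := fun m => pc _
  have hhz : ∀ (m n : ℤ) (y : G), h ^ m * (z ^ n * y) = z ^ n * (h ^ m * y) := fun m => pz _
  have D : ∀ y, a * (b ^ (4 : ℤ) * (a * y)) =
      b ^ (-2 : ℤ) * (h ^ (1 : ℤ) * (a * (b ^ (-2 : ℤ) * y))) := fun y => by
    rw [hdef]; group
  have S2 : ∀ y, a * (h ^ (1 : ℤ) * y) =
      c ^ (-3 : ℤ) * (z ^ (-1 : ℤ) * (h ^ (-1 : ℤ) * (a * y))) := by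
    intro y
    have e1 : ∀ y, h ^ (1 : ℤ) * y = c ^ (-1 : ℤ) * (b ^ (2 : ℤ) * (a * (b ^ (4 : ℤ) * (a *
        (b ^ (2 : ℤ) * (a * y)))))) := fun y => by
      have := congrArg (fun t => c ^ (-1 : ℤ) * (b ^ (2 : ℤ) * t)) (D (b ^ (2 : ℤ) * (a * y)))
      simp only [aa, ac, az, bc, bz, zc, cc, zz, bb, zpow_zero, one_mul, hh, hhc, hhz, Int.reduceAdd, Int.reduceNeg] at this
      exact this.symm
    have e2 : ∀ y, h ^ (-1 : ℤ) * y = c ^ (-2 : ℤ) * (a * (b ^ (-2 : ℤ) * (a * (b ^ (-4 : ℤ) *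
        (a * (b ^ (-2 : ℤ) * y)))))) := fun y => by
      have := e1 (c ^ (-2 : ℤ) * (a * (b ^ (-2 : ℤ) * (a * (b ^ (-4 : ℤ) *
        (a * (b ^ (-2 : ℤ) * y)))))))
      have := congrArg (fun t => h ^ (-1 : ℤ) * t) this
      simp only [aa, ac, az, bc, bz, zc, cc, zz, bb, zpow_zero, one_mul, hh, hhc, hhz, Int.reduceAdd, Int.reduceNeg] at this
      exact this.symm
    rw [e1, e2]
    have := congrArg (fun t => c ^ (-1 : ℤ) * (a * (b ^ (-2 : ℤ) * t))) (K (b ^ (-2 : ℤ) * (a * y)))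
    simpa only [aa, ac, az, bc, bz, zc, cc, zz, bb, zpow_zero, one_mul, Int.reduceAdd, Int.reduceNeg] using this
  have conjP : ∀ (x t s : G) (i j : ℤ), (∀ y, x * (t * y) = c ^ i * (z ^ j * (t * (s * y)))) →
      ∀ (n : ℤ) (y : G), x ^ n * (t * y) = c ^ (i * n) * (z ^ (j * n) * (t * (s ^ n * y))) := by
    intro x t s i j e n y
    have e2 : x = (c ^ i * z ^ j) * (t * s * t⁻¹) := by
      have := e t⁻¹
      rw [mul_inv_cancel, mul_one] at this
      rw [this]; simp only [mul_assoc]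
    have hcom : ∀ w, Commute (c ^ i * z ^ j) w := fun w =>
      ((hc w).zpow_left i).mul_left ((hz w).zpow_left j)
    rw [e2, (hcom _).mul_zpow, conj_zpow, ((hc _).zpow_left i).mul_zpow, ← zpow_mul, ← zpow_mul]
    simp only [mul_assoc, inv_mul_cancel_left]
  have S2n : ∀ (n : ℤ) y, a * (h ^ n * y) =
      c ^ (-3 * n) * (z ^ (-1 * n) * (h ^ (-1 * n) * (a * y))) := by
    intro n y
    have e : ∀ y, h ^ (-1 : ℤ) * (a * y) = c ^ (3 : ℤ) * (z ^ (1 : ℤ) * (a * (h ^ (1 : ℤ) * y))) := by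
      intro y
      rw [S2]
      simp only [aa, ac, az, bc, bz, zc, cc, zz, bb, zpow_zero, one_mul, hh, hhc, hhz, Int.reduceAdd, Int.reduceNeg, Int.reduceMul]
    have := conjP _ _ _ _ _ e n y
    rw [← zpow_mul, ← zpow_mul, one_mul] at this
    rw [this]
    simp only [aa, ac, az, bc, bz, zc, cc, zz, bb, zpow_zero, one_mul, hh, hhc, hhz]
    rw [show -1 * n + n = 0 by ring, show -3 * n + 3 * n = 0 by ring]
    simp only [aa, ac, az, bc, bz, zc, cc, zz, bb, zpow_zero, one_mul, hh, hhc, hhz]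
  have T : ∀ y, b ^ (-4 : ℤ) * (h ^ (1 : ℤ) * y) =
      c ^ (3 : ℤ) * (z ^ (2 : ℤ) * (h ^ (1 : ℤ) * (b ^ (-1 : ℤ) * y))) := by
    intro y
    have e1 : ∀ y, a * (b ^ (4 : ℤ) * (a * (a * (b ^ (4 : ℤ) * (a * y))))) =
        c ^ (1 : ℤ) * (z ^ (1 : ℤ) * (b ^ (-1 : ℤ) * (a * (b ^ (-1 : ℤ) * y)))) := by
      intro y
      have := b7 1 1 (a * y)
      simp only [aa, ac, az, bc, bz, zc, cc, zz, bb, zpow_zero, one_mul, hh, hhc, hhz, S2n, Int.reduceAdd, Int.reduceNeg, Int.reduceMul] at this ⊢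
      rw [this, az, A1]
    have := congrArg (fun t => c ^ (1 : ℤ) * (z ^ (1 : ℤ) * (h ^ (1 : ℤ) * (a * (b ^ (2 : ℤ) * t)))))
      (e1 (b ^ (2 : ℤ) * (a * y)))
    simp only [D] at this
    simp only [aa, ac, az, bc, bz, zc, cc, zz, bb, zpow_zero, one_mul, hh, hhc, hhz, S2n, A1, Int.reduceAdd, Int.reduceNeg, Int.reduceMul] at this
    exact this
  -- moving `h` to the left across powers of `b`
  have S3 : ∀ y, b ^ (1 : ℤ) * (h ^ (1 : ℤ) * y) =
      c ^ (-6 : ℤ) * (z ^ (-5 : ℤ) * (h ^ (1 : ℤ) * (b ^ (2 : ℤ) * y))) := by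
    intro y
    have e := conjP _ _ _ _ _ T (-2) y
    rw [← zpow_mul, ← zpow_mul] at e
    have := congrArg (fun t => z ^ (-1 : ℤ) * t) e
    have e2 := b7 1 1 (h ^ (1 : ℤ) * y)
    simp only [aa, ac, az, bc, bz, zc, cc, zz, bb, zpow_zero, one_mul, hh, hhc, hhz, S2n, Int.reduceAdd, Int.reduceNeg, Int.reduceMul] at this e2
    rw [e2] at this
    simpa only [aa, ac, az, bc, bz, zc, cc, zz, bb, zpow_zero, one_mul, hh, hhc, hhz, S2n, Int.reduceAdd, Int.reduceNeg, Int.reduceMul] using this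
  have S3p : ∀ (m : ℤ) y, b ^ m * (h ^ (1 : ℤ) * y) =
      c ^ (-6 * m) * (z ^ (-5 * m) * (h ^ (1 : ℤ) * (b ^ (2 * m) * y))) := by
    intro m y
    have := conjP _ _ _ _ _ S3 m y
    rwa [← zpow_mul, ← zpow_mul, one_mul] at this
  have S3q : ∀ (m : ℤ) y, b ^ m * (h ^ (-1 : ℤ) * y) =
      c ^ (24 * m) * (z ^ (19 * m) * (h ^ (-1 : ℤ) * (b ^ (4 * m) * y))) := by
    intro m y
    have e1 : ∀ y, b ^ (1 : ℤ) * (h ^ (-1 : ℤ) * y) =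
      c ^ (24 : ℤ) * (z ^ (19 : ℤ) * (h ^ (-1 : ℤ) * (b ^ (4 : ℤ) * y))) := by
      intro y
      have e := S3p 4 (h ^ (-1 : ℤ) * y)
      have e2 := b7 1 1 (h ^ (-1 : ℤ) * y)
      have e3 := congrArg (fun t => c ^ (24 : ℤ) * (z ^ (19 : ℤ) * (h ^ (-1 : ℤ) * t))) e
      simp only [aa, ac, az, bc, bz, zc, cc, zz, bb, zpow_zero, one_mul, hh, hhc, hhz, Int.reduceAdd, Int.reduceNeg, Int.reduceMul] at e2 e3
      rw [e2] at e3
      simp only [aa, ac, az, bc, bz, zc, cc, zz, bb, zpow_zero, one_mul, hh, hhc, hhz, Int.reduceAdd, Int.reduceNeg, Int.reduceMul] at e3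
      exact e3.symm
    have := conjP _ _ _ _ _ e1 m y
    rwa [← zpow_mul, ← zpow_mul, one_mul] at this
  have rel1 : ∀ y, c ^ (21 : ℤ) * (z ^ (17 : ℤ) * y) = y := by
    intro y
    have e1 := T (b ^ (1 : ℤ) * (h ^ (-1 : ℤ) * y))
    have e2 := b7 (-1) (-1) (b ^ (1 : ℤ) * (h ^ (-1 : ℤ) * y))
    rw [S3p] at e1
    have e3 := congrArg (fun t => c ^ (-3 : ℤ) * (z ^ (-2 : ℤ) * t)) e1
    simp only [aa, ac, az, bc, bz, zc, cc, zz, bb, zpow_zero, one_mul, hh, hhc, hhz, Int.reduceAdd, Int.reduceNeg, Int.reduceMul] at e2 e3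
    rw [e2] at e3
    simp only [aa, ac, az, bc, bz, zc, cc, zz, bb, zpow_zero, one_mul, hh, hhc, hhz, Int.reduceAdd, Int.reduceNeg, Int.reduceMul] at e3
    exact e3
  have P2 : ∀ y, a * (b ^ (-2 : ℤ) * (a * y)) =
      c ^ (4 : ℤ) * (z ^ (1 : ℤ) * (b ^ (4 : ℤ) * (a * (b ^ (2 : ℤ) * (h ^ (1 : ℤ) * y))))) := by
    intro y
    have := congrArg (fun t => c ^ (3 : ℤ) * (z ^ (1 : ℤ) * (a * t)))
      (D (b ^ (2 : ℤ) * (h ^ (1 : ℤ) * y)))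
    simp only [aa, ac, az, bc, bz, zc, cc, zz, bb, zpow_zero, one_mul, hh, hhc, hhz, S2n, Int.reduceAdd, Int.reduceNeg, Int.reduceMul] at this
    exact this.symm
  have Dm : ∀ y, a * (b ^ (-4 : ℤ) * (a * y)) =
      c ^ (4 : ℤ) * (z ^ (1 : ℤ) * (b ^ (2 : ℤ) * (h ^ (1 : ℤ) * (a * (b ^ (2 : ℤ) * y))))) := by
    intro y
    have := congrArg (fun t => c ^ (-1 : ℤ) * (a * (b ^ (-4 : ℤ) * (a * t))))
      (D (b ^ (2 : ℤ) * (a * (h ^ (-1 : ℤ) * (b ^ (2 : ℤ) * y)))))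
    simp only [aa, ac, az, bc, bz, zc, cc, zz, bb, zpow_zero, one_mul, hh, hhc, hhz, S2n, Int.reduceAdd, Int.reduceNeg, Int.reduceMul] at this
    exact this.symm
  have S3r : ∀ (m : ℤ) y, b ^ m * (h ^ (2 : ℤ) * y) =
      c ^ (-6 * m + -6 * (2 * m)) * (z ^ (-5 * m + -5 * (2 * m)) *
        (h ^ (2 : ℤ) * (b ^ (2 * (2 * m)) * y))) := by
    intro m y
    have := S3p m (h ^ (1 : ℤ) * y)
    simp only [S3p, aa, ac, az, bc, bz, zc, cc, zz, bb, zpow_zero, one_mul, hh, hhc, hhz, Int.reduceAdd, Int.reduceNeg, Int.reduceMul] at this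
    exact this
  have r5 : ∀ y, b ^ (5 : ℤ) * y = z ^ (1 : ℤ) * (b ^ (-2 : ℤ) * y) := fun y => by
    have := b7 (-2) (1) y
    simpa only [Int.reduceAdd, Int.reduceNeg, Int.reduceMul] using this
  have r6 : ∀ y, b ^ (6 : ℤ) * y = z ^ (1 : ℤ) * (b ^ (-1 : ℤ) * y) := fun y => by
    have := b7 (-1) (1) y
    simpa only [Int.reduceAdd, Int.reduceNeg, Int.reduceMul] using this
  have r8 : ∀ y, b ^ (8 : ℤ) * y = z ^ (1 : ℤ) * (b ^ (1 : ℤ) * y) := fun y => by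
    have := b7 (1) (1) y
    simpa only [Int.reduceAdd, Int.reduceNeg, Int.reduceMul] using this
  have r16 : ∀ y, b ^ (16 : ℤ) * y = z ^ (2 : ℤ) * (b ^ (2 : ℤ) * y) := fun y => by
    have := b7 (2) (2) y
    simpa only [Int.reduceAdd, Int.reduceNeg, Int.reduceMul] using this
  have r18 : ∀ y, b ^ (18 : ℤ) * y = z ^ (3 : ℤ) * (b ^ (-3 : ℤ) * y) := fun y => by
    have := b7 (-3) (3) y
    simpa only [Int.reduceAdd, Int.reduceNeg, Int.reduceMul] using this
  have r20 : ∀ y, b ^ (20 : ℤ) * y = z ^ (3 : ℤ) * (b ^ (-1 : ℤ) * y) := fun y => by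
    have := b7 (-1) (3) y
    simpa only [Int.reduceAdd, Int.reduceNeg, Int.reduceMul] using this
  have rm8 : ∀ y, b ^ (-8 : ℤ) * y = z ^ (-1 : ℤ) * (b ^ (-1 : ℤ) * y) := fun y => by
    have := b7 (-1) (-1) y
    simpa only [Int.reduceAdd, Int.reduceNeg, Int.reduceMul] using this
  have rm6 : ∀ y, b ^ (-6 : ℤ) * y = z ^ (-1 : ℤ) * (b ^ (1 : ℤ) * y) := fun y => by
    have := b7 (1) (-1) y
    simpa only [Int.reduceAdd, Int.reduceNeg, Int.reduceMul] using this
  have rm16 : ∀ y, b ^ (-16 : ℤ) * y = z ^ (-2 : ℤ) * (b ^ (-2 : ℤ) * y) := fun y => by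
    have := b7 (-2) (-2) y
    simpa only [Int.reduceAdd, Int.reduceNeg, Int.reduceMul] using this
  have r24 : ∀ y, b ^ (24 : ℤ) * y = z ^ (3 : ℤ) * (b ^ (3 : ℤ) * y) := fun y => by
    have := b7 (3) (3) y
    simpa only [Int.reduceAdd, Int.reduceNeg, Int.reduceMul] using this
  have rm5 : ∀ y, b ^ (-5 : ℤ) * y = z ^ (-1 : ℤ) * (b ^ (2 : ℤ) * y) := fun y => by
    have := b7 (2) (-1) y
    simpa only [Int.reduceAdd, Int.reduceNeg, Int.reduceMul] using this
  have rm7 : ∀ y, b ^ (-7 : ℤ) * y = z ^ (-1 : ℤ) * (b ^ (0 : ℤ) * y) := fun y => by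
    have := b7 (0) (-1) y
    simpa only [Int.reduceAdd, Int.reduceNeg, Int.reduceMul] using this
  have r7 : ∀ y, b ^ (7 : ℤ) * y = z ^ (1 : ℤ) * (b ^ (0 : ℤ) * y) := fun y => by
    have := b7 (0) (1) y
    simpa only [Int.reduceAdd, Int.reduceNeg, Int.reduceMul] using this
  have r14 : ∀ y, b ^ (14 : ℤ) * y = z ^ (2 : ℤ) * (b ^ (0 : ℤ) * y) := fun y => by
    have := b7 (0) (2) y
    simpa only [Int.reduceAdd, Int.reduceNeg, Int.reduceMul] using this
  have r21 : ∀ y, b ^ (21 : ℤ) * y = z ^ (3 : ℤ) * (b ^ (0 : ℤ) * y) := fun y => by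
    have := b7 (0) (3) y
    simpa only [Int.reduceAdd, Int.reduceNeg, Int.reduceMul] using this
  have rm14 : ∀ y, b ^ (-14 : ℤ) * y = z ^ (-2 : ℤ) * (b ^ (0 : ℤ) * y) := fun y => by
    have := b7 (0) (-2) y
    simpa only [Int.reduceAdd, Int.reduceNeg, Int.reduceMul] using this
  have rm21 : ∀ y, b ^ (-21 : ℤ) * y = z ^ (-3 : ℤ) * (b ^ (0 : ℤ) * y) := fun y => by
    have := b7 (0) (-3) y
    simpa only [Int.reduceAdd, Int.reduceNeg, Int.reduceMul] using this
  have rm28 : ∀ y, b ^ (-28 : ℤ) * y = z ^ (-4 : ℤ) * (b ^ (0 : ℤ) * y) := fun y => by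
    have := b7 (0) (-4) y
    simpa only [Int.reduceAdd, Int.reduceNeg, Int.reduceMul] using this
  have r28 : ∀ y, b ^ (28 : ℤ) * y = z ^ (4 : ℤ) * (b ^ (0 : ℤ) * y) := fun y => by
    have := b7 (0) (4) y
    simpa only [Int.reduceAdd, Int.reduceNeg, Int.reduceMul] using this
  have r12 : ∀ y, b ^ (12 : ℤ) * y = z ^ (2 : ℤ) * (b ^ (-2 : ℤ) * y) := fun y => by
    have := b7 (-2) (2) y
    simpa only [Int.reduceAdd, Int.reduceNeg, Int.reduceMul] using this
  have rm12 : ∀ y, b ^ (-12 : ℤ) * y = z ^ (-2 : ℤ) * (b ^ (2 : ℤ) * y) := fun y => by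
    have := b7 (2) (-2) y
    simpa only [Int.reduceAdd, Int.reduceNeg, Int.reduceMul] using this
  have r10 : ∀ y, b ^ (10 : ℤ) * y = z ^ (1 : ℤ) * (b ^ (3 : ℤ) * y) := fun y => by
    have := b7 (3) (1) y
    simpa only [Int.reduceAdd, Int.reduceNeg, Int.reduceMul] using this
  have rm10 : ∀ y, b ^ (-10 : ℤ) * y = z ^ (-1 : ℤ) * (b ^ (-3 : ℤ) * y) := fun y => by
    have := b7 (-3) (-1) y
    simpa only [Int.reduceAdd, Int.reduceNeg, Int.reduceMul] using this
  have r9 : ∀ y, b ^ (9 : ℤ) * y = z ^ (1 : ℤ) * (b ^ (2 : ℤ) * y) := fun y => by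
    have := b7 (2) (1) y
    simpa only [Int.reduceAdd, Int.reduceNeg, Int.reduceMul] using this
  have rm9 : ∀ y, b ^ (-9 : ℤ) * y = z ^ (-1 : ℤ) * (b ^ (-2 : ℤ) * y) := fun y => by
    have := b7 (-2) (-1) y
    simpa only [Int.reduceAdd, Int.reduceNeg, Int.reduceMul] using this
  have R3 : ∀ y, h ^ (3 : ℤ) * y = c ^ (69 : ℤ) * (z ^ (58 : ℤ) * y) := by
    intro y
    have e := congrArg (fun t => a * (b ^ (-2 : ℤ) * t)) (aa (b ^ (-2 : ℤ) * (a * (h ^ (-1 : ℤ) * 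
      (b ^ (-1 : ℤ) * (a * (b ^ (-1 : ℤ) * y)))))))
    simp only [bc, ac, bb, Int.reduceAdd, Int.reduceNeg] at e
    rw [Dm, P2, P2] at e
    have e2 := congrArg (fun t => c ^ (-21 : ℤ) * (z ^ (-12 : ℤ) * (h ^ (1 : ℤ) * t))) e
    simp only [aa, ac, az, bc, bz, zc, cc, zz, bb, zpow_zero, one_mul, hh, hhc, hhz, S2n, S3p, S3q, S3r, A1, A1m, r5, r6, r8, r16, r18, r20, rm8, rm6, rm16, r24, rm5, rm7, r7, r14, r21, rm14, rm21, rm28, r28, r12, rm12, r10, rm10, r9, rm9, Int.reduceAdd, Int.reduceNeg, Int.reduceMul] at e2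
    exact e2.symm
  have R4 : ∀ y, h ^ (3 : ℤ) * y = c ^ (122 : ℤ) * (z ^ (101 : ℤ) * y) := by
    intro y
    obtain ⟨t, ht⟩ : ∃ t, t = b ^ (1 : ℤ) * (a * (b ^ (1 : ℤ) * y)) := ⟨_, rfl⟩
    have e := congrArg (fun t => a * (b ^ (-1 : ℤ) * t)) (aa (b ^ (-2 : ℤ) * (a * (h ^ (-1 : ℤ) * t))))
    have e5 := b7 (4) (-1)
    simp only [bc, ac, bb, Int.reduceAdd, Int.reduceNeg, Int.reduceMul] at e e5
    rw [e5, az, D, P2] at e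
    simp only [aa, ac, az, bc, bz, zc, cc, zz, bb, zpow_zero, one_mul, hh, hhc, hhz, A1, A1m, r5, Int.reduceAdd, Int.reduceNeg, Int.reduceMul] at e
    rw [P2] at e
    rw [ht] at e
    have e2 := congrArg (fun t => c ^ (7 : ℤ) * (z ^ (10 : ℤ) * (h ^ (1 : ℤ) * t))) e
    simp only [aa, ac, az, bc, bz, zc, cc, zz, bb, zpow_zero, one_mul, hh, hhc, hhz, S2n, S3p, S3q, S3r, A1, A1m, r5, r6, r8, r16, r18, r20, rm8, rm6, rm16, r24, rm5, rm7, r7, r14, r21, rm14, rm21, rm28, r28, r12, rm12, r10, rm10, r9, rm9, Int.reduceAdd, Int.reduceNeg, Int.reduceMul] at e2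
    exact e2.symm
  have hcz : Commute c z := hc z
  have q1 : c ^ (21 : ℤ) * z ^ (17 : ℤ) = 1 := by simpa only [mul_one] using rel1 1
  have q2 : c ^ (53 : ℤ) * z ^ (43 : ℤ) = 1 := by
    have e := (R4 1).symm.trans (R3 1)
    have := congrArg (fun t => c ^ (-69 : ℤ) * (z ^ (-58 : ℤ) * t)) e
    simp only [aa, ac, az, bc, bz, zc, cc, zz, bb, zpow_zero, one_mul, hh, hhc, hhz, Int.reduceAdd, Int.reduceNeg, Int.reduceMul] at this
    simpa only [mul_one] using this
  have pw : ∀ (i j n : ℤ), (c ^ i * z ^ j) ^ n = c ^ (i * n) * z ^ (j * n) := fun i j n => by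
    rw [((hc _).zpow_left i).mul_zpow, ← zpow_mul, ← zpow_mul]
  have ml : ∀ (i j i' j' : ℤ), (c ^ i * z ^ j) * (c ^ i' * z ^ j') = c ^ (i + i') * z ^ (j + j') := by
    intro i j i' j'
    rw [mul_assoc, zc, ← mul_assoc, ← zpow_add, ← zpow_add]
  have q3 : c * z = 1 := by
    have : c * z = (c ^ (53 : ℤ) * z ^ (43 : ℤ)) ^ (2 : ℤ) * (c ^ (21 : ℤ) * z ^ (17 : ℤ)) ^ (-5 : ℤ) := by
      rw [pw, pw, ml]; norm_num
    rw [this, q1, q2]; simp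
  have q4 : c ^ 2 = 1 := by
    have : c ^ 2 = (c ^ (53 : ℤ) * z ^ (43 : ℤ)) * (c ^ (21 : ℤ) * z ^ (17 : ℤ)) ^ (-2 : ℤ) *
        (c ^ (1 : ℤ) * z ^ (1 : ℤ)) ^ (-9 : ℤ) := by
      rw [pw, pw, ml, ml]; norm_num
    rw [this, q1, q2, zpow_one, zpow_one, q3]; simp
  have q5 : z = c := by
    rw [sq] at q4
    exact mul_left_cancel (q3.trans q4.symm)
  subst q5
  have ev : ∀ n : ℤ, z ^ (2 * n) = 1 := fun n => by
    rw [zpow_mul]; norm_cast; rw [q4, one_zpow]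
  have ez : ∀ (m n : ℤ), z ^ (m + 2 * n) = z ^ m := fun m n => by rw [zpow_add, ev, mul_one]
  refine ⟨q4, rfl, h, ?_, ?_, ?_, ?_, ?_⟩
  · have := R3 1
    have e := ez 1 63
    simp only [mul_one, ← zpow_add, Int.reduceAdd, Int.reduceNeg, Int.reduceMul] at this e
    rw [e, zpow_one] at this
    exact_mod_cast this
  · have := S2 1
    have e := ez 0 (-2)
    simp only [mul_one, ← mul_assoc, ← zpow_add, Int.reduceAdd, Int.reduceNeg, Int.reduceMul] at this e
    rw [e] at this
    simpa using this
  · have := S3 1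
    have e := ez 1 (-6)
    simp only [mul_one, ← mul_assoc, ← zpow_add, Int.reduceAdd, Int.reduceNeg, Int.reduceMul] at this e
    rw [e] at this
    simp only [mul_assoc, zpow_one] at this
    exact_mod_cast this
  · have := D 1
    simp only [zpow_one, mul_one] at this
    exact this
  · have := P2 1
    have e := ez 1 (2)
    simp only [mul_one, ← mul_assoc, ← zpow_add, Int.reduceAdd, Int.reduceNeg, Int.reduceMul] at this e
    rw [e] at this
    simp only [mul_assoc, zpow_one] at this
    exact this

/-- The group has at most 336 elements, by a Bruhat decomposition. -/
lemma card_bound {G : Type*} [Group G] (a b c h : G)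
    (hgen : Subgroup.closure ({a, b} : Set G) = ⊤)
    (hc : ∀ x, Commute c x) (ha : a * a = c) (hb : b ^ 7 = c) (hc2 : c ^ 2 = 1)
    (aba : a * b * a = b⁻¹ * a * b⁻¹)
    (h3 : h ^ 3 = c) (hah : a * h = h⁻¹ * a) (hbh : b * h = c * (h * b ^ 2))
    (D : a * (b ^ (4 : ℤ) * a) = b ^ (-2 : ℤ) * (h * (a * b ^ (-2 : ℤ))))
    (P2 : a * (b ^ (-2 : ℤ) * a) = c * (b ^ (4 : ℤ) * (a * (b ^ (2 : ℤ) * h)))) :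
    Finite G ∧ Nat.card G ≤ 336 := by
  have hcb : c = b ^ (7 : ℤ) := by rw [← hb]; norm_cast
  have b14 : b ^ (14 : ℤ) = 1 := by
    rw [← hc2, ← hb, ← pow_mul]; norm_cast
  have hinv : h⁻¹ = h ^ 5 := by
    rw [inv_eq_iff_mul_eq_one, ← pow_succ', ← hc2, ← h3, ← pow_mul]
  have ainv : a⁻¹ = a * b ^ (7 : ℤ) := by
    rw [inv_eq_iff_mul_eq_one, ← mul_assoc, ha, ← hcb, ← sq, hc2]
  have bh1 : ∀ m : ℤ, b ^ m * h = h * b ^ (9 * m) := by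
    intro m
    have e : b = h * b ^ 9 * h⁻¹ := by
      rw [eq_mul_inv_iff_mul_eq, hbh, ← mul_assoc, (hc h).eq, mul_assoc, ← hb, ← pow_add]
    calc b ^ m * h = (h * b ^ 9 * h⁻¹) ^ m * h := by rw [← e]
      _ = h * (b ^ 9) ^ m := by rw [conj_zpow]; group
      _ = _ := by rw [zpow_mul]; norm_cast
  have bh : ∀ (i : ℕ) (m : ℤ), ∃ m' : ℤ, b ^ m * h ^ i = h ^ i * b ^ m' := by
    intro i
    induction i with
    | zero => intro m; exact ⟨m, by simp⟩
    | succ i ih =>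
      intro m
      obtain ⟨m', e⟩ := ih m
      exact ⟨9 * m', by rw [pow_succ, ← mul_assoc, e, mul_assoc, bh1, mul_assoc]⟩
  have ah : ∀ i : ℕ, a * h ^ i = h ^ (5 * i) * a := by
    intro i
    have e : a * h ^ i * a⁻¹ = (a * h * a⁻¹) ^ i := conj_pow.symm
    rw [← mul_inv_eq_iff_eq_mul, e, hah, mul_inv_cancel_right, hinv, ← pow_mul]
  set Q : G → Prop := fun g => ∃ (i : ℕ) (m n : ℤ), g = h ^ i * b ^ m * a * b ^ n with hQ
  have Ql : ∀ (m : ℤ) g, Q g → Q (b ^ m * g) := by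
    rintro m g ⟨i, k, n, rfl⟩
    obtain ⟨m', e⟩ := bh i m
    refine ⟨i, m' + k, n, ?_⟩
    rw [zpow_add, ← mul_assoc, ← mul_assoc, ← mul_assoc, e]; simp only [mul_assoc]
  have Qh : ∀ (j : ℕ) g, Q g → Q (h ^ j * g) := by
    rintro j g ⟨i, k, n, rfl⟩
    exact ⟨j + i, k, n, by rw [pow_add]; simp only [mul_assoc]⟩
  have Qr : ∀ (m : ℤ) g, Q g → Q (g * b ^ m) := by
    rintro m g ⟨i, k, n, rfl⟩
    exact ⟨i, k, n + m, by rw [zpow_add]; simp only [mul_assoc]⟩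
  have Qa : Q a := ⟨0, 0, 0, by simp⟩
  have Qrh : ∀ (j : ℕ) g, Q g → Q (g * h ^ j) := by
    rintro j g ⟨i, k, n, rfl⟩
    obtain ⟨n', e⟩ := bh j n
    have : h ^ i * b ^ k * a * b ^ n * h ^ j = h ^ i * (b ^ k * (h ^ (5 * j) * (a * b ^ n'))) := by
      rw [mul_assoc _ (b ^ n), e, ← mul_assoc (h ^ (5 * j)), ← ah]; simp only [mul_assoc]
    rw [this]
    exact Qh _ _ (Ql _ _ (Qh _ _ (Qr _ _ Qa)))
  have Qinv : ∀ g, Q g → Q g⁻¹ := by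
    rintro g ⟨i, k, n, rfl⟩
    have : (h ^ i * b ^ k * a * b ^ n)⁻¹ = b ^ (-n) * (a * b ^ (7 : ℤ) * b ^ (-k)) * h ^ (5 * i) := by
      rw [← ainv, pow_mul, ← hinv]; group
    rw [this]
    exact Qrh _ _ (Ql _ _ (Qr _ _ (Qr _ _ Qa)))
  -- the key computations
  have k1 : Q (a * b ^ (1 : ℤ) * a) := by
    rw [zpow_one, aba, ← zpow_neg_one]
    exact Qr _ _ (Ql _ _ Qa)
  have km2 : Q (a * b ^ (-2 : ℤ) * a) := by
    have : a * b ^ (-2 : ℤ) * a = b ^ (7 : ℤ) * (b ^ (4 : ℤ) * (a * b ^ (2 : ℤ) * h ^ 1)) := by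
      rw [mul_assoc, P2, ← hcb, pow_one]; simp only [mul_assoc]
    rw [this]
    exact Ql _ _ (Ql _ _ (Qrh _ _ (Qr _ _ Qa)))
  have k4 : Q (a * b ^ (4 : ℤ) * a) := by
    have : a * b ^ (4 : ℤ) * a = b ^ (-2 : ℤ) * (h ^ 1 * (a * b ^ (-2 : ℤ))) := by
      rw [mul_assoc, D, pow_one]
    rw [this]
    exact Ql _ _ (Qh _ _ (Qr _ _ Qa))
  have kshift : ∀ j n : ℤ, a * b ^ (j + 7 * n) * a = b ^ (7 * n) * (a * b ^ j * a) := by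
    intro j n
    have e : b ^ (7 * n) = c ^ n := by rw [hcb, zpow_mul]
    rw [add_comm, zpow_add, e, ← mul_assoc a, ← ((hc a).zpow_left n).eq]
    simp only [mul_assoc]
  have kneg : ∀ j : ℤ, Q (a * b ^ j * a) → Q (a * b ^ (-j) * a) := by
    intro j hj
    have : a * b ^ (-j) * a = (a * b ^ j * a)⁻¹ := by
      rw [eq_inv_iff_mul_eq_one]
      calc a * b ^ (-j) * a * (a * b ^ j * a) = a * b ^ (-j) * (a * a) * b ^ j * a := by
            simp only [mul_assoc]
        _ = 1 := by
            rw [ha, mul_assoc a, ← (hc _).eq]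
            calc a * (c * b ^ (-j)) * b ^ j * a = a * c * a := by group
              _ = 1 := by rw [← (hc a).eq, mul_assoc, ha, ← sq, hc2]
    rw [this]; exact Qinv _ hj
  have kall : ∀ j : ℤ, (∃ m : ℤ, a * b ^ j * a = b ^ m) ∨ Q (a * b ^ j * a) := by
    intro j
    have hj : ∃ n : ℤ, j = 0 + 7 * n ∨ j = 1 + 7 * n ∨ j = -1 + 7 * n ∨ j = -2 + 7 * n ∨
        j = -(-2) + 7 * n ∨ j = 4 + 7 * n ∨ j = -4 + 7 * n := by
      have : j % 7 = 0 ∨ j % 7 = 1 ∨ j % 7 = 2 ∨ j % 7 = 3 ∨ j % 7 = 4 ∨ j % 7 = 5 ∨ j % 7 = 6 := by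
        omega
      rcases this with h | h | h | h | h | h | h
      · exact ⟨j / 7, by omega⟩
      · exact ⟨j / 7, by omega⟩
      · exact ⟨j / 7, by omega⟩
      · exact ⟨j / 7 + 1, by omega⟩
      · exact ⟨j / 7, by omega⟩
      · exact ⟨j / 7 + 1, by omega⟩
      · exact ⟨j / 7 + 1, by omega⟩
    obtain ⟨n, e | e | e | e | e | e | e⟩ := hj <;> rw [e, kshift]
    · left
      refine ⟨7 * n + 7, ?_⟩
      rw [zpow_zero, mul_one, ha, hcb, zpow_add]
    · exact Or.inr (Ql _ _ k1)
    · exact Or.inr (Ql _ _ (kneg _ k1))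
    · exact Or.inr (Ql _ _ km2)
    · exact Or.inr (Ql _ _ (kneg _ km2))
    · exact Or.inr (Ql _ _ k4)
    · exact Or.inr (Ql _ _ (kneg _ k4))
  have mb : ∀ (m : ℤ) g, ((∃ (i : ℕ) (j : ℤ), g = h ^ i * b ^ j) ∨ Q g) →
      ((∃ (i : ℕ) (j : ℤ), b ^ m * g = h ^ i * b ^ j) ∨ Q (b ^ m * g)) := by
    rintro m g (⟨i, j, rfl⟩ | hg)
    · left
      obtain ⟨m', e⟩ := bh i m
      exact ⟨i, m' + j, by rw [← mul_assoc, e, mul_assoc, zpow_add]⟩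
    · exact Or.inr (Ql _ _ hg)
  have ma : ∀ g, ((∃ (i : ℕ) (j : ℤ), g = h ^ i * b ^ j) ∨ Q g) →
      ((∃ (i : ℕ) (j : ℤ), a * g = h ^ i * b ^ j) ∨ Q (a * g)) := by
    rintro g (⟨i, j, rfl⟩ | ⟨i, j, k, rfl⟩)
    · right
      rw [← mul_assoc, ah, mul_assoc]
      exact Qh _ _ (Qr _ _ Qa)
    · have e : a * (h ^ i * b ^ j * a * b ^ k) = h ^ (5 * i) * ((a * b ^ j * a) * b ^ k) := by
        simp only [← mul_assoc, ah]
      rw [e]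
      rcases kall j with ⟨m, e2⟩ | e2
      · left
        exact ⟨5 * i, m + k, by rw [e2, zpow_add]⟩
      · exact Or.inr (Qh _ _ (Qr _ _ e2))
  have cover : ∀ g, ((∃ (i : ℕ) (j : ℤ), g = h ^ i * b ^ j) ∨ Q g) := by
    refine gen_induction a b hgen _ (Or.inl ⟨0, 0, by simp⟩) ma ?_ ?_ ?_
    · intro g hg; simpa only [zpow_one] using mb 1 g hg
    · intro g hg
      rw [ainv, mul_assoc]
      exact ma _ (mb _ _ hg)
    · intro g hg; simpa only [zpow_neg_one] using mb (-1) g hg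
  have red : ∀ (i : ℕ) (j : ℤ), ∃ (i' : Fin 3) (j' : Fin 14),
      h ^ i * b ^ j = h ^ (i' : ℕ) * b ^ (j' : ℕ) := by
    intro i j
    have e : h ^ i = h ^ (i % 3) * b ^ (7 * (i / 3 : ℕ) : ℤ) := by
      rw [zpow_mul, ← hcb, ← h3]
      norm_cast
      rw [← pow_mul, ← pow_add, Nat.mod_add_div]
    have e2 : b ^ (7 * (i / 3 : ℕ) : ℤ) * b ^ j = b ^ ((7 * (i / 3 : ℕ) + j) % 14).toNat := by
      rw [← zpow_natCast, Int.toNat_of_nonneg (by omega), ← zpow_add]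
      conv_lhs => rw [← Int.emod_add_mul_ediv (7 * (i / 3 : ℕ) + j) 14]
      rw [zpow_add, zpow_mul, b14, one_zpow, mul_one]
    refine ⟨⟨i % 3, by omega⟩, ⟨((7 * (i / 3 : ℕ) + j) % 14).toNat, by omega⟩, ?_⟩
    rw [e, mul_assoc, e2]
  let f : (Fin 3 × Fin 14) ⊕ (Fin 3 × Fin 14 × Fin 7) → G := fun t => match t with
    | Sum.inl (i, j) => h ^ (i : ℕ) * b ^ (j : ℕ)
    | Sum.inr (i, j, k) => h ^ (i : ℕ) * b ^ (j : ℕ) * a * b ^ (k : ℕ)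
  have hf : Function.Surjective f := by
    intro g
    rcases cover g with ⟨i, j, rfl⟩ | ⟨i, j, k, rfl⟩
    · obtain ⟨i', j', e⟩ := red i j
      exact ⟨Sum.inl (i', j'), e.symm⟩
    · obtain ⟨i', j', e⟩ := red i (j + 7 * (k / 7))
      refine ⟨Sum.inr (i', j', ⟨(k % 7).toNat, by omega⟩), ?_⟩
      change h ^ (i' : ℕ) * b ^ (j' : ℕ) * a * b ^ (k % 7).toNat = _
      rw [← e, ← zpow_natCast b (k % 7).toNat, Int.toNat_of_nonneg (by omega)]
      have e3 : b ^ (7 * (k / 7)) = c ^ (k / 7) := by rw [hcb, zpow_mul]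
      conv_rhs => rw [← Int.emod_add_mul_ediv k 7]
      rw [add_comm (k % 7), zpow_add, zpow_add, e3]
      simp only [mul_assoc]
      rw [← mul_assoc a, ← ((hc a).zpow_left _).eq, mul_assoc]
  refine ⟨Finite.of_surjective f hf, ?_⟩
  have := Nat.card_le_card_of_surjective f hf
  simpa using this

lemma card_quads : Fintype.card {x : ZMod 7 × ZMod 7 × ZMod 7 × ZMod 7 //
    x.1 * x.2.2.2 - x.2.1 * x.2.2.1 = 1} = 336 := by
  decide +kernel

lemma card_sl_ge (h : Finite SL2_7) : 336 ≤ Nat.card SL2_7 := by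
  rw [← card_quads, ← Nat.card_eq_fintype_card]
  refine Nat.card_le_card_of_injective
    (fun x => (⟨!![x.1.1, x.1.2.1; x.1.2.2.1, x.1.2.2.2], by
      rw [Matrix.det_fin_two_of]; exact x.2⟩ : SL2_7)) ?_
  rintro ⟨⟨p, q, r, s⟩, h⟩ ⟨⟨p', q', r', s'⟩, h'⟩ e
  have e' := congrArg Subtype.val e
  have e1 := congrFun (congrFun e' 0) 0
  have e2 := congrFun (congrFun e' 0) 1
  have e3 := congrFun (congrFun e' 1) 0
  have e4 := congrFun (congrFun e' 1) 1
  simp at e1 e2 e3 e4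
  subst e1 e2 e3 e4
  rfl

def matA : SL2_7 := ⟨!![0, 1; -1, 0], by decide⟩
def matB : SL2_7 := ⟨!![-1, -1; 0, -1], by decide⟩
def up (x : ZMod 7) : SL2_7 := ⟨!![1, x; 0, 1], by simp [Matrix.det_fin_two_of]⟩
def lo (x : ZMod 7) : SL2_7 := ⟨!![1, 0; x, 1], by simp [Matrix.det_fin_two_of]⟩

lemma mat_rel1 : (matA * matB) ^ 3 = matA ^ 2 := by decide +kernel
lemma mat_rel2 : (matA * matB ^ 4 * matA * matB ^ 4) ^ 2 * matB ^ 7 * matA ^ 4 = 1 := by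
  decide +kernel

lemma up_eq : ∀ x : ZMod 7, up x = matB ^ (8 * x.val) := by decide +kernel
lemma lo_eq : ∀ x : ZMod 7, lo x = matA * matB ^ (8 * (-x).val) * matA⁻¹ := by decide +kernel

lemma sl_ext {M N : SL2_7} (h00 : M.1 0 0 = N.1 0 0) (h01 : M.1 0 1 = N.1 0 1)
    (h10 : M.1 1 0 = N.1 1 0) (h11 : M.1 1 1 = N.1 1 1) : M = N := by
  apply Subtype.ext
  ext i j
  fin_cases i <;> fin_cases j <;> assumption

lemma sl_mul (M N : SL2_7) (i j : Fin 2) :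
    (M * N).1 i j = M.1 i 0 * N.1 0 j + M.1 i 1 * N.1 1 j := by
  have : (M * N).1 = M.1 * N.1 := rfl
  rw [this, Matrix.mul_apply, Fin.sum_univ_two]

lemma sl_det (M : SL2_7) : M.1 0 0 * M.1 1 1 - M.1 0 1 * M.1 1 0 = 1 := by
  have hd := M.2
  rwa [Matrix.det_fin_two] at hd

lemma zmod_inv : ∀ r : ZMod 7, r ≠ 0 → r * r ^ 5 = 1 := by decide

@[simp] lemma up00 (x) : (up x).1 0 0 = 1 := rfl
@[simp] lemma up01 (x) : (up x).1 0 1 = x := rfl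
@[simp] lemma up10 (x) : (up x).1 1 0 = 0 := rfl
@[simp] lemma up11 (x) : (up x).1 1 1 = 1 := rfl
@[simp] lemma lo00 (x) : (lo x).1 0 0 = 1 := rfl
@[simp] lemma lo01 (x) : (lo x).1 0 1 = 0 := rfl
@[simp] lemma lo10 (x) : (lo x).1 1 0 = x := rfl
@[simp] lemma lo11 (x) : (lo x).1 1 1 = 1 := rfl

lemma sl_decomp (M : SL2_7) (hr : M.1 1 0 ≠ 0) :
    M = up ((M.1 0 0 - 1) * M.1 1 0 ^ 5) * lo (M.1 1 0) * up ((M.1 1 1 - 1) * M.1 1 0 ^ 5) := by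
  have hd := sl_det M
  have hi := zmod_inv _ hr
  generalize hw : M.1 1 0 ^ 5 = w at *
  apply sl_ext <;> simp only [sl_mul, up00, up01, up10, up11, lo00, lo01, lo10, lo11]
  · linear_combination -(M.1 0 0 - 1) * hi
  · linear_combination (-(M.1 0 0 - 1) * (M.1 1 1 - 1) * w - M.1 0 1) * hi - w * hd
  · ring
  · linear_combination -(M.1 1 1 - 1) * hi

lemma mat_gen : Subgroup.closure ({matA, matB} : Set SL2_7) = ⊤ := by
  rw [eq_top_iff]
  set H := Subgroup.closure ({matA, matB} : Set SL2_7)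
  have hA : matA ∈ H := Subgroup.subset_closure (by simp)
  have hB : matB ∈ H := Subgroup.subset_closure (by simp)
  have hup : ∀ x, up x ∈ H := fun x => by rw [up_eq]; exact H.pow_mem hB _
  have hlo : ∀ x, lo x ∈ H := fun x => by
    rw [lo_eq]; exact H.mul_mem (H.mul_mem hA (H.pow_mem hB _)) (H.inv_mem hA)
  have key : ∀ M : SL2_7, M.1 1 0 ≠ 0 → M ∈ H := fun M hM => by
    rw [sl_decomp M hM]
    exact H.mul_mem (H.mul_mem (hup _) (hlo _)) (hup _)
  intro M _
  by_cases hM : M.1 1 0 = 0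
  · have : M * lo 1 ∈ H := by
      apply key
      have hd := sl_det M
      rw [hM] at hd
      intro h0
      rw [sl_mul, hM] at h0
      have h0' : M.1 1 1 = 0 := by simpa using h0
      rw [h0'] at hd
      simp at hd
      exact absurd hd (by decide)
    simpa using H.mul_mem this (H.inv_mem (hlo 1))
  · exact key M hM


/-- Cayley-Hamilton in degree two. -/
lemma cayley (M : SL2_7) : M.1 ^ 2 = (M.1 0 0 + M.1 1 1) • M.1 + (-1 : ZMod 7) • 1 := by
  have hd := sl_det M
  rw [pow_two]
  ext i j
  fin_cases i <;> fin_cases j <;>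
    simp [Matrix.mul_apply, Fin.sum_univ_two]
  · linear_combination -hd
  · ring
  · ring
  · linear_combination -hd

lemma cayley_step (X : Matrix (Fin 2) (Fin 2) (ZMod 7)) (t : ZMod 7)
    (h : X ^ 2 = t • X + (-1 : ZMod 7) • 1) (n : ℕ) (u v u' v' : ZMod 7)
    (hn : X ^ n = u • X + v • 1) (hu : u' = u * t + v) (hv : v' = -u) :
    X ^ (n + 1) = u' • X + v' • 1 := by
  rw [pow_succ, hn, add_mul, smul_mul_assoc, ← pow_two, h, hu, hv]
  simp only [smul_mul_assoc, one_mul]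
  module

lemma val_one_iff (M : SL2_7) (n : ℕ) : M ^ n = 1 ↔ M.1 ^ n = 1 :=
  ⟨fun h => by
    have := congrArg Subtype.val h
    exact this, fun h => Subtype.ext h⟩

lemma val_neg_one_iff (M : SL2_7) (n : ℕ) : M ^ n = -1 ↔ M.1 ^ n = -1 :=
  ⟨fun h => by
    have := congrArg Subtype.val h
    exact this, fun h => Subtype.ext h⟩

lemma trace_three (M : SL2_7) (h : M.1 0 0 + M.1 1 1 = 3) : M ^ 4 = -1 := by
  rw [val_neg_one_iff]
  have hC := cayley M
  rw [h] at hC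
  have e3 := cayley_step _ 3 hC 2 3 (-1) 1 (-3) hC (by decide) (by decide)
  have e4 := cayley_step _ 3 hC 3 1 (-3) 0 (-1) e3 (by decide) (by decide)
  rw [e4]; simp

lemma trace_zero (M : SL2_7) (h : M.1 0 0 + M.1 1 1 = 0) : M ^ 2 = -1 := by
  rw [val_neg_one_iff]
  have hC := cayley M
  rw [h] at hC
  rw [hC]; simp

lemma trace_one (M : SL2_7) (h : M.1 0 0 + M.1 1 1 = 1) : M ^ 3 = -1 := by
  rw [val_neg_one_iff]
  have hC := cayley M
  rw [h] at hC
  have e3 := cayley_step _ 1 hC 2 1 (-1) 0 (-1) hC (by decide) (by decide)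
  rw [e3]; simp

lemma trace_two (M : SL2_7) (h : M.1 0 0 + M.1 1 1 = 2) : M ^ 7 = 1 := by
  rw [val_one_iff]
  have hC := cayley M
  rw [h] at hC
  have e3 := cayley_step _ 2 hC 2 2 (-1) 3 (-2) hC (by decide) (by decide)
  have e4 := cayley_step _ 2 hC 3 3 (-2) 4 (-3) e3 (by decide) (by decide)
  have e5 := cayley_step _ 2 hC 4 4 (-3) 5 (-4) e4 (by decide) (by decide)
  have e6 := cayley_step _ 2 hC 5 5 (-4) 6 (-5) e5 (by decide) (by decide)
  have e7 := cayley_step _ 2 hC 6 6 (-5) 0 1 e6 (by decide) (by decide)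
  rw [e7]; simp

lemma neg_cases (M : SL2_7) : (M ^ 8 = 1 ∨ M ^ 6 = 1 ∨ M ^ 7 = 1) ∨ (-M) ^ 8 = 1 ∨
    (-M) ^ 6 = 1 ∨ (-M) ^ 7 = 1 := by
  have h3 : ∀ t : ZMod 7, t = 0 ∨ t = 1 ∨ -t = 1 ∨ t = 2 ∨ -t = 2 ∨ t = 3 ∨ -t = 3 := by decide
  have hneg : (-M).1 0 0 + (-M).1 1 1 = -(M.1 0 0 + M.1 1 1) := by
    change -(M.1 0 0) + -(M.1 1 1) = _
    ring
  have c2 : ∀ N : SL2_7, N ^ 2 = -1 → N ^ 8 = 1 := fun N h => by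
    rw [show N ^ 8 = (N ^ 2) ^ 4 by rw [← pow_mul], h]; decide
  have c3 : ∀ N : SL2_7, N ^ 3 = -1 → N ^ 6 = 1 := fun N h => by
    rw [show N ^ 6 = (N ^ 3) ^ 2 by rw [← pow_mul], h]; decide
  have c4 : ∀ N : SL2_7, N ^ 4 = -1 → N ^ 8 = 1 := fun N h => by
    rw [show N ^ 8 = (N ^ 4) ^ 2 by rw [← pow_mul], h]; decide
  obtain h | h | h | h | h | h | h := h3 (M.1 0 0 + M.1 1 1)
  · exact Or.inl (Or.inl (c2 _ (trace_zero _ h)))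
  · exact Or.inl (Or.inr (Or.inl (c3 _ (trace_one _ h))))
  · exact Or.inr (Or.inr (Or.inl (c3 _ (trace_one _ (hneg.trans h)))))
  · exact Or.inl (Or.inr (Or.inr (trace_two _ h)))
  · exact Or.inr (Or.inr (Or.inr (trace_two _ (hneg.trans h))))
  · exact Or.inl (Or.inl (c4 _ (trace_three _ h)))
  · exact Or.inr (Or.inl (c4 _ (trace_three _ (hneg.trans h))))

lemma up_inv (x : ZMod 7) : (up x)⁻¹ = up (-x) := by
  rw [inv_eq_iff_mul_eq_one]
  apply sl_ext <;> simp [sl_mul]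

lemma lo_inv (x : ZMod 7) : (lo x)⁻¹ = lo (-x) := by
  rw [inv_eq_iff_mul_eq_one]
  apply sl_ext <;> simp [sl_mul]

lemma sl_inv (M : SL2_7) : M⁻¹.1 0 0 = M.1 1 1 ∧ M⁻¹.1 0 1 = -M.1 0 1 ∧ M⁻¹.1 1 0 = -M.1 1 0 ∧
    M⁻¹.1 1 1 = M.1 0 0 := by
  have : M⁻¹.1 = M.1.adjugate := rfl
  rw [this, Matrix.adjugate_fin_two]
  exact ⟨rfl, rfl, rfl, rfl⟩

/-- A normal subgroup containing a matrix with nonzero lower left entry contains `-1`. -/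
lemma neg_one_mem (N : Subgroup SL2_7) [N.Normal] (k : SL2_7) (hk : k ∈ N) (hr : k.1 1 0 ≠ 0) :
    -1 ∈ N := by
  set x := k.1 1 0 ^ 5 with hx
  have hi : k.1 1 0 * x = 1 := zmod_inv _ hr
  have hm : k * (up x * k⁻¹ * (up x)⁻¹) ∈ N :=
    N.mul_mem hk (Subgroup.Normal.conj_mem inferInstance _ (N.inv_mem hk) _)
  have ht : (k * (up x * k⁻¹ * (up x)⁻¹)).1 0 0 + (k * (up x * k⁻¹ * (up x)⁻¹)).1 1 1 = 3 := by
    obtain ⟨i1, i2, i3, i4⟩ := sl_inv k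
    have hd := sl_det k
    rw [up_inv]
    simp only [sl_mul, up00, up01, up10, up11, i1, i2, i3, i4]
    linear_combination 2 * hd + (k.1 1 0 * x + 1) * hi
  rw [← trace_three _ ht]
  exact N.pow_mem hm 4

lemma exists_conj (k : SL2_7) (h1 : k ≠ 1) (h2 : k ≠ -1) :
    ∃ x, (lo x * k * (lo x)⁻¹).1 1 0 ≠ 0 := by
  by_contra! hcon
  have f : ∀ x, k.1 1 0 + x * (k.1 0 0 - k.1 1 1) - x ^ 2 * k.1 0 1 = 0 := fun x => by
    have := hcon x
    rw [lo_inv] at this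
    simp only [sl_mul, lo00, lo01, lo10, lo11] at this
    linear_combination this
  have hd := sl_det k
  have aux : ∀ p q s : ZMod 7, p * s = 1 → 1 * (p - s) - 1 ^ 2 * q = 0 →
      (-1) * (p - s) - (-1) ^ 2 * q = 0 → q = 0 ∧ ((p = 1 ∧ s = 1) ∨ (p = -1 ∧ s = -1)) := by
    decide
  have g0 : k.1 1 0 = 0 := by simpa using f 0
  have g1 := f 1
  have g2 := f (-1)
  rw [g0, zero_add] at g1 g2
  rw [g0, mul_zero, sub_zero] at hd
  obtain ⟨q0, ⟨p1, s1⟩ | ⟨p1, s1⟩⟩ := aux _ _ _ hd g1 g2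
  · exact h1 (sl_ext p1 q0 g0 s1)
  · exact h2 (sl_ext (p1.trans (by decide)) (q0.trans (by decide)) (g0.trans (by decide))
      (s1.trans (by decide)))

lemma normal_sub (N : Subgroup SL2_7) [N.Normal] (h : N ≠ ⊥) : -1 ∈ N := by
  obtain ⟨k, hk, hk1⟩ := N.bot_or_exists_ne_one.resolve_left h
  by_cases h2 : k = -1
  · rwa [← h2]
  obtain ⟨x, hx⟩ := exists_conj k hk1 h2
  exact neg_one_mem N _ (Subgroup.Normal.conj_mem inferInstance _ hk _) hx

lemma hom_injective {G : Type*} [Group G] (f : SL2_7 →* G) (hf : Function.Surjective f)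
    (h14 : ∃ g : G, orderOf g = 14) : Function.Injective f := by
  rw [← MonoidHom.ker_eq_bot_iff]
  by_contra hne
  have hm : f (-1) = 1 := normal_sub f.ker hne
  obtain ⟨g, hg⟩ := h14
  obtain ⟨M, rfl⟩ := hf g
  have hneg : f (-M) = f M := by
    rw [← neg_one_mul, map_mul, hm, one_mul]
  have key : ∀ n, f M ^ n = 1 → 14 ∣ n := fun n hn => hg ▸ orderOf_dvd_of_pow_eq_one hn
  have t : ∀ n, M ^ n = 1 → 14 ∣ n := fun n hn => key n (by rw [← map_pow, hn, map_one])
  have t' : ∀ n, (-M) ^ n = 1 → 14 ∣ n := fun n hn =>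
    key n (by rw [← hneg, ← map_pow, hn, map_one])
  obtain (h | h | h) | h | h | h := neg_cases M
  · exact absurd (t _ h) (by norm_num)
  · exact absurd (t _ h) (by norm_num)
  · exact absurd (t _ h) (by norm_num)
  · exact absurd (t' _ h) (by norm_num)
  · exact absurd (t' _ h) (by norm_num)
  · exact absurd (t' _ h) (by norm_num)

lemma bound {G : Type*} [Group G] (a b : G)
    (hgen : Subgroup.closure ({a, b} : Set G) = ⊤)
    (h1 : (a * b) ^ 3 = a ^ 2)
    (h2 : (a * b ^ 4 * a * b ^ 4) ^ 2 * b ^ 7 * a ^ 4 = 1) :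
    Finite G ∧ Nat.card G ≤ 336 := by
  have hc := sq_central a b hgen h1
  have hz := pow7_central a b hgen h1 h2
  have h2' : (a * b ^ 4 * a * b ^ 4) ^ 2 * b ^ 7 * (a ^ 2) ^ 2 = 1 := by
    rw [← pow_mul]; exact h2
  obtain ⟨hc2, hzc, h, h3, hah, hbh, hD, hP⟩ :=
    core a b (a ^ 2) (b ^ 7) hc hz (sq a).symm rfl h1 h2'
  have aba : a * b * a = b⁻¹ * a * b⁻¹ := by
    have : a * b * a = b⁻¹ * a⁻¹ * ((a * b) ^ 3) * b⁻¹ := by simp [pow_succ, mul_assoc]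
    rw [this, h1]; group
  exact card_bound a b (a ^ 2) h hgen hc (sq a).symm hzc hc2 aba h3 hah hbh hD hP

/-- Every group satisfying the relations is a quotient of `SL(2, 7)`. -/
lemma exists_hom {G : Type*} [Group G] (a b : G)
    (hgen : Subgroup.closure ({a, b} : Set G) = ⊤)
    (h1 : (a * b) ^ 3 = a ^ 2)
    (h2 : (a * b ^ 4 * a * b ^ 4) ^ 2 * b ^ 7 * a ^ 4 = 1) :
    ∃ f : SL2_7 →* G, Function.Surjective f := by
  set S : Set (G × SL2_7) := {(a, matA), (b, matB)} with hS
  set H := Subgroup.closure S with hH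
  have ma : (a, matA) ∈ H := Subgroup.subset_closure (by simp [hS])
  have mb : (b, matB) ∈ H := Subgroup.subset_closure (by simp [hS])
  have hgenH : Subgroup.closure ({⟨(a, matA), ma⟩, ⟨(b, matB), mb⟩} : Set H) = ⊤ := by
    rw [← Subgroup.closure_closure_coe_preimage (k := S)]
    congr 1
    ext ⟨x, hx⟩
    simp [hS]
  have hb := bound (G := H) ⟨(a, matA), ma⟩ ⟨(b, matB), mb⟩ hgenH
    (Subtype.ext (Prod.ext h1 mat_rel1)) (Subtype.ext (Prod.ext h2 mat_rel2))
  obtain ⟨hfin, hcard⟩ := hb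
  have s1 : Function.Surjective ((MonoidHom.fst G SL2_7).comp H.subtype) := by
    rw [← MonoidHom.range_eq_top, MonoidHom.range_comp, Subgroup.range_subtype, hH,
      MonoidHom.map_closure, hS, Set.image_pair]
    exact hgen
  have s2 : Function.Surjective ((MonoidHom.snd G SL2_7).comp H.subtype) := by
    rw [← MonoidHom.range_eq_top, MonoidHom.range_comp, Subgroup.range_subtype, hH,
      MonoidHom.map_closure, hS, Set.image_pair]
    exact mat_gen
  have hfs : Finite SL2_7 := Finite.of_surjective _ s2
  have hle := card_sl_ge hfs
  have hbij : Function.Bijective ((MonoidHom.snd G SL2_7).comp H.subtype) :=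
    s2.bijective_of_nat_card_le (hcard.trans hle)
  let e := MulEquiv.ofBijective _ hbij
  exact ⟨((MonoidHom.fst G SL2_7).comp H.subtype).comp e.symm.toMonoidHom,
    s1.comp e.symm.surjective⟩

theorem quotient_with_order_14_is_sl2_7
    (G : Type*) [Group G] (a b : G)
    (hgen : Subgroup.closure ({a, b} : Set G) = ⊤)
    (h1 : (a * b) ^ 3 = a ^ 2)
    (h2 : (a * b ^ 4 * a * b ^ 4) ^ 2 * b ^ 7 * a ^ 4 = 1)
    (h14 : ∃ g : G, orderOf g = 14) :
    Nonempty (G ≃* SL2_7) := by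
  obtain ⟨f, hf⟩ := exists_hom a b hgen h1 h2
  exact ⟨(MulEquiv.ofBijective f ⟨hom_injective f hf h14, hf⟩).symm⟩
end

section
/- The group presented by generators a, b subject to the relations a^2 = b^19 = (a*b^2)^4 = (a*b*a*b^2)^3 = 1 is isomorphic to PGL(2, 19). -/
abbrev GL2_19 := Matrix.GeneralLinearGroup (Fin 2) (ZMod 19)

abbrev PGL2_19 := GL2_19 ⧸ Subgroup.center GL2_19

namespace Stmt14

local notation "a" => FreeGroup.of (0 : Fin 2)
local notation "b" => FreeGroup.of (1 : Fin 2)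

def rels : Set (FreeGroup (Fin 2)) :=
  {a ^ 2, b ^ 19, (a * b ^ 2) ^ 4, (a * b * a * b ^ 2) ^ 3}

/-- Consequences of the relations in an arbitrary group, with `w = y x y^2 x y`, `t = x w`. -/
theorem key {G : Type*} [Group G] (x y : G) (h1 : x ^ 2 = 1) (h2 : y ^ 19 = 1)
    (h3 : (x * y ^ 2) ^ 4 = 1) (h4 : (x * y * x * y ^ 2) ^ 3 = 1) :
    ∃ w t : G, x = t * w ∧ w * w = 1 ∧ w * y * w = y⁻¹ * w * y⁻¹ ∧ w * t * w = t⁻¹ ∧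
      t * y * t⁻¹ = y ^ 2 ∧ t ^ 18 = 1 ∧ w = y * x * y ^ 2 * x * y := by
  have hx : x * x = 1 := by rw [← pow_two]; exact h1
  have hxi : x⁻¹ = x := inv_eq_of_mul_eq_one_left hx
  obtain ⟨u, hu⟩ : ∃ u, u = x * y ^ 2 * x := ⟨_, rfl⟩
  have hxux : x * u * x = y ^ 2 := by
    calc x * u * x = (x * x) * y ^ 2 * (x * x) := by rw [hu]; group
      _ = _ := by rw [hx]; group
  have e3 : u * y ^ 2 * u * y ^ 2 = 1 := by
    rw [← h3, hu]; simp only [pow_succ, pow_zero, one_mul, mul_assoc]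
  have e4 : y * u * y * u * y * u = 1 := by
    calc y * u * y * u * y * u = x⁻¹ * (x * y * x * y ^ 2) ^ 3 * x := by
          rw [hu]; simp only [pow_succ, pow_zero, one_mul, mul_assoc, inv_mul_cancel_left]
      _ = 1 := by rw [h4]; group
  obtain ⟨w, hw⟩ : ∃ w, w = y * u * y := ⟨_, rfl⟩
  have ww : w * w = 1 := by
    calc w * w = y * (u * y ^ 2 * u * y ^ 2) * y⁻¹ := by
          rw [hw]; simp only [pow_two, mul_assoc, mul_inv_cancel, mul_one]
      _ = 1 := by rw [e3]; group
  have wi : w⁻¹ = w := inv_eq_of_mul_eq_one_left ww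
  have hw' : w = u * y * u := by
    have : w * (u * y * u) = 1 := by rw [← e4, hw]; group
    rw [← wi]; exact inv_eq_of_mul_eq_one_right this
  have wyw : w * y * w = u := by
    have : w * y = u * w := by
      calc w * y = u * y * u * y := by rw [hw']
        _ = u * w := by rw [hw]; group
    rw [this, mul_assoc, ww, mul_one]
  have wuw : w * u * w = y := by
    rw [← wyw]
    calc w * (w * y * w) * w = (w * w) * y * (w * w) := by group
      _ = y := by rw [ww]; group
  obtain ⟨t, ht⟩ : ∃ t, t = x * w := ⟨_, rfl⟩
  have ti : t⁻¹ = w * x := by rw [ht, mul_inv_rev, wi, hxi]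
  have wtw : w * t * w = t⁻¹ := by
    rw [ti, ht]
    calc w * (x * w) * w = w * x * (w * w) := by group
      _ = _ := by rw [ww, mul_one]
  have tyt : t * y * t⁻¹ = y ^ 2 := by
    rw [ti, ht, ← hxux, ← wyw]; group
  have conjw : ∀ n : ℕ, w * t ^ n * w = (t ^ n)⁻¹ := by
    intro n
    have : (w * t * w⁻¹) ^ n = w * t ^ n * w⁻¹ := conj_pow
    rw [wi, wtw] at this
    rw [← this, inv_pow]
  have conjt : ∀ n : ℕ, t ^ n * y * (t ^ n)⁻¹ = y ^ (2 ^ n) := by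
    intro n
    induction n with
    | zero => simp
    | succ n ih =>
      calc t ^ (n+1) * y * (t ^ (n+1))⁻¹ = t * (t ^ n * y * (t ^ n)⁻¹) * t⁻¹ := by
            rw [pow_succ']; group
        _ = (t * y * t⁻¹) ^ (2 ^ n) := by rw [ih, conj_pow]
        _ = _ := by rw [tyt, ← pow_mul, pow_succ']
  have t9 : t ^ 9 * y * (t ^ 9)⁻¹ = y⁻¹ := by
    rw [conjt, eq_inv_iff_mul_eq_one, ← pow_succ]
    have : 2 ^ 9 + 1 = 19 * 27 := by norm_num
    rw [this, pow_mul, h2, one_pow]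
  -- `t^9` inverts `y`, so does its inverse
  have t9' : (t ^ 9)⁻¹ * y * t ^ 9 = y⁻¹ := by
    have h := congrArg (fun g => (t ^ 9)⁻¹ * g⁻¹ * t ^ 9) t9
    simp only [inv_inv] at h
    rw [← h]; group
  have t9u : t ^ 9 * u * (t ^ 9)⁻¹ = u⁻¹ := by
    have h9 := conjw 9
    have h9' : t ^ 9 = w * (t ^ 9)⁻¹ * w := by
      rw [← h9]
      calc t ^ 9 = (w * w) * t ^ 9 * (w * w) := by rw [ww]; group
        _ = _ := by group
    have h9i : (t ^ 9)⁻¹ = w * t ^ 9 * w := h9.symm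
    calc t ^ 9 * u * (t ^ 9)⁻¹ = (w * (t ^ 9)⁻¹ * w) * u * (w * t ^ 9 * w) := by
          rw [← h9', ← h9i]
      _ = w * ((t ^ 9)⁻¹ * (w * u * w) * t ^ 9) * w := by group
      _ = w * y⁻¹ * w := by rw [wuw, t9']
      _ = (w⁻¹ * y * w⁻¹)⁻¹ := by group
      _ = u⁻¹ := by rw [wi, wyw]
  have t9w : t ^ 9 * w * (t ^ 9)⁻¹ = w := by
    calc t ^ 9 * w * (t ^ 9)⁻¹
        = (t ^ 9 * y * (t ^ 9)⁻¹) * (t ^ 9 * u * (t ^ 9)⁻¹) * (t ^ 9 * y * (t ^ 9)⁻¹) := by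
          rw [hw]; group
      _ = (y * u * y)⁻¹ := by rw [t9, t9u]; group
      _ = w := by rw [← hw, wi]
  have t18 : t ^ 18 = 1 := by
    have h := conjw 9
    have e : t ^ 9 * w = w * t ^ 9 := by rw [← mul_inv_eq_iff_eq_mul]; exact t9w
    rw [← e, mul_assoc, ww, mul_one] at h
    calc t ^ 18 = t ^ 9 * t ^ 9 := by rw [← pow_add]
      _ = t ^ 9 * (t ^ 9)⁻¹ := by rw [← h]
      _ = 1 := mul_inv_cancel _
  refine ⟨w, t, ?_, ww, ?_, wtw, tyt, t18, ?_⟩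
  · rw [ht, mul_assoc, ww, mul_one]
  · rw [wyw, hw]; group
  · rw [hw, hu]; group

/-- The Bruhat normal form. -/
theorem normal_form {G : Type*} [Group G] (w t y : G) (h2 : y ^ 19 = 1)
    (ww : w * w = 1) (wyw : w * y * w = y⁻¹ * w * y⁻¹) (wtw : w * t * w = t⁻¹)
    (tyt : t * y * t⁻¹ = y ^ 2) (t18 : t ^ 18 = 1)
    (hgen : Subgroup.closure {t * w, y} = ⊤) (g : G) :
    ∃ i j : ℕ, g = y ^ i * t ^ j ∨ ∃ k : ℕ, g = y ^ i * t ^ j * w * y ^ k := by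
  have wi : w⁻¹ = w := inv_eq_of_mul_eq_one_left ww
  have yi : y⁻¹ = y ^ 18 := by
    rw [inv_eq_iff_mul_eq_one, ← pow_succ']; exact h2
  have ti : ∀ j : ℕ, (t ^ j)⁻¹ = t ^ (17 * j) := by
    intro j
    rw [inv_eq_iff_mul_eq_one, ← pow_add, show j + 17 * j = 18 * j by ring, pow_mul, t18, one_pow]
  have wt : ∀ n : ℕ, w * t ^ n = t ^ (17 * n) * w := by
    intro n
    have : (w * t * w⁻¹) ^ n = w * t ^ n * w⁻¹ := conj_pow
    rw [wi, wtw, inv_pow, ti] at this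
    rw [this, mul_assoc, ww, mul_one]
  have ty1 : ∀ i : ℕ, t * y ^ i = y ^ (2 * i) * t := by
    intro i
    rw [← mul_inv_eq_iff_eq_mul, ← conj_pow, tyt, pow_mul]
  have ty : ∀ j i : ℕ, t ^ j * y ^ i = y ^ (2 ^ j * i) * t ^ j := by
    intro j
    induction j with
    | zero => intro i; simp
    | succ j ih =>
      intro i
      rw [pow_succ, mul_assoc, ty1, ← mul_assoc, ih, mul_assoc, ← pow_succ, ← mul_assoc]
      ring_nf
  have yt : ∀ i j : ℕ, y ^ i * t ^ j = t ^ j * y ^ (2 ^ (17 * j) * i) := by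
    intro i j
    have h := ty (17 * j) i
    rw [← ti] at h
    calc y ^ i * t ^ j = t ^ j * ((t ^ j)⁻¹ * y ^ i) * t ^ j := by group
      _ = _ := by rw [h]; group
  have ymod : ∀ i : ℕ, y ^ i = y ^ (i % 19) := fun i => pow_eq_pow_mod i h2
  have wyy : ∀ i : ℕ, ∃ i' j' : ℕ, w * y ^ i * w = y ^ i' * t ^ j' ∨
      ∃ k, w * y ^ i * w = y ^ i' * t ^ j' * w * y ^ k := by
    intro i
    by_cases h0 : i % 19 = 0
    · refine ⟨0, 0, Or.inl ?_⟩
      rw [ymod, h0]; simp [ww]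
    · have : ∃ m : ℕ, 2 ^ m % 19 = i % 19 := by
        have hl : i % 19 < 19 := Nat.mod_lt _ (by norm_num)
        have : ∀ r < 19, r ≠ 0 → ∃ m < 18, 2 ^ m % 19 = r := by decide
        obtain ⟨m, _, hm⟩ := this _ hl h0
        exact ⟨m, hm⟩
      obtain ⟨m, hm⟩ := this
      have e : y ^ i = t ^ m * y * t ^ (17 * m) := by
        have := ty m 1
        rw [pow_one, mul_one] at this
        rw [this, mul_assoc, ← ti, mul_inv_cancel, mul_one, ymod, ← hm, ← ymod]
      refine ⟨2 ^ (17 * m) * 18, 17 * m + 17 * m, Or.inr ⟨2 ^ (17 * m) * 18, ?_⟩⟩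
      have wt' : t ^ (17 * m) * w = w * t ^ m := (wt m).symm
      calc w * y ^ i * w = (w * t ^ m) * y * (t ^ (17 * m) * w) := by rw [e]; group
        _ = t ^ (17 * m) * (w * y * w) * t ^ m := by
            rw [wt']; simp only [← mul_assoc]; rw [wt']
        _ = (t ^ (17 * m) * y ^ 18) * w * (y ^ 18 * t ^ m) := by rw [wyw, yi]; group
        _ = y ^ (2 ^ (17 * m) * 18) * t ^ (17 * m) * (w * t ^ m) * y ^ (2 ^ (17 * m) * 18) := by
            rw [yt, ty]; simp only [mul_assoc]
        _ = _ := by rw [wt]; simp only [pow_add, mul_assoc]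
  -- closure under left multiplication
  let P : G → Prop := fun g => ∃ i j : ℕ, g = y ^ i * t ^ j ∨ ∃ k : ℕ, g = y ^ i * t ^ j * w * y ^ k
  have Py : ∀ (n : ℕ) g, P g → P (y ^ n * g) := by
    rintro n g ⟨i, j, rfl | ⟨k, rfl⟩⟩
    · exact ⟨n + i, j, Or.inl (by simp only [pow_add, mul_assoc])⟩
    · exact ⟨n + i, j, Or.inr ⟨k, by simp only [pow_add, mul_assoc]⟩⟩
  have Pt : ∀ (n : ℕ) g, P g → P (t ^ n * g) := by
    rintro n g ⟨i, j, rfl | ⟨k, rfl⟩⟩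
    · exact ⟨2 ^ n * i, n + j, Or.inl (by rw [← mul_assoc, ty, mul_assoc, ← pow_add])⟩
    · refine ⟨2 ^ n * i, n + j, Or.inr ⟨k, ?_⟩⟩
      simp only [← mul_assoc]
      rw [ty, pow_add]; simp only [mul_assoc]
  have Pyr : ∀ (n : ℕ) g, P g → P (g * y ^ n) := by
    rintro n g ⟨i, j, rfl | ⟨k, rfl⟩⟩
    · exact ⟨i + 2 ^ j * n, j, Or.inl (by rw [mul_assoc, ty, ← mul_assoc, ← pow_add])⟩
    · exact ⟨i, j, Or.inr ⟨k + n, by simp only [pow_add, mul_assoc]⟩⟩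
  have Pw : ∀ g, P g → P (w * g) := by
    rintro g ⟨i, j, rfl | ⟨k, rfl⟩⟩
    · rw [yt, ← mul_assoc, wt]
      exact ⟨0, 17 * j, Or.inr ⟨2 ^ (17 * j) * i, by rw [pow_zero, one_mul]⟩⟩
    · have : w * (y ^ i * t ^ j * w * y ^ k)
          = t ^ (17 * j) * ((w * y ^ (2 ^ (17 * j) * i) * w) * y ^ k) := by
        rw [yt]; simp only [← mul_assoc]; rw [wt]
      rw [this]
      apply Pt
      apply Pyr
      exact wyy _
  have Ptw : ∀ g, P g → P (t * w * g) := by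
    intro g hg
    have := Pt 1 _ (Pw g hg)
    rwa [pow_one, ← mul_assoc] at this
  have hg : g ∈ Subgroup.closure {t * w, y} := by rw [hgen]; trivial
  change P g
  induction hg using Subgroup.closure_induction_left with
  | one => exact ⟨0, 0, Or.inl (by simp)⟩
  | mul_left x hx z _ ih =>
    rcases hx with rfl | rfl
    · exact Ptw _ ih
    · simpa using Py 1 _ ih
  | inv_mul_cancel x hx z _ ih =>
    rcases hx with rfl | rfl
    · have : (t * w)⁻¹ = t * w := by
        rw [mul_inv_rev, wi, ← wtw]
        calc w * (w * t * w) = (w * w) * t * w := by group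
          _ = _ := by rw [ww, one_mul]
      rw [this]
      exact Ptw _ ih
    · rw [yi]; exact Py _ _ ih

instance : Fact (Nat.Prime 19) := ⟨by norm_num⟩

theorem mem_center_of {M : GL2_19} (h01 : M.1 0 1 = 0) (h10 : M.1 1 0 = 0)
    (h : M.1 0 0 = M.1 1 1) : M ∈ Subgroup.center GL2_19 := by
  rw [Subgroup.mem_center_iff]
  intro N
  ext i j
  simp only [Units.val_mul, Matrix.mul_apply, Fin.sum_univ_two]
  fin_cases i <;> fin_cases j <;> simp [h01, h10, h, mul_comm]

/-- `[[0, -2], [1, 0]]` -/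
def mA : GL2_19 := ⟨!![0, -2; 1, 0], !![0, 1; 9, 0], by decide, by decide⟩
/-- `[[1, 1], [0, 1]]` -/
def mB : GL2_19 := ⟨!![1, 1; 0, 1], !![1, -1; 0, 1], by decide, by decide⟩
/-- `[[2, 0], [0, 1]]` -/
def mT : GL2_19 := ⟨!![2, 0; 0, 1], !![10, 0; 0, 1], by decide, by decide⟩
/-- `[[0, -1], [1, 0]]` -/
def mW : GL2_19 := ⟨!![0, -1; 1, 0], !![0, 1; -1, 0], by decide, by decide⟩

theorem of_center {M : GL2_19} (h : M ∈ Subgroup.center GL2_19) :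
    M.1 0 1 = 0 ∧ M.1 1 0 = 0 ∧ M.1 0 0 = M.1 1 1 := by
  rw [Subgroup.mem_center_iff] at h
  have h1 := congrArg Units.val (h mB)
  have h2 := congrArg Units.val (h mT)
  have e1 := congrFun (congrFun h1 0) 1
  have e2 := congrFun (congrFun h2 0) 1
  have e3 := congrFun (congrFun h1 0) 0
  simp [mB, mT, Matrix.mul_apply, Fin.sum_univ_two] at e1 e2 e3
  refine ⟨?_, e3, ?_⟩
  · linear_combination e2
  · linear_combination -e1

theorem mB_pow (n : ℕ) : (mB ^ n).1 = !![1, (n : ZMod 19); 0, 1] := by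
  induction n with
  | zero => ext i j; fin_cases i <;> fin_cases j <;> simp
  | succ n ih =>
    rw [pow_succ, Units.val_mul, ih]
    ext i j; fin_cases i <;> fin_cases j <;> simp [mB, Matrix.mul_apply, add_comm]

theorem mT_pow (n : ℕ) : (mT ^ n).1 = !![(2 : ZMod 19) ^ n, 0; 0, 1] := by
  induction n with
  | zero => ext i j; fin_cases i <;> fin_cases j <;> simp
  | succ n ih =>
    rw [pow_succ, Units.val_mul, ih]
    ext i j; fin_cases i <;> fin_cases j <;> simp [mT, Matrix.mul_apply, pow_succ]

theorem mBT (i j : ℕ) : (mB ^ i * mT ^ j).1 = !![(2 : ZMod 19) ^ j, (i : ZMod 19); 0, 1] := by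
  rw [Units.val_mul, mB_pow, mT_pow]
  ext r s; fin_cases r <;> fin_cases s <;> simp [Matrix.mul_apply]

theorem mBTWB (i j k : ℕ) : (mB ^ i * mT ^ j * mW * mB ^ k).1 =
    !![(i : ZMod 19), i * k - 2 ^ j; 1, (k : ZMod 19)] := by
  rw [Units.val_mul, Units.val_mul, mBT, mB_pow]
  ext r s; fin_cases r <;> fin_cases s <;> simp [mW, Matrix.mul_apply, sub_eq_add_neg]

/-- the quotient map -/
abbrev q : GL2_19 →* PGL2_19 := QuotientGroup.mk' (Subgroup.center GL2_19)

theorem q_eq_one {M : GL2_19} : q M = 1 ↔ M ∈ Subgroup.center GL2_19 := by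
  rw [← MonoidHom.mem_ker, QuotientGroup.ker_mk']

theorem q_eq {M N : GL2_19} (c : ZMod 19) (h : M.1 = c • N.1) : q M = q N := by
  have : q (N⁻¹ * M) = 1 := by
    have e : (N⁻¹ * M).1 = c • (1 : Matrix (Fin 2) (Fin 2) (ZMod 19)) := by
      rw [Units.val_mul, h, Matrix.mul_smul, ← Units.val_mul, inv_mul_cancel, Units.val_one]
    rw [q_eq_one]
    apply mem_center_of <;> rw [e] <;> simp
  rw [map_mul, map_inv, inv_mul_eq_one] at this
  exact this.symm

theorem mW_eq : q mW = q mB * q mA * q mB ^ 2 * q mA * q mB := by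
  simp only [← map_mul, ← map_pow]
  apply q_eq (10 : ZMod 19)
  decide

theorem relA : q mA ^ 2 = 1 := by
  rw [← map_pow, ← map_one q]; apply q_eq (-2 : ZMod 19); decide
theorem relB : q mB ^ 19 = 1 := by
  rw [← map_pow, ← map_one q]; apply q_eq (1 : ZMod 19)
  rw [mB_pow]; decide
theorem relC : (q mA * q mB ^ 2) ^ 4 = 1 := by
  rw [← map_pow, ← map_mul, ← map_pow, ← map_one q]; apply q_eq (-4 : ZMod 19); decide
theorem relD : (q mA * q mB * q mA * q mB ^ 2) ^ 3 = 1 := by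
  simp only [← map_pow, ← map_mul]
  rw [← map_one q]; apply q_eq (8 : ZMod 19); decide
theorem relT : q mA = q mT * q mW := by
  rw [← map_mul]; apply q_eq (1 : ZMod 19); decide

theorem exists_pow : ∀ d : ZMod 19, d ≠ 0 → ∃ m : ℕ, (2 : ZMod 19) ^ m = d := by
  have : ∀ d : ZMod 19, d ≠ 0 → ∃ m < 18, (2 : ZMod 19) ^ m = d := by decide
  intro d hd
  obtain ⟨m, _, h⟩ := this d hd
  exact ⟨m, h⟩

theorem presentation_pgl2_19 : Nonempty (PresentedGroup rels ≃* PGL2_19) := by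
  let f : Fin 2 → PGL2_19 := ![q mA, q mB]
  have hf : ∀ r ∈ rels, FreeGroup.lift f r = 1 := by
    rintro r (rfl | rfl | rfl | rfl)
    · simpa [f] using relA
    · simpa [f] using relB
    · simpa [f] using relC
    · simpa [f] using relD
  let F : PresentedGroup rels →* PGL2_19 := PresentedGroup.toGroup hf
  obtain ⟨x, hx⟩ : ∃ x : PresentedGroup rels, x = PresentedGroup.of 0 := ⟨_, rfl⟩
  obtain ⟨y, hy⟩ : ∃ y : PresentedGroup rels, y = PresentedGroup.of 1 := ⟨_, rfl⟩
  have Fx : F x = q mA := by rw [hx]; exact PresentedGroup.toGroup.of hf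
  have Fy : F y = q mB := by rw [hy]; exact PresentedGroup.toGroup.of hf
  have hrel : ∀ r ∈ rels, PresentedGroup.mk rels r = 1 := fun r hr =>
    PresentedGroup.one_of_mem hr
  have h1 : x ^ 2 = 1 := by
    rw [hx]; exact hrel (a ^ 2) (by simp [rels])
  have h2 : y ^ 19 = 1 := by
    rw [hy]; exact hrel (b ^ 19) (by simp [rels])
  have h3 : (x * y ^ 2) ^ 4 = 1 := by
    rw [hx, hy]; exact hrel ((a * b ^ 2) ^ 4) (by simp [rels])
  have h4 : (x * y * x * y ^ 2) ^ 3 = 1 := by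
    rw [hx, hy]; exact hrel ((a * b * a * b ^ 2) ^ 3) (by simp [rels])
  obtain ⟨w, t, hxt, ww, wyw, wtw, tyt, t18, hw⟩ := key x y h1 h2 h3 h4
  have hgen : Subgroup.closure {t * w, y} = ⊤ := by
    rw [← hxt, ← PresentedGroup.closure_range_of rels]
    congr 1
    ext z
    simp [Fin.exists_fin_two, hx, hy, eq_comm]
  have nf := normal_form w t y h2 ww wyw wtw tyt t18 hgen
  have Fw : F w = q mW := by
    rw [hw, mW_eq]; simp only [map_mul, map_pow, Fx, Fy]
  have Ft : F t = q mT := by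
    have := congrArg F hxt
    rw [map_mul, Fx, Fw, relT] at this
    exact (mul_right_cancel this).symm
  have F1 : ∀ i j : ℕ, F (y ^ i * t ^ j) = q (mB ^ i * mT ^ j) := by
    intro i j; simp only [map_mul, map_pow, Fy, Ft]
  have F2 : ∀ i j k : ℕ, F (y ^ i * t ^ j * w * y ^ k) = q (mB ^ i * mT ^ j * mW * mB ^ k) := by
    intro i j k; simp only [map_mul, map_pow, Fy, Ft, Fw]
  refine ⟨MulEquiv.ofBijective F ⟨?_, ?_⟩⟩
  · rw [injective_iff_map_eq_one]
    intro g hg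
    obtain ⟨i, j, rfl | ⟨k, rfl⟩⟩ := nf g
    · rw [F1, q_eq_one] at hg
      have := of_center hg
      rw [mBT] at this
      obtain ⟨e1, -, e3⟩ := this
      simp at e1 e3
      have hi : 19 ∣ i := (ZMod.natCast_eq_zero_iff i 19).1 e1
      have hj : t ^ j = 1 := by
        have e18 : (2 : ZMod 19) ^ 18 = 1 := by decide
        rw [pow_eq_pow_mod j e18] at e3
        have hl : j % 18 < 18 := Nat.mod_lt _ (by norm_num)
        have : ∀ r < 18, (2 : ZMod 19) ^ r = 1 → r = 0 := by decide
        rw [pow_eq_pow_mod j t18, this _ hl e3, pow_zero]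
      obtain ⟨i', rfl⟩ := hi
      rw [hj, pow_mul, h2, one_pow, one_mul]
    · rw [F2, q_eq_one] at hg
      have := (of_center hg).2.1
      rw [mBTWB] at this
      simp at this
  · intro z
    obtain ⟨M, rfl⟩ := QuotientGroup.mk'_surjective (Subgroup.center GL2_19) z
    have hdet : M.1 0 0 * M.1 1 1 - M.1 0 1 * M.1 1 0 ≠ 0 := by
      have : M.1.det ≠ 0 := (Matrix.isUnit_iff_isUnit_det _ |>.1 M.isUnit).ne_zero
      rwa [Matrix.det_fin_two] at this
    by_cases h : M.1 1 0 = 0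
    · rw [h, mul_zero, sub_zero] at hdet
      have hp := left_ne_zero_of_mul hdet
      have hs := right_ne_zero_of_mul hdet
      obtain ⟨j, hj⟩ := exists_pow (M.1 0 0 / M.1 1 1) (div_ne_zero hp hs)
      refine ⟨y ^ (M.1 0 1 / M.1 1 1).val * t ^ j, ?_⟩
      rw [F1]
      symm
      apply q_eq (M.1 1 1)
      rw [mBT, hj, ZMod.natCast_zmod_val]
      ext r s; fin_cases r <;> fin_cases s <;> simp [h] <;> field_simp
    · obtain ⟨j, hj⟩ := exists_pow
        ((M.1 0 0 * M.1 1 1 - M.1 0 1 * M.1 1 0) / (M.1 1 0) ^ 2)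
        (div_ne_zero hdet (pow_ne_zero _ h))
      refine ⟨y ^ (M.1 0 0 / M.1 1 0).val * t ^ j * w * y ^ (M.1 1 1 / M.1 1 0).val, ?_⟩
      rw [F2]
      symm
      apply q_eq (M.1 1 0)
      rw [mBTWB, hj, ZMod.natCast_zmod_val, ZMod.natCast_zmod_val]
      ext r s; fin_cases r <;> fin_cases s <;> simp <;> field_simp <;> ring

end Stmt14
end
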